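/- arXiv:1703.10377 — 3 statements merged into one kernel-verified Lean document; each statement's English description precedes it below -/
import Mathlib

section
/- Let Q be a set of prime numbers having natural density c ≥ 0 within the primes, i.e. #{p ∈ Q : p ≤ x} / #{p prime : p ≤ x} → c as x → ∞. Then, as x → ∞, Σ_{p ∈ Q, p ≤ x} (log p)/p = c·(log x − log log x) + o(log x); in particular, if c > 0 then Σ_{p ∈ Q, p ≤ x} (log p)/p is asymptotically equivalent to c·(log x − log log x). -/
open Filter Real Asymptotics

lemma aux_abel (a b g : ℕ → ℝ) (hg0 : ∀ n, 0 ≤ g n) (hg : ∀ n, 3 ≤ n → g (n + 1) ≤ g n)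
    (C : ℝ) (h : ∀ n, ∑ i ∈ Finset.range n, a i ≤ ∑ i ∈ Finset.range n, b i + C) :
    ∃ K, ∀ n, ∑ i ∈ Finset.range n, a i * g i ≤ ∑ i ∈ Finset.range n, b i * g i + K := by
  set T : ℕ → ℝ := fun n => ∑ i ∈ Finset.range n, b i + C - ∑ i ∈ Finset.range n, a i with hT
  have hT0 : ∀ n, 0 ≤ T n := fun n => by have := h n; simp only [hT]; linarith
  set W : ℕ → ℝ := fun n => ∑ i ∈ Finset.range n, b i * g i - ∑ i ∈ Finset.range n, a i * g i
    with hW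
  have key : ∀ n, 3 ≤ n → T n * g n ≤ W n + (T 3 * g 3 - W 3) := by
    intro n hn
    induction n, hn using Nat.le_induction with
    | base => linarith
    | succ n hn ih =>
      have h1 : W (n + 1) = W n + (b n - a n) * g n := by
        simp only [hW, Finset.sum_range_succ]; ring
      have h2 : T (n + 1) = T n + (b n - a n) := by
        simp only [hT, Finset.sum_range_succ]; ring
      have h3 : T (n + 1) * g (n + 1) ≤ T (n + 1) * g n :=
        mul_le_mul_of_nonneg_left (hg n hn) (hT0 _)
      rw [h1]
      rw [h2] at h3 ⊢
      linarith
  refine ⟨|T 3 * g 3 - W 3| + |W 0| + |W 1| + |W 2|, fun n => ?_⟩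
  have : 0 ≤ W n + (|T 3 * g 3 - W 3| + |W 0| + |W 1| + |W 2|) := by
    have a0 := abs_nonneg (W 0)
    have a1 := abs_nonneg (W 1)
    have a2 := abs_nonneg (W 2)
    have a3 := abs_nonneg (T 3 * g 3 - W 3)
    have b0 := neg_abs_le (W 0)
    have b1 := neg_abs_le (W 1)
    have b2 := neg_abs_le (W 2)
    by_cases hn : 3 ≤ n
    · have := key n hn
      have := mul_nonneg (hT0 n) (hg0 n)
      have := le_abs_self (T 3 * g 3 - W 3)
      linarith
    · push Not at hn
      interval_cases n <;> linarith
  simp only [hW] at this ⊢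
  linarith

open ArithmeticFunction in
lemma aux_mertens_vm (N : ℕ) (hN : 1 ≤ N) :
    |∑ n ∈ Finset.Ioc 0 N, vonMangoldt n / n - Real.log N| ≤ Real.log 4 + 5 := by
  have hNr : (0 : ℝ) < N := by exact_mod_cast hN
  have h1 : ∑ n ∈ Finset.Ioc 0 N, vonMangoldt n * ((N / n : ℕ) : ℝ)
      = ∑ n ∈ Finset.Ioc 0 N, Real.log n := by
    rw [← sum_Ioc_mul_zeta_eq_sum, vonMangoldt_mul_zeta]
    simp
  have h2 : ∑ n ∈ Finset.Ioc 0 N, Real.log n = Real.log (N.factorial) := by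
    clear h1 hNr hN
    induction N with
    | zero => simp
    | succ n ih =>
      rw [Finset.sum_Ioc_succ_top (by omega), ih, Nat.factorial_succ, Nat.cast_mul,
        Real.log_mul (by positivity) (by positivity)]
      ring
  have h3 : N * Real.log N - N ≤ Real.log (N.factorial) := by
    have := Stirling.le_log_factorial_stirling (n := N) (by omega)
    have h5 : 0 ≤ Real.log N := Real.log_natCast_nonneg _
    have h6 : 0 ≤ Real.log (2 * Real.pi) := Real.log_nonneg (by linarith [Real.pi_gt_three])
    linarith
  have h4 : Real.log (N.factorial) ≤ N * Real.log N := by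
    rw [← Real.log_pow]
    apply Real.log_le_log (by positivity)
    exact_mod_cast Nat.factorial_le_pow N
  set S := ∑ n ∈ Finset.Ioc 0 N, vonMangoldt n / n with hS
  have h7 : Real.log (N.factorial) ≤ N * S := by
    rw [← h2, ← h1, hS, Finset.mul_sum]
    refine Finset.sum_le_sum fun n hn => ?_
    have : ((N / n : ℕ) : ℝ) ≤ N / n := Nat.cast_div_le
    calc _ ≤ vonMangoldt n * ((N : ℝ) / n) :=
          mul_le_mul_of_nonneg_left this vonMangoldt_nonneg
      _ = _ := by ring
  have h8 : N * S - Chebyshev.psi N ≤ Real.log (N.factorial) := by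
    rw [← h2, ← h1, hS, Finset.mul_sum, Chebyshev.psi, Nat.floor_natCast, ← Finset.sum_sub_distrib]
    refine Finset.sum_le_sum fun n hn => ?_
    have : (N : ℝ) / n ≤ ((N / n : ℕ) : ℝ) + 1 := by
      rw [← Nat.floor_div_eq_div (K := ℝ)]
      exact (Nat.lt_floor_add_one _).le
    have := mul_le_mul_of_nonneg_left this (vonMangoldt_nonneg (n := n))
    have e : (N : ℝ) * (vonMangoldt n / n) = vonMangoldt n * ((N : ℝ) / n) := by ring
    rw [e]
    linarith
  have h9 := Chebyshev.psi_le_const_mul_self hNr.le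
  rw [abs_le]
  have h10 := Real.log_nonneg (show (1 : ℝ) ≤ 4 by norm_num)
  constructor
  · have : N * (Real.log N - 1) ≤ N * S := by linarith
    have := le_of_mul_le_mul_left this hNr
    linarith
  · have : N * S ≤ N * (Real.log N + (Real.log 4 + 4)) := by linarith
    have := le_of_mul_le_mul_left this hNr
    linarith

open Classical in
noncomputable def auxInd (Q : Set ℕ) (n : ℕ) : ℝ := if n ∈ Q then 1 else 0

open ArithmeticFunction in
lemma aux_mertens : ∃ K : ℝ, ∀ N : ℕ, 1 ≤ N →
    |∑ n ∈ Finset.range (N + 1), auxInd {p | p.Prime} n * (Real.log n / n) - Real.log N| ≤ K := by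
  have hs := vonMangoldt.summable_residueClass_non_primes_div (q := 1) (a := 0)
  set F : ℕ → ℝ := fun n => (if n.Prime then 0 else vonMangoldt.residueClass (0 : ZMod 1) n) / n
    with hF
  have hF0 : ∀ n, 0 ≤ F n := fun n => by
    simp only [hF]
    have := vonMangoldt.residueClass_nonneg (0 : ZMod 1) n
    split_ifs <;> positivity
  have hr : ∀ n, vonMangoldt.residueClass (0 : ZMod 1) n = vonMangoldt n := by
    intro n
    simp only [vonMangoldt.residueClass]
    apply Set.indicator_of_mem
    exact Subsingleton.elim _ _
  refine ⟨Real.log 4 + 5 + ∑' n, F n, fun N hN => ?_⟩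
  have h1 := aux_mertens_vm N hN
  have h2 : ∑ n ∈ Finset.range (N + 1), auxInd {p | p.Prime} n * (Real.log n / n)
      = ∑ n ∈ Finset.Ioc 0 N, vonMangoldt n / n - ∑ n ∈ Finset.Ioc 0 N, F n := by
    rw [Finset.range_eq_Ico, ← Finset.sum_sub_distrib, Finset.sum_eq_sum_Ico_succ_bot (by omega)]
    simp only [Nat.cast_zero, div_zero, mul_zero, zero_add]
    refine Finset.sum_congr (by ext; simp; omega) fun n hn => ?_
    simp only [hF, auxInd, hr, Set.mem_ofPred_eq]
    split_ifs with hp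
    · rw [vonMangoldt_apply_prime hp]; simp
    · simp
  have h3 : ∑ n ∈ Finset.Ioc 0 N, F n ≤ ∑' n, F n := hs.sum_le_tsum _ fun n _ => hF0 n
  have h4 : 0 ≤ ∑ n ∈ Finset.Ioc 0 N, F n := Finset.sum_nonneg fun n _ => hF0 n
  rw [h2]
  rw [abs_le] at h1 ⊢
  constructor <;> linarith

lemma aux_set (Q : Set ℕ) (x : ℝ) (hx : 0 ≤ x) [DecidablePred (· ∈ Q)] :
    {p : ℕ | p ∈ Q ∧ (p : ℝ) ≤ x} = ((Finset.range (⌊x⌋₊ + 1)).filter (· ∈ Q) : Finset ℕ) := by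
  ext p
  simp [Nat.le_floor_iff hx, and_comm]

lemma aux_ncard (Q : Set ℕ) (x : ℝ) (hx : 0 ≤ x) :
    ({p : ℕ | p ∈ Q ∧ (p : ℝ) ≤ x}.ncard : ℝ) = ∑ n ∈ Finset.range (⌊x⌋₊ + 1), auxInd Q n := by
  classical
  rw [aux_set Q x hx, Set.ncard_coe_finset]
  simp only [auxInd, Finset.sum_boole]

lemma aux_finsum (Q : Set ℕ) (x : ℝ) (hx : 0 ≤ x) (f : ℕ → ℝ) :
    ∑ᶠ p ∈ {p : ℕ | p ∈ Q ∧ (p : ℝ) ≤ x}, f p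
      = ∑ n ∈ Finset.range (⌊x⌋₊ + 1), auxInd Q n * f n := by
  classical
  rw [aux_set Q x hx, finsum_mem_coe_finset, Finset.sum_filter]
  refine Finset.sum_congr rfl fun n _ => ?_
  simp only [auxInd]
  split_ifs <;> simp

lemma aux_main (Q : Set ℕ) (c : ℝ)
    (hdens : Tendsto (fun x : ℝ =>
        (({p | p ∈ Q ∧ (p : ℝ) ≤ x}.ncard : ℝ) /
          ({p : ℕ | p.Prime ∧ (p : ℝ) ≤ x}.ncard : ℝ)))
      atTop (nhds c)) (ε : ℝ) (hε : 0 < ε) :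
    ∃ K : ℝ, ∀ x : ℝ, 1 ≤ x →
      |(∑ᶠ p ∈ {p : ℕ | p ∈ Q ∧ (p : ℝ) ≤ x}, Real.log p / p) - c * Real.log x|
        ≤ ε * Real.log x + K := by
  set u := auxInd {p | p.Prime} with hu
  set q := auxInd Q with hq
  obtain ⟨x0, hx0⟩ := eventually_atTop.1 (hdens.eventually (Metric.ball_mem_nhds c hε))
  -- bound
  have hbd : ∃ C : ℝ, ∀ n, |∑ i ∈ Finset.range n, q i - c * ∑ i ∈ Finset.range n, u i|
      ≤ ε * ∑ i ∈ Finset.range n, u i + C := by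
    set M := ⌈x0⌉₊ + 3 with hM
    set D : ℕ → ℝ := fun n => |∑ i ∈ Finset.range n, q i - c * ∑ i ∈ Finset.range n, u i| with hD
    have hu0 : ∀ n, 0 ≤ ∑ i ∈ Finset.range n, u i := fun n =>
      Finset.sum_nonneg fun i _ => by simp only [hu, auxInd]; split_ifs <;> norm_num
    refine ⟨∑ i ∈ Finset.range M, D i, fun n => ?_⟩
    have hDs : 0 ≤ ∑ i ∈ Finset.range M, D i := Finset.sum_nonneg fun i _ => abs_nonneg _
    by_cases hn : n < M
    · have : D n ≤ ∑ i ∈ Finset.range M, D i :=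
        Finset.single_le_sum (f := D) (fun i _ => abs_nonneg _) (Finset.mem_range.2 hn)
      have := mul_nonneg hε.le (hu0 n)
      change D n ≤ _
      linarith
    · push Not at hn
      obtain ⟨m, rfl⟩ : ∃ m, n = m + 1 := ⟨n - 1, by omega⟩
      have h1 := hx0 (m : ℝ) (by
        have : x0 ≤ ⌈x0⌉₊ := Nat.le_ceil _
        have h2 : ((⌈x0⌉₊ : ℕ) : ℝ) ≤ m := by exact_mod_cast (by omega)
        linarith)
      have e := aux_ncard {p | p.Prime} (m : ℝ) (by positivity)
      simp only [Set.mem_ofPred_eq] at e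
      rw [Real.dist_eq, aux_ncard Q _ (by positivity), e,
        Nat.floor_natCast, ← hq, ← hu] at h1
      have hpos : 0 < ∑ i ∈ Finset.range (m + 1), u i := by
        refine Finset.sum_pos' (fun i _ => by simp only [hu, auxInd]; split_ifs <;> norm_num)
          ⟨2, Finset.mem_range.2 (by omega), ?_⟩
        simp [hu, auxInd, Nat.prime_two]
      have h2 := mul_le_mul_of_nonneg_right h1.le hpos.le
      rw [← abs_of_pos hpos, ← abs_mul, abs_of_pos hpos, sub_mul, div_mul_cancel₀ _ hpos.ne'] at h2
      linarith
  obtain ⟨C, hC⟩ := hbd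
  set g : ℕ → ℝ := fun n => Real.log n / n with hg
  have hg0 : ∀ n, 0 ≤ g n := fun n => div_nonneg (Real.log_natCast_nonneg _) (by positivity)
  have hg1 : ∀ n, 3 ≤ n → g (n + 1) ≤ g n := by
    intro n hn
    have h3 : Real.exp 1 ≤ n := by
      have := Real.exp_one_lt_d9
      have : (3 : ℝ) ≤ n := by exact_mod_cast hn
      linarith
    refine Real.log_div_self_antitoneOn h3 ?_ (by push_cast; linarith)
    rw [Set.mem_Ici, Nat.cast_add, Nat.cast_one]
    linarith
  obtain ⟨K1, hK1⟩ := aux_abel q (fun i => (c + ε) * u i) g hg0 hg1 C (fun n => by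
    have := (abs_le.1 (hC n)).2
    rw [← Finset.mul_sum]; linarith)
  obtain ⟨K2, hK2⟩ := aux_abel (fun i => (c - ε) * u i) q g hg0 hg1 C (fun n => by
    have := (abs_le.1 (hC n)).1
    rw [← Finset.mul_sum]; linarith)
  obtain ⟨K0, hK0⟩ := aux_mertens
  refine ⟨|K1| + |K2| + (|c| + ε) * (K0 + Real.log 2), fun x hx => ?_⟩
  have hN : 1 ≤ ⌊x⌋₊ := Nat.le_floor (by simpa using hx)
  have hNr : (1 : ℝ) ≤ ⌊x⌋₊ := by exact_mod_cast hN
  rw [aux_finsum Q x (by linarith)]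
  have k1 := hK1 (⌊x⌋₊ + 1)
  have k2 := hK2 (⌊x⌋₊ + 1)
  have k0 := hK0 ⌊x⌋₊ hN
  simp only [mul_assoc] at k1 k2
  rw [← Finset.mul_sum] at k1 k2
  change |∑ n ∈ Finset.range (⌊x⌋₊ + 1), u n * g n - _| ≤ K0 at k0
  change |∑ n ∈ Finset.range (⌊x⌋₊ + 1), q n * g n - _| ≤ _
  set A := ∑ n ∈ Finset.range (⌊x⌋₊ + 1), u n * g n
  set B := ∑ n ∈ Finset.range (⌊x⌋₊ + 1), q n * g n
  have l1 : Real.log ⌊x⌋₊ ≤ Real.log x :=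
    Real.log_le_log (by linarith) (Nat.floor_le (by linarith))
  have l2 : Real.log x ≤ Real.log ⌊x⌋₊ + Real.log 2 := by
    rw [← Real.log_mul (by positivity) (by norm_num)]
    apply Real.log_le_log (by linarith)
    have := Nat.lt_floor_add_one x
    linarith
  have hA : |A - Real.log x| ≤ K0 + Real.log 2 := by
    rw [abs_le] at k0 ⊢
    constructor <;> linarith
  have m1 : |c * (A - Real.log x)| ≤ |c| * (K0 + Real.log 2) := by
    rw [abs_mul]; exact mul_le_mul_of_nonneg_left hA (abs_nonneg _)
  have m2 : ε * (A - Real.log x) ≤ ε * (K0 + Real.log 2) :=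
    mul_le_mul_of_nonneg_left (abs_le.1 hA).2 hε.le
  have := le_abs_self K1
  have := le_abs_self K2
  have := abs_nonneg K1
  have := abs_nonneg K2
  rw [abs_le] at m1 ⊢
  constructor <;> nlinarith

/-- If a set `Q` of primes has natural density `c ≥ 0` within the primes,
then `∑_{p ∈ Q, p ≤ x} (log p)/p = c·(log x − log log x) + o(log x)`; in particular if
`c > 0` the sum is asymptotically equivalent to `c·(log x − log log x)`. -/
theorem stmt_0 (Q : Set ℕ) (hQ : ∀ p ∈ Q, p.Prime) (c : ℝ) (hc : 0 ≤ c)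
    (hdens : Tendsto (fun x : ℝ =>
        (({p | p ∈ Q ∧ (p : ℝ) ≤ x}.ncard : ℝ) /
          ({p : ℕ | p.Prime ∧ (p : ℝ) ≤ x}.ncard : ℝ)))
      atTop (nhds c)) :
    ((fun x : ℝ =>
        (∑ᶠ p ∈ {p : ℕ | p ∈ Q ∧ (p : ℝ) ≤ x}, Real.log p / p)
          - c * (Real.log x - Real.log (Real.log x))) =o[atTop] Real.log)
    ∧ (0 < c → Tendsto (fun x : ℝ =>
        (∑ᶠ p ∈ {p : ℕ | p ∈ Q ∧ (p : ℝ) ≤ x}, Real.log p / p)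
          / (c * (Real.log x - Real.log (Real.log x)))) atTop (nhds 1)) := by
  have hll : (fun x : ℝ => Real.log (Real.log x)) =o[atTop] Real.log :=
    Real.isLittleO_log_id_atTop.comp_tendsto Real.tendsto_log_atTop
  have h1 : (fun x : ℝ => (∑ᶠ p ∈ {p : ℕ | p ∈ Q ∧ (p : ℝ) ≤ x}, Real.log p / p)
      - c * Real.log x) =o[atTop] Real.log := by
    rw [isLittleO_iff]
    intro ε hε
    obtain ⟨K, hK⟩ := aux_main Q c hdens (ε / 2) (by positivity)
    filter_upwards [eventually_ge_atTop 1,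
      Real.tendsto_log_atTop.eventually_ge_atTop (K / (ε / 2))] with x hx hx2
    have h := hK x hx
    rw [div_le_iff₀ (by positivity)] at hx2
    rw [Real.norm_eq_abs, Real.norm_eq_abs, abs_of_nonneg (Real.log_nonneg hx)]
    refine h.trans ?_
    linarith
  have h2 : (fun x : ℝ =>
        (∑ᶠ p ∈ {p : ℕ | p ∈ Q ∧ (p : ℝ) ≤ x}, Real.log p / p)
          - c * (Real.log x - Real.log (Real.log x))) =o[atTop] Real.log := by
    refine (h1.add (hll.const_mul_left c)).congr_left fun x => ?_
    ring
  refine ⟨h2, fun hc0 => ?_⟩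
  have h3 : Real.log =O[atTop] (fun x => c * (Real.log x - Real.log (Real.log x))) := by
    have : (fun x : ℝ => Real.log x - Real.log (Real.log x)) ~[atTop] Real.log := by
      refine (hll.neg_left).congr_left fun x => ?_
      simp
    exact this.symm.isBigO.trans ((isBigO_refl _ _).const_mul_right hc0.ne')
  have h4 : (fun x : ℝ => (∑ᶠ p ∈ {p : ℕ | p ∈ Q ∧ (p : ℝ) ≤ x}, Real.log p / p)) ~[atTop]
      (fun x => c * (Real.log x - Real.log (Real.log x))) := h2.trans_isBigO h3
  refine (isEquivalent_iff_tendsto_one ?_).1 h4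
  filter_upwards [h3.eq_zero_imp, Real.tendsto_log_atTop.eventually_gt_atTop 0] with x hx hx1 h0
  exact hx1.ne' (hx h0)
end

section
/- Let F be a number field with ring of integers O_F, let P_F denote the set of nonzero prime ideals of O_F, and for a prime ideal 𝔭 let q_𝔭 denote the cardinality of the residue field O_F/𝔭 (the absolute norm of 𝔭). Suppose Q_F ⊆ P_F has natural density c > 0, i.e. #{𝔭 ∈ Q_F : q_𝔭 ≤ x} / #{𝔭 ∈ P_F : q_𝔭 ≤ x} → c as x → ∞. Then there exist a constant c₁ > 0 (depending only on Q_F and F) and x₀ > 0 such that for all x ≥ x₀ one has Σ_{𝔭 ∈ Q_F, q_𝔭 ≤ x} (log q_𝔭)/q_𝔭 ≥ c₁·log x. -/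
open Filter Real
open scoped nonZeroDivisors NumberField


namespace S2
variable (F : Type*) [Field F] [NumberField F]

theorem finA (n : ℕ) : {I : Ideal (𝓞 F) | I ≠ ⊥ ∧ Ideal.absNorm I ≤ n}.Finite :=
  (Ideal.finite_setOfPred_absNorm_le n).subset fun _ h => h.2

noncomputable def A (n : ℕ) : Finset (Ideal (𝓞 F)) := (finA F n).toFinset

theorem mem_A {n : ℕ} {I : Ideal (𝓞 F)} : I ∈ A F n ↔ I ≠ ⊥ ∧ Ideal.absNorm I ≤ n := by
  simp [A]

theorem pos_of {I : Ideal (𝓞 F)} (h : I ≠ ⊥) : 0 < Ideal.absNorm I :=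
  Nat.pos_of_ne_zero (by rwa [Ne, Ideal.absNorm_eq_zero_iff])

theorem count_tendsto : ∃ κ : ℝ, 0 < κ ∧
    Tendsto (fun n : ℕ => ((A F n).card : ℝ) / n) atTop (nhds κ) := by
  refine ⟨_, NumberField.dedekindZeta_residue_pos F, ?_⟩
  rw [NumberField.dedekindZeta_residue]
  refine Tendsto.congr ?_ ((NumberField.Ideal.tendsto_norm_le_div_atTop₀ F).comp
    tendsto_natCast_atTop_atTop)
  intro n
  simp only [Function.comp]
  congr 2
  rw [← Nat.card_eq_finsetCard]
  refine Nat.card_congr ⟨fun I => ⟨I.1.1, (mem_A F).2 ⟨nonZeroDivisors.ne_zero I.1.2,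
      by exact_mod_cast I.2⟩⟩,
    fun I => ⟨⟨I.1, mem_nonZeroDivisors_of_ne_zero ((mem_A F).1 I.2).1⟩,
      by exact_mod_cast ((mem_A F).1 I.2).2⟩, fun _ => rfl, fun _ => rfl⟩

theorem count_le : ∃ C : ℝ, 0 < C ∧ ∀ n : ℕ, ((A F n).card : ℝ) ≤ C * n := by
  obtain ⟨κ, hκ, h⟩ := count_tendsto F
  obtain ⟨C, hC⟩ := h.bddAbove_range
  refine ⟨max C 1, by positivity, fun n => ?_⟩
  rcases Nat.eq_zero_or_pos n with rfl | hn
  · have : A F 0 = ∅ := by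
      ext I
      simp only [mem_A, Finset.notMem_empty, iff_false, not_and]
      intro h1 h2
      have := pos_of F h1
      omega
    simp [this]
  · have h1 := hC ⟨n, rfl⟩
    have hn' : (0:ℝ) < n := by exact_mod_cast hn
    simp only at h1
    rw [div_le_iff₀ hn'] at h1
    exact h1.trans (by gcongr; exact le_max_left _ _)

open Classical in
theorem dvd_count (P : Ideal (𝓞 F)) (hP : P ≠ ⊥) (k n : ℕ) :
    ((A F n).filter (fun a => P ^ k ∣ a)).card ≤ (A F (n / Ideal.absNorm P ^ k)).card := by
  have h0 : P ^ k ≠ ⊥ := pow_ne_zero k hP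
  refine (Finset.card_le_card (t := (A F (n / Ideal.absNorm P ^ k)).image (fun b => P ^ k * b)) ?_).trans
    Finset.card_image_le
  intro a ha
  simp only [Finset.mem_filter, mem_A] at ha
  obtain ⟨⟨ha1, ha2⟩, b, rfl⟩ := ha
  refine Finset.mem_image.2 ⟨b, (mem_A F).2 ⟨?_, ?_⟩, rfl⟩
  · rintro rfl; exact ha1 (Ideal.mul_bot _)
  · rw [Nat.le_div_iff_mul_le (pow_pos (pos_of F hP) k)]
    rw [map_mul, map_pow] at ha2
    linarith

/-- primes -/
noncomputable def PP (n : ℕ) : Finset (Ideal (𝓞 F)) := by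
  classical exact (A F n).filter (fun P => P.IsPrime)

theorem mem_PP {n : ℕ} {I : Ideal (𝓞 F)} :
    I ∈ PP F n ↔ I.IsPrime ∧ I ≠ ⊥ ∧ Ideal.absNorm I ≤ n := by
  simp [PP, mem_A, and_comm]

open Classical UniqueFactorizationMonoid in
theorem log_le (n : ℕ) (a : Ideal (𝓞 F)) (ha : a ∈ A F n) :
    log (Ideal.absNorm a) ≤ ∑ P ∈ PP F n, ∑ k ∈ Finset.range n,
      if P ^ (k+1) ∣ a then log (Ideal.absNorm P) else 0 := by
  obtain ⟨h1, h2⟩ := (mem_A F).1 ha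
  have e : log (Ideal.absNorm a) =
      ((normalizedFactors a).map (fun P => log (Ideal.absNorm P))).sum := by
    have key : ∀ s : Multiset (Ideal (𝓞 F)), (∀ P ∈ s, P ≠ ⊥) → log (Ideal.absNorm s.prod) =
      (s.map (fun P => log (Ideal.absNorm P))).sum := by
      intro s
      induction s using Multiset.induction_on with
      | empty => simp
      | cons P s ih =>
        intro h
        rw [Multiset.prod_cons, Multiset.map_cons, Multiset.sum_cons, map_mul, Nat.cast_mul,
          log_mul, ih (fun Q hQ => h Q (Multiset.mem_cons_of_mem hQ))]
        · exact_mod_cast (pos_of F (h P (Multiset.mem_cons_self _ _))).ne'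
        · have : s.prod ≠ ⊥ := by
            apply Multiset.prod_ne_zero
            intro h0
            exact h _ (Multiset.mem_cons_of_mem h0) rfl
          exact_mod_cast (pos_of F this).ne'
    rw [← key _ (fun P hP => (prime_of_normalized_factor P hP).ne_zero),
      Ideal.prod_normalizedFactors_eq_self h1]
  rw [e, Finset.sum_multiset_map_count]
  have hpr : ∀ P ∈ normalizedFactors a, P ∈ PP F n := by
    intro P hP
    have hp := prime_of_normalized_factor P hP
    refine (mem_PP F).2 ⟨Ideal.isPrime_of_prime hp, hp.ne_zero, ?_⟩
    refine le_trans (Nat.le_of_dvd (pos_of F h1) ?_) h2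
    exact map_dvd _ (dvd_of_mem_normalizedFactors hP)
  refine (Finset.sum_le_sum ?_).trans (Finset.sum_le_sum_of_subset_of_nonneg
    (fun P hP => hpr P (Multiset.mem_toFinset.1 hP)) ?_)
  · intro P hP
    have hP := Multiset.mem_toFinset.1 hP
    have hp := prime_of_normalized_factor P hP
    have hq : 2 ≤ Ideal.absNorm P := by
      have := pos_of F hp.ne_zero
      have h3 : Ideal.absNorm P ≠ 1 := by
        rw [Ne, Ideal.absNorm_eq_one_iff]
        exact (Ideal.isPrime_of_prime hp).ne_top
      omega
    have hd : P ^ ((normalizedFactors a).count P) ∣ a := by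
      rw [dvd_iff_normalizedFactors_le_normalizedFactors (pow_ne_zero _ hp.ne_zero) h1,
        normalizedFactors_pow, normalizedFactors_irreducible hp.irreducible, normalize_eq,
        Multiset.nsmul_singleton, ← Multiset.le_count_iff_replicate_le]
    rw [← Finset.sum_filter, Finset.sum_const, nsmul_eq_mul, nsmul_eq_mul]
    refine mul_le_mul_of_nonneg_right ?_ (log_natCast_nonneg _)
    norm_cast
    set c := (normalizedFactors a).count P
    conv_lhs => rw [← Finset.card_range c]
    apply Finset.card_le_card
    intro k hk
    rw [Finset.mem_range] at hk
    simp only [Finset.mem_filter, Finset.mem_range]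
    refine ⟨?_, (pow_dvd_pow P hk).trans hd⟩
    have h4 : Ideal.absNorm P ^ c ≤ Ideal.absNorm a := by
      rw [← map_pow]
      exact Nat.le_of_dvd (pos_of F h1) (map_dvd _ hd)
    have h5 : 2 ^ c ≤ Ideal.absNorm P ^ c := Nat.pow_le_pow_left hq c
    have h6 := Nat.lt_two_pow_self (n := c)
    omega
  · intro P _ _
    refine Finset.sum_nonneg fun k _ => ?_
    split_ifs
    · exact log_natCast_nonneg _
    · rfl

theorem sum_log_le : ∃ C : ℝ, 0 < C ∧ ∀ n : ℕ, ∑ a ∈ A F n, log (Ideal.absNorm a) ≤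
    C * n * ∑ P ∈ PP F n, log (Ideal.absNorm P) / Ideal.absNorm P := by
  classical
  obtain ⟨C, hC, h⟩ := count_le F
  refine ⟨2 * C, by positivity, fun n => ?_⟩
  refine (Finset.sum_le_sum (fun a ha => log_le F n a ha)).trans ?_
  rw [Finset.sum_comm, Finset.mul_sum]
  refine Finset.sum_le_sum fun P hP => ?_
  obtain ⟨hp, hp0, hpn⟩ := (mem_PP F).1 hP
  have hq : 2 ≤ Ideal.absNorm P := by
    have := pos_of F hp0
    have h3 : Ideal.absNorm P ≠ 1 := by
      rw [Ne, Ideal.absNorm_eq_one_iff]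
      exact hp.ne_top
    omega
  rw [Finset.sum_comm]
  set q := Ideal.absNorm P with hqdef
  have hq' : (2:ℝ) ≤ q := by exact_mod_cast hq
  have h1 : ∀ k ∈ Finset.range n, ∑ a ∈ A F n, (if P ^ (k+1) ∣ a then log q else 0) ≤
      (C * n * log q / q) * ((1/2:ℝ)) ^ k := by
    intro k _
    rw [← Finset.sum_filter, Finset.sum_const, nsmul_eq_mul]
    have h2 : (((A F n).filter (fun a => P ^ (k+1) ∣ a)).card : ℝ) ≤ C * n / q * (1/2)^k := by
      calc (((A F n).filter (fun a => P ^ (k+1) ∣ a)).card : ℝ) ≤ (A F (n / q ^ (k+1))).card := by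
            exact_mod_cast dvd_count F P hp0 (k+1) n
        _ ≤ C * ((n / q ^ (k+1) : ℕ) : ℝ) := h _
        _ ≤ C * ((n:ℝ) / (q:ℝ) ^ (k+1)) := by
            gcongr
            exact_mod_cast Nat.cast_div_le (α := ℝ) (m := n) (n := q ^ (k+1))
        _ = C * n / q * (1/(q:ℝ))^k := by
            rw [pow_succ, one_div, inv_pow]; field_simp
        _ ≤ _ := by gcongr
    calc _ ≤ (C * n / q * (1/2)^k) * log q :=
          mul_le_mul_of_nonneg_right h2 (log_natCast_nonneg _)
      _ = _ := by ring
  refine (Finset.sum_le_sum h1).trans ?_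
  rw [← Finset.mul_sum]
  have h3 : ∑ i ∈ Finset.range n, (1/2:ℝ)^i ≤ 2 := sum_geometric_two_le n
  have h4 : 0 ≤ C * n * log q / q := by
    have := log_natCast_nonneg q
    positivity
  calc _ ≤ C * n * log q / q * 2 := mul_le_mul_of_nonneg_left h3 h4
    _ = _ := by ring

theorem mertens : ∃ c : ℝ, 0 < c ∧ ∀ᶠ n : ℕ in atTop,
    c * log n ≤ ∑ P ∈ PP F n, log (Ideal.absNorm P) / Ideal.absNorm P := by
  obtain ⟨κ, hκ, hlim⟩ := count_tendsto F
  obtain ⟨D, hD, hle⟩ := count_le F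
  obtain ⟨C, hC, hsum⟩ := sum_log_le F
  refine ⟨κ / (8 * C), by positivity, ?_⟩
  have e1 := hlim.eventually (lt_mem_nhds (show κ / 2 < κ by linarith))
  have e2 : ∀ᶠ n : ℕ in atTop, D * 4 / κ ≤ sqrt (n:ℝ) :=
    (tendsto_sqrt_atTop.comp tendsto_natCast_atTop_atTop).eventually_ge_atTop _
  filter_upwards [e1, e2, eventually_gt_atTop 1] with n h1 h2 h3
  have hn : (0:ℝ) < n := by exact_mod_cast (by omega : 0 < n)
  have hl : 0 ≤ log (n:ℝ) := log_natCast_nonneg n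
  rw [lt_div_iff₀ hn] at h1
  have hs : (Nat.sqrt n : ℝ) ≤ sqrt n := Real.nat_sqrt_le_real_sqrt
  have hss : sqrt (n:ℝ) * sqrt n = n := Real.mul_self_sqrt hn.le
  have h4 := hle (Nat.sqrt n)
  have h5 : D * sqrt n ≤ κ / 4 * n := by
    rw [div_le_iff₀ hκ] at h2
    nlinarith [Real.sqrt_nonneg (n:ℝ)]
  have h6 : ((A F (Nat.sqrt n)).card : ℝ) ≤ κ / 4 * n := by
    refine h4.trans (le_trans ?_ h5)
    gcongr
  have hsub : A F (Nat.sqrt n) ⊆ A F n := by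
    intro a ha
    rw [mem_A] at ha ⊢
    exact ⟨ha.1, ha.2.trans (Nat.sqrt_le_self n)⟩
  classical
  have h7 : κ / 4 * n ≤ ((A F n \ A F (Nat.sqrt n)).card : ℝ) := by
    rw [Finset.cast_card_sdiff hsub]
    linarith
  have h8 : ((A F n \ A F (Nat.sqrt n)).card : ℝ) * (log n / 2) ≤
      ∑ a ∈ A F n, log (Ideal.absNorm a) := by
    rw [← nsmul_eq_mul]
    refine (Finset.card_nsmul_le_sum _ (fun a => log (Ideal.absNorm a : ℝ)) _ ?_).trans
      (Finset.sum_le_sum_of_subset_of_nonneg Finset.sdiff_subset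
        fun _ _ _ => log_natCast_nonneg _)
    intro a ha
    simp only [Finset.mem_sdiff, mem_A, not_and, not_le] at ha
    have h9 := ha.2 ha.1.1
    rw [Nat.sqrt_lt'] at h9
    have h10 : log (n:ℝ) ≤ log ((Ideal.absNorm a : ℝ)^2) :=
      log_le_log hn (by exact_mod_cast h9.le)
    rw [log_pow] at h10
    push_cast at h10
    linarith
  have h9 := hsum n
  set S := ∑ P ∈ PP F n, log (Ideal.absNorm P) / Ideal.absNorm P
  have h10 : κ / 4 * n * (log n / 2) ≤ C * n * S := by
    refine le_trans ?_ (h8.trans h9)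
    gcongr
  have h11 : (κ / 8 * log n) * n ≤ (C * S) * n := by linarith
  have h12 := le_of_mul_le_mul_right h11 hn
  rw [div_mul_eq_mul_div, div_le_iff₀ (by positivity)]
  linarith

/-- Abel summation comparison -/
theorem abel (d g : ℕ → ℝ) (N₀ : ℕ) (hg : ∀ n ≥ N₀, g (n+1) ≤ g n) (hg0 : ∀ n, 0 ≤ g n)
    (hD : ∀ n ≥ N₀, 0 ≤ ∑ i ∈ Finset.range (n+1), d i) :
    ∃ M : ℝ, ∀ n ≥ N₀, M ≤ ∑ i ∈ Finset.range (n+1), d i * g i := by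
  refine ⟨∑ i ∈ Finset.range (N₀+1), d i * g i - (∑ i ∈ Finset.range (N₀+1), d i) * g N₀, ?_⟩
  have key : ∀ n ≥ N₀, ∑ i ∈ Finset.range (N₀+1), d i * g i - (∑ i ∈ Finset.range (N₀+1), d i) * g N₀
      ≤ ∑ i ∈ Finset.range (n+1), d i * g i - (∑ i ∈ Finset.range (n+1), d i) * g n := by
    intro n hn
    induction n, hn using Nat.le_induction with
    | base => exact le_rfl
    | succ n hn ih =>
      rw [Finset.sum_range_succ _ (n+1), Finset.sum_range_succ _ (n+1)]
      nlinarith [mul_nonneg (hD n hn) (sub_nonneg.2 (hg n hn))]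
  intro n hn
  have := key n hn
  have := mul_nonneg (hD n hn) (hg0 n)
  linarith

open Classical in
/-- elements of `Q` of norm at most `n` -/
noncomputable def QQ (Q : Set (Ideal (𝓞 F))) (n : ℕ) : Finset (Ideal (𝓞 F)) :=
  (A F n).filter (fun P => P ∈ Q)

theorem mem_QQ {Q : Set (Ideal (𝓞 F))} {n : ℕ} {P : Ideal (𝓞 F)} :
    P ∈ QQ F Q n ↔ P ∈ A F n ∧ P ∈ Q := by
  simp [QQ]

theorem fiber (Q : Set (Ideal (𝓞 F))) (n : ℕ) (g : ℕ → ℝ) :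
    ∑ P ∈ QQ F Q n, g (Ideal.absNorm P) = ∑ i ∈ Finset.range (n+1),
      (((QQ F Q i).filter (fun P => Ideal.absNorm P = i)).card : ℝ) * g i := by
  rw [← Finset.sum_fiberwise_of_maps_to (s := QQ F Q n) (t := Finset.range (n+1))
    (g := fun P => Ideal.absNorm P)
    (fun P hP => Finset.mem_range.2 (Nat.lt_succ_of_le
      ((mem_A F).1 ((mem_QQ F).1 hP).1).2))]
  refine Finset.sum_congr rfl fun i hi => ?_
  have hi := Finset.mem_range.1 hi
  have : (QQ F Q n).filter (fun P => Ideal.absNorm P = i) =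
      (QQ F Q i).filter (fun P => Ideal.absNorm P = i) := by
    ext P
    simp only [QQ, Finset.mem_filter, mem_A]
    constructor
    · rintro ⟨⟨⟨h1, h2⟩, h3⟩, h4⟩; exact ⟨⟨⟨h1, h4.le⟩, h3⟩, h4⟩
    · rintro ⟨⟨⟨h1, h2⟩, h3⟩, h4⟩; exact ⟨⟨⟨h1, by omega⟩, h3⟩, h4⟩
  rw [this, ← nsmul_eq_mul, ← Finset.sum_const]
  refine Finset.sum_congr rfl fun P hP => ?_
  rw [(Finset.mem_filter.1 hP).2]

theorem card_fiber (Q : Set (Ideal (𝓞 F))) (n : ℕ) :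
    ((QQ F Q n).card : ℝ) = ∑ i ∈ Finset.range (n+1),
      (((QQ F Q i).filter (fun P => Ideal.absNorm P = i)).card : ℝ) := by
  have := fiber F Q n (fun _ => 1)
  simpa using this

theorem compare (Q T : Set (Ideal (𝓞 F))) (c : ℝ)
    (h : ∀ᶠ n : ℕ in atTop, c * ((QQ F T n).card : ℝ) ≤ (QQ F Q n).card) :
    ∃ M : ℝ, ∀ᶠ n : ℕ in atTop,
      M + c * ∑ P ∈ QQ F T n, log (Ideal.absNorm P) / Ideal.absNorm P ≤
        ∑ P ∈ QQ F Q n, log (Ideal.absNorm P) / Ideal.absNorm P := by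
  obtain ⟨N, hN⟩ := eventually_atTop.1 h
  let a : Set (Ideal (𝓞 F)) → ℕ → ℝ :=
    fun Q i => ((QQ F Q i).filter (fun P => Ideal.absNorm P = i)).card
  obtain ⟨M, hM⟩ := abel (fun i => a Q i - c * a T i) (fun i => log i / i) (max N 3) (by
      intro n hn
      have h3 : (3:ℝ) ≤ n := by exact_mod_cast (le_max_right _ _).trans hn
      have he := exp_one_lt_d9
      apply log_div_self_antitoneOn
      · simp only [Set.mem_Ici]; linarith
      · simp only [Set.mem_Ici]; push_cast; linarith
      · push_cast; linarith) (fun n => div_nonneg (log_natCast_nonneg n) (Nat.cast_nonneg n)) (by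
      intro n hn
      have h1 := hN n ((le_max_left _ _).trans hn)
      rw [card_fiber, card_fiber] at h1
      rw [Finset.sum_sub_distrib, ← Finset.mul_sum]
      linarith)
  refine ⟨M, ?_⟩
  filter_upwards [eventually_ge_atTop (max N 3)] with n hn
  have h2 := hM n hn
  have e1 := fiber F Q n (fun i => log i / i)
  have e2 := fiber F T n (fun i => log i / i)
  rw [e1, e2]
  simp only [sub_mul, mul_assoc] at h2
  rw [Finset.sum_sub_distrib, ← Finset.mul_sum] at h2
  linarith

theorem coe_QQ (Q : Set (Ideal (𝓞 F))) (hQ : ∀ P ∈ Q, P ≠ ⊥) (x : ℝ) (hx : 0 ≤ x) :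
    {P | P ∈ Q ∧ (Ideal.absNorm P : ℝ) ≤ x} = (QQ F Q ⌊x⌋₊ : Set (Ideal (𝓞 F))) := by
  ext P
  simp only [QQ, Finset.coe_filter, mem_A, Set.mem_ofPred_eq, Nat.le_floor_iff hx]
  constructor
  · rintro ⟨h1, h2⟩; exact ⟨⟨hQ P h1, h2⟩, h1⟩
  · rintro ⟨⟨_, h2⟩, h1⟩; exact ⟨h1, h2⟩

end S2

/-- Let `F` be a number field. If a set `Q` of nonzero prime ideals of `O_F`
has natural density `c > 0` among all nonzero prime ideals (counted by absolute norm),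
then there are `c₁ > 0` and `x₀ > 0` such that for all `x ≥ x₀`,
`∑_{𝔭 ∈ Q, q_𝔭 ≤ x} (log q_𝔭)/q_𝔭 ≥ c₁·log x`. -/
theorem stmt_2 (F : Type*) [Field F] [NumberField F]
    (Q : Set (Ideal (NumberField.RingOfIntegers F)))
    (hQ : ∀ 𝔭 ∈ Q, 𝔭.IsPrime ∧ 𝔭 ≠ ⊥)
    (c : ℝ) (hc : 0 < c)
    (hdens : Tendsto (fun x : ℝ =>
        (({𝔭 | 𝔭 ∈ Q ∧ (Ideal.absNorm 𝔭 : ℝ) ≤ x}.ncard : ℝ) /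
          ({𝔭 : Ideal (NumberField.RingOfIntegers F) |
              𝔭.IsPrime ∧ 𝔭 ≠ ⊥ ∧ (Ideal.absNorm 𝔭 : ℝ) ≤ x}.ncard : ℝ)))
      atTop (nhds c)) :
    ∃ c₁ : ℝ, 0 < c₁ ∧ ∃ x₀ : ℝ, 0 < x₀ ∧ ∀ x ≥ x₀,
      c₁ * Real.log x ≤
        ∑ᶠ 𝔭 ∈ {𝔭 : Ideal (NumberField.RingOfIntegers F) |
            𝔭 ∈ Q ∧ (Ideal.absNorm 𝔭 : ℝ) ≤ x},
          Real.log (Ideal.absNorm 𝔭) / (Ideal.absNorm 𝔭 : ℝ) := by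
  classical
  let T : Set (Ideal (𝓞 F)) := {P | P.IsPrime ∧ P ≠ ⊥}
  have hT : ∀ P ∈ T, P ≠ ⊥ := fun P h => h.2
  have hQ' : ∀ P ∈ Q, P ≠ ⊥ := fun P h => (hQ P h).2
  have hev : ∀ᶠ n : ℕ in atTop,
      c / 2 * ((S2.QQ F T n).card : ℝ) ≤ (S2.QQ F Q n).card := by
    filter_upwards [(hdens.comp tendsto_natCast_atTop_atTop).eventually
      (lt_mem_nhds (show c / 2 < c by linarith))] with n hn
    simp only [Function.comp] at hn
    have e1 := S2.coe_QQ F Q hQ' n (Nat.cast_nonneg n)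
    have e2 := S2.coe_QQ F T hT n (Nat.cast_nonneg n)
    simp only [T, Set.mem_ofPred_eq, and_assoc] at e2
    rw [e1, e2, Set.ncard_coe_finset, Set.ncard_coe_finset, Nat.floor_natCast] at hn
    rcases Nat.eq_zero_or_pos (S2.QQ F T n).card with h0 | h0
    · rw [h0]; simp
    · rw [lt_div_iff₀ (by exact_mod_cast h0)] at hn
      exact hn.le
  obtain ⟨M, hM⟩ := S2.compare F Q T (c / 2) hev
  obtain ⟨k, hk, hk2⟩ := S2.mertens F
  have hPP : ∀ n, S2.PP F n = S2.QQ F T n := by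
    intro n
    ext P
    simp only [S2.mem_PP, S2.QQ, Finset.mem_filter, S2.mem_A, T, Set.mem_ofPred_eq]
    tauto
  have hall : ∀ᶠ x : ℝ in atTop, c * k / 8 * log x ≤
      ∑ P ∈ S2.QQ F Q ⌊x⌋₊, log (Ideal.absNorm P) / Ideal.absNorm P := by
    have f := tendsto_nat_floor_atTop (α := ℝ)
    have l1 : ∀ᶠ x : ℝ in atTop, -M / (c * k / 8) ≤ log x :=
      tendsto_log_atTop.eventually_ge_atTop _
    filter_upwards [f.eventually hM, f.eventually hk2, l1, eventually_ge_atTop 4]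
      with x h1 h2 h3 h4
    rw [hPP] at h2
    rw [div_le_iff₀ (by positivity)] at h3
    have h5 : log x / 2 ≤ log (⌊x⌋₊ : ℝ) := by
      have h6 : x < ⌊x⌋₊ + 1 := Nat.lt_floor_add_one x
      have h7 : log x ≤ log ((⌊x⌋₊ : ℝ) ^ 2) := log_le_log (by linarith) (by nlinarith)
      rw [log_pow] at h7
      push_cast at h7
      linarith
    have h8 : k * (log x / 2) ≤ _ := (mul_le_mul_of_nonneg_left h5 hk.le).trans h2
    have h9 := mul_le_mul_of_nonneg_left h8 (show 0 ≤ c / 2 by linarith)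
    linarith
  obtain ⟨x₁, hx₁⟩ := eventually_atTop.1 hall
  refine ⟨c * k / 8, by positivity, max x₁ 1, by positivity, fun x hx => ?_⟩
  rw [S2.coe_QQ F Q hQ' x (zero_le_one.trans ((le_max_right _ _).trans hx))]
  rw [finsum_mem_coe_finset]
  exact hx₁ x ((le_max_left _ _).trans hx)
end

section
/- Let F be a number field with ring of integers O_F, let P_F denote the set of nonzero prime ideals of O_F, and for a prime ideal 𝔭 let q_𝔭 denote the cardinality of the residue field O_F/𝔭 (the absolute norm of 𝔭). Suppose P ⊆ P_F has natural density ρ > 0, i.e. #{𝔭 ∈ P : q_𝔭 ≤ x} / #{𝔭 ∈ P_F : q_𝔭 ≤ x} → ρ as x → ∞. Then for all sufficiently large real numbers g, the set {𝔭 ∈ P : q_𝔭 + 1 < g} has cardinality at least (ρ/2)·g/log g. -/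
open Filter Real


namespace PIT
open MeasureTheory Set Topology

/-- triangle function -/
noncomputable def tri (l t : ℝ) : ℝ := max 0 (1 - |t| / l)

/-- Fejer kernel (unscaled) -/
noncomputable def fej (u : ℝ) : ℝ := 2 * (1 - Real.cos u) / u ^ 2

lemma fej_nonneg (u : ℝ) : 0 ≤ fej u := by
  unfold fej
  have := Real.cos_le_one u
  exact div_nonneg (by linarith) (sq_nonneg u)

lemma fej_le (u : ℝ) : fej u ≤ 5 * (1 + u ^ 2)⁻¹ := by
  unfold fej
  have h1 := Real.one_sub_sq_div_two_le_cos (x := u)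
  have h2 := Real.neg_one_le_cos u
  rcases eq_or_ne u 0 with rfl | hu
  · simp
  have hu2 : 0 < u ^ 2 := by positivity
  rw [← div_eq_mul_inv, div_le_div_iff₀ hu2 (by positivity)]
  nlinarith [Real.cos_le_one u]

lemma fej_meas : Measurable fej := by
  unfold fej; fun_prop

lemma fej_integrable : Integrable fej := by
  refine (integrable_inv_one_add_sq.const_mul 5).mono' fej_meas.aestronglyMeasurable ?_
  filter_upwards with u
  rw [Real.norm_of_nonneg (fej_nonneg u)]
  exact fej_le u

lemma fej_pos : 0 < ∫ u, fej u := by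
  rw [integral_pos_iff_support_of_nonneg (fun u => fej_nonneg u) fej_integrable]
  refine lt_of_lt_of_le (b := volume (Ioo (0:ℝ) 1)) (by simp) (measure_mono ?_)
  intro u hu
  rw [Function.mem_support]
  unfold fej
  have : u ≠ 0 := hu.1.ne'
  have h3 : 0 < 2 * (1 - Real.cos u) / u^2 := by
    have : 0 < 1 - Real.cos u := by
      have := Real.cos_lt_cos_of_nonneg_of_le_pi le_rfl (by linarith [hu.2, Real.pi_gt_three]) hu.1
      rw [Real.cos_zero] at this; linarith
    positivity
  exact h3.ne'

lemma tri_nonneg (l t : ℝ) : 0 ≤ tri l t := le_max_left _ _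

lemma tri_cont (l : ℝ) : Continuous (tri l) := by
  unfold tri; fun_prop

lemma tri_eq_zero {l t : ℝ} (hl : 0 < l) (ht : l ≤ |t|) : tri l t = 0 := by
  unfold tri
  rw [max_eq_left]
  rw [sub_nonpos, le_div_iff₀ hl]; linarith

lemma tri_le_one {l t : ℝ} (hl : 0 < l) : tri l t ≤ 1 := by
  unfold tri
  have : 0 ≤ |t| / l := by positivity
  exact max_le (by norm_num) (by linarith)

lemma tri_hcs {l : ℝ} (hl : 0 < l) : HasCompactSupport (tri l) := by
  refine HasCompactSupport.intro (isCompact_Icc (a := -l) (b := l)) ?_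
  intro x hx
  apply tri_eq_zero hl
  by_contra h
  push Not at h
  rw [abs_lt] at h
  exact hx ⟨h.1.le, h.2.le⟩

lemma tri_fourier {l v : ℝ} (hl : 0 < l) (hv : v ≠ 0) :
    ∫ t : ℝ, (tri l t : ℂ) * Complex.exp (-(Complex.I * t * v)) = ((l * fej (l * v) : ℝ) : ℂ) := by
  have h0 : ∫ t : ℝ, (tri l t : ℂ) * Complex.exp (-(Complex.I * t * v)) =
      ∫ t in (-l)..l, (tri l t : ℂ) * Complex.exp (-(Complex.I * t * v)) := by
    rw [intervalIntegral.integral_of_le (by linarith)]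
    rw [setIntegral_eq_integral_of_forall_compl_eq_zero]
    intro t ht
    rw [tri_eq_zero hl]; · simp
    by_contra h
    push Not at h
    rw [abs_lt] at h
    exact ht ⟨h.1, h.2.le⟩
  have hc : Continuous fun t : ℝ => (tri l t : ℂ) * Complex.exp (-(Complex.I * t * v)) := by
    have := tri_cont l
    fun_prop
  set a : ℂ := -(Complex.I * v) with ha
  have ha0 : a ≠ 0 := by simp [ha, hv]
  have hl0 : (l : ℂ) ≠ 0 := by exact_mod_cast hl.ne'
  have hd : ∀ t : ℝ, HasDerivAt (fun t : ℝ => Complex.exp (a * t)) (Complex.exp (a * t) * a) t := by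
    intro t
    have h1 : HasDerivAt (fun t : ℝ => a * (t : ℂ)) a t := by
      simpa using (Complex.ofRealCLM.hasDerivAt (x := t)).const_mul a
    exact h1.cexp
  have hid : ∀ t : ℝ, HasDerivAt (fun t : ℝ => (t : ℂ)) 1 t := fun t => by
    simpa using (hasDerivAt_id t).ofReal_comp
  have i1 : ∫ t in (0:ℝ)..l, (tri l t : ℂ) * Complex.exp (-(Complex.I * t * v)) =
      Complex.exp (a * l) / (l * a ^ 2) - 1 / a - 1 / (l * a ^ 2) := by
    rw [intervalIntegral.integral_eq_sub_of_hasDerivAt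
      (f := fun t : ℝ => (1 - t / l) * Complex.exp (a * t) / a + Complex.exp (a * t) / (l * a ^ 2))
      _ (hc.intervalIntegrable _ _)]
    · simp only [Complex.ofReal_zero, mul_zero, Complex.exp_zero]
      field_simp
      ring
    · intro t ht
      rw [uIcc_of_le hl.le] at ht
      have e : tri l t = 1 - t / l := by
        unfold tri
        rw [abs_of_nonneg ht.1, max_eq_right]
        rw [sub_nonneg, div_le_one hl]; exact ht.2
      have := ((((hid t).div_const (l:ℂ)).const_sub 1).mul (hd t)).div_const a |>.add
        ((hd t).div_const (l * a ^ 2))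
      refine this.congr_deriv ?_
      rw [e]
      have : -(Complex.I * t * v) = a * t := by rw [ha]; ring
      rw [this]
      push_cast
      field_simp
      ring
  have i2 : ∫ t in (-l)..(0:ℝ), (tri l t : ℂ) * Complex.exp (-(Complex.I * t * v)) =
      Complex.exp (-(a * l)) / (l * a ^ 2) + 1 / a - 1 / (l * a ^ 2) := by
    rw [intervalIntegral.integral_eq_sub_of_hasDerivAt
      (f := fun t : ℝ => (1 + t / l) * Complex.exp (a * t) / a - Complex.exp (a * t) / (l * a ^ 2))
      _ (hc.intervalIntegrable _ _)]
    · simp only [Complex.ofReal_zero, mul_zero, Complex.exp_zero]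
      push_cast
      rw [mul_neg]
      field_simp
      ring
    · intro t ht
      rw [uIcc_of_le (by linarith)] at ht
      have e : tri l t = 1 + t / l := by
        unfold tri
        rw [abs_of_nonpos ht.2, max_eq_right]
        · ring
        rw [sub_nonneg, div_le_one hl]; linarith [ht.1]
      have := ((((hid t).div_const (l:ℂ)).const_add 1).mul (hd t)).div_const a |>.sub
        ((hd t).div_const (l * a ^ 2))
      refine this.congr_deriv ?_
      rw [e]
      have : -(Complex.I * t * v) = a * t := by rw [ha]; ring
      rw [this]
      push_cast
      field_simp
      ring
  rw [h0, ← intervalIntegral.integral_add_adjacent_intervals (b := 0)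
    (hc.intervalIntegrable _ _) (hc.intervalIntegrable _ _), i1, i2]
  have h3 : Complex.exp (a * l) + Complex.exp (-(a * l)) = 2 * Complex.cos (l * v) := by
    rw [Complex.two_cos, ha]
    rw [add_comm]
    congr 2 <;> ring
  have h4 : a ^ 2 = - (v:ℂ) ^ 2 := by rw [ha]; linear_combination (v:ℂ)^2 * Complex.I_sq
  have : Complex.exp (-(a * l)) / (l * a ^ 2) + 1 / a - 1 / (l * a ^ 2) +
    (Complex.exp (a * l) / (l * a ^ 2) - 1 / a - 1 / (l * a ^ 2)) =
    ((Complex.exp (a * l) + Complex.exp (-(a * l))) - 2) / (l * a ^ 2) := by ring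
  rw [this, h3, h4, fej]
  have hv0 : (v : ℂ) ≠ 0 := by exact_mod_cast hv
  push_cast
  field_simp
  ring

end PIT


namespace PIT
open MeasureTheory Set Topology

lemma kern_integrable {l : ℝ} (hl : 0 < l) (y : ℝ) :
    Integrable fun u : ℝ => l * fej (l * (u - y)) :=
  ((fej_integrable.comp_mul_left' hl.ne').comp_sub_right y).const_mul l

lemma kern_total {l : ℝ} (hl : 0 < l) (y : ℝ) :
    ∫ u : ℝ, l * fej (l * (u - y)) = ∫ u, fej u := by
  rw [integral_const_mul, integral_sub_right_eq_self (fun u => fej (l * u)) y,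
    Measure.integral_comp_mul_left, abs_of_pos (by positivity), smul_eq_mul]
  field_simp

lemma exp_int {e : ℝ} (he : 0 < e) (D : ℝ) :
    IntegrableOn (fun u : ℝ => D * Real.exp (-e * u)) (Ioi 0) :=
  (integrableOn_exp_mul_Ioi (by linarith : -e < 0) 0).const_mul D

variable {B : ℝ → ℝ} {C : ℝ} {G : ℂ → ℂ}

/-- Fubini step. -/
lemma taub_fubini (hm : Measurable B) (hB : ∀ u, |B u - 1| ≤ C)
    (hL : ∀ z : ℂ, 0 < z.re → ∫ u in Ioi (0:ℝ), ((B u - 1 : ℝ) : ℂ) * Complex.exp (-z * u) = G z)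
    {l : ℝ} (hl : 0 < l) (y : ℝ) {e : ℝ} (he : 0 < e) :
    ∫ t : ℝ, (tri l t : ℂ) * Complex.exp (Complex.I * t * y) * G (e + Complex.I * t) =
      ∫ u in Ioi (0:ℝ), (((B u - 1) * Real.exp (-e * u) * (l * fej (l * (u - y))) : ℝ) : ℂ) := by
  have h1 : ∀ t : ℝ, (tri l t : ℂ) * Complex.exp (Complex.I * t * y) * G (e + Complex.I * t) =
      ∫ u in Ioi (0:ℝ), (tri l t : ℂ) * Complex.exp (Complex.I * t * y) *
        (((B u - 1 : ℝ) : ℂ) * Complex.exp (-(e + Complex.I * t) * u)) := by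
    intro t
    rw [integral_const_mul, hL _ (by simpa using he)]
  simp_rw [h1]
  rw [integral_integral_swap]
  · apply integral_congr_ae
    have : ∀ᵐ u ∂(volume.restrict (Ioi (0:ℝ))), u ≠ y := by
      apply ae_restrict_of_ae
      simp [ae_iff]
    filter_upwards [this] with u hu
    have h2 := tri_fourier hl (sub_ne_zero.mpr hu)
    push_cast at h2 ⊢
    rw [← h2, ← integral_const_mul]
    congr 1
    ext t
    have h3 : Complex.exp (Complex.I * t * y) * Complex.exp (-(e + Complex.I * t) * u) =
        Complex.exp (-e * u) * Complex.exp (-(Complex.I * t * (u - y))) := by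
      rw [← Complex.exp_add, ← Complex.exp_add]
      congr 1
      ring
    linear_combination ((B u : ℂ) - 1) * (tri l t : ℂ) * h3
  · have hi : Integrable (fun p : ℝ × ℝ => tri l p.1 * (C * Real.exp (-e * p.2)))
        (volume.prod (volume.restrict (Ioi 0))) := by
      exact ((tri_cont l).integrable_of_hasCompactSupport (tri_hcs hl)).mul_prod (exp_int he C)
    refine hi.mono' ?_ ?_
    · have := (tri_cont l).measurable
      simp only [Function.uncurry_def]
      apply Measurable.aestronglyMeasurable
      fun_prop
    · filter_upwards with p
      simp only [Function.uncurry_def, norm_mul, Complex.norm_real, Complex.norm_exp]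
      rw [Real.norm_of_nonneg (tri_nonneg _ _)]
      simp only [Complex.mul_re, Complex.I_re, Complex.I_im, Complex.ofReal_re, Complex.ofReal_im,
        Complex.mul_im, Complex.neg_re, Complex.neg_im, Complex.add_re, Complex.add_im]
      simp only [zero_mul, mul_zero, one_mul, sub_self, Real.exp_zero, mul_one, sub_zero, add_zero,
        zero_add]
      gcongr
      · exact tri_nonneg _ _
      · exact hB _

lemma taub_limit (hm : Measurable B) (hB : ∀ u, |B u - 1| ≤ C)
    (hG : ContinuousOn G {z | 0 ≤ z.re})
    (hL : ∀ z : ℂ, 0 < z.re → ∫ u in Ioi (0:ℝ), ((B u - 1 : ℝ) : ℂ) * Complex.exp (-z * u) = G z)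
    {l : ℝ} (hl : 0 < l) (y : ℝ) :
    ∫ t : ℝ, (tri l t : ℂ) * Complex.exp (Complex.I * t * y) * G (Complex.I * t) =
      ∫ u in Ioi (0:ℝ), (((B u - 1) * (l * fej (l * (u - y))) : ℝ) : ℂ) := by
  have hC : 0 ≤ C := (abs_nonneg _).trans (hB 0)
  -- bound for G
  obtain ⟨M, hM⟩ : ∃ M, ∀ z ∈ (Icc (0:ℝ) 1) ×ℂ (Icc (-l) l), ‖G z‖ ≤ M := by
    apply IsCompact.exists_bound_of_continuousOn
    · exact isCompact_Icc.reProdIm isCompact_Icc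
    · exact hG.mono fun z hz => hz.1.1
  have t1 : Tendsto (fun e : ℝ => ∫ t : ℝ, (tri l t : ℂ) * Complex.exp (Complex.I * t * y) *
      G (e + Complex.I * t)) (𝓝[>] 0)
      (𝓝 (∫ t : ℝ, (tri l t : ℂ) * Complex.exp (Complex.I * t * y) * G (Complex.I * t))) := by
    apply tendsto_integral_filter_of_dominated_convergence (fun t => tri l t * M)
    · filter_upwards [self_mem_nhdsWithin] with e he
      have : Continuous fun t : ℝ => G (e + Complex.I * t) := by
        apply hG.comp_continuous (by fun_prop)
        intro t
        simpa using le_of_lt he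
      have h2 : Continuous fun t : ℝ => (tri l t : ℂ) * Complex.exp (Complex.I * t * y) := by
        have := tri_cont l
        fun_prop
      exact (h2.mul this).aestronglyMeasurable
    · filter_upwards [Ioc_mem_nhdsGT (zero_lt_one' ℝ)] with e he
      filter_upwards with t
      rw [norm_mul, norm_mul, Complex.norm_real, Real.norm_of_nonneg (tri_nonneg _ _)]
      have : ‖Complex.exp (Complex.I * t * y)‖ = 1 := by
        rw [Complex.norm_exp]; simp
      rw [this, mul_one]
      by_cases ht : l ≤ |t|
      · simp [tri_eq_zero hl ht]
      · push Not at ht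
        rw [abs_lt] at ht
        refine mul_le_mul_of_nonneg_left (hM _ ?_) (tri_nonneg _ _)
        rw [Complex.mem_reProdIm]
        simp
        exact ⟨⟨he.1.le, he.2⟩, ht.1.le, ht.2.le⟩
    · exact ((tri_cont l).integrable_of_hasCompactSupport (tri_hcs hl)).mul_const M
    · filter_upwards with t
      apply Tendsto.const_mul
      have h3 : ContinuousWithinAt G {z | 0 ≤ z.re} (Complex.I * t) := hG _ (by simp)
      refine h3.tendsto.comp ?_
      apply tendsto_nhdsWithin_iff.mpr
      constructor
      · have : Tendsto (fun e : ℝ => (e : ℂ) + Complex.I * t) (𝓝 0) (𝓝 ((0:ℝ) + Complex.I * t)) := by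
          apply Continuous.tendsto; fun_prop
        simpa using this.mono_left nhdsWithin_le_nhds
      · filter_upwards [self_mem_nhdsWithin] with e he
        simpa using le_of_lt he
  have t2 : Tendsto (fun e : ℝ => ∫ u in Ioi (0:ℝ),
      (((B u - 1) * Real.exp (-e * u) * (l * fej (l * (u - y))) : ℝ) : ℂ)) (𝓝[>] 0)
      (𝓝 (∫ u in Ioi (0:ℝ), (((B u - 1) * (l * fej (l * (u - y))) : ℝ) : ℂ))) := by
    apply tendsto_integral_filter_of_dominated_convergence
      (fun u => C * (l * fej (l * (u - y))))
    · filter_upwards with e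
      have := fej_meas
      exact Measurable.aestronglyMeasurable (by fun_prop)
    · filter_upwards [self_mem_nhdsWithin] with e he
      filter_upwards [ae_restrict_mem measurableSet_Ioi] with u hu
      rw [Complex.norm_real, norm_mul, norm_mul]
      have h1 := fej_nonneg (l * (u - y))
      rw [Real.norm_of_nonneg (by positivity : 0 ≤ l * fej (l * (u - y)))]
      rw [Real.norm_of_nonneg (Real.exp_pos _).le]
      refine mul_le_mul_of_nonneg_right ?_ (by positivity)
      have : Real.exp (-e * u) ≤ 1 := by
        rw [Real.exp_le_one_iff]
        have : 0 < e * u := mul_pos he hu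
        linarith
      calc _ ≤ C * 1 := mul_le_mul (hB u) this (Real.exp_pos _).le hC
        _ = C := mul_one _
    · exact ((kern_integrable hl y).const_mul C).integrableOn
    · filter_upwards with u
      have : Continuous fun e : ℝ => (((B u - 1) * Real.exp (-e * u) * (l * fej (l * (u - y))) : ℝ) : ℂ) := by
        fun_prop
      have h := (this.tendsto 0).mono_left (nhdsWithin_le_nhds (s := Ioi 0))
      simpa using h
  refine tendsto_nhds_unique t1 (t2.congr' ?_)
  filter_upwards [self_mem_nhdsWithin] with e he
  exact (taub_fubini hm hB hL hl y he).symm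

lemma taub_RL (hm : Measurable B) (hB : ∀ u, |B u - 1| ≤ C)
    (hG : ContinuousOn G {z | 0 ≤ z.re})
    (hL : ∀ z : ℂ, 0 < z.re → ∫ u in Ioi (0:ℝ), ((B u - 1 : ℝ) : ℂ) * Complex.exp (-z * u) = G z)
    {l : ℝ} (hl : 0 < l) :
    Tendsto (fun y : ℝ => ∫ u in Ioi (0:ℝ), (B u - 1) * (l * fej (l * (u - y)))) atTop (𝓝 0) := by
  have h1 := Real.tendsto_integral_exp_smul_cocompact
    (fun t : ℝ => (tri l t : ℂ) * G (Complex.I * t))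
  have h2 : Tendsto (fun y : ℝ => -(y / (2 * π))) atTop (cocompact ℝ) := by
    refine Tendsto.mono_right ?_ atBot_le_cocompact
    exact tendsto_neg_atTop_atBot.comp (tendsto_id.atTop_div_const (by positivity))
  have h3 := h1.comp h2
  have h4 : Tendsto (fun y : ℝ => ((∫ u in Ioi (0:ℝ), (B u - 1) * (l * fej (l * (u - y))) : ℝ) : ℂ))
      atTop (𝓝 0) := by
    refine h3.congr fun y => ?_
    rw [← integral_complex_ofReal, ← taub_limit hm hB hG hL hl y, Function.comp]
    congr 1
    ext t
    rw [Circle.smul_def, Real.fourierChar_apply, smul_eq_mul]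
    have hE : Complex.exp (↑(2 * π * -(t * -(y / (2 * π)))) * Complex.I) =
        Complex.exp (Complex.I * t * y) := by
      congr 1
      push_cast
      have : (π : ℂ) ≠ 0 := by exact_mod_cast Real.pi_ne_zero
      field_simp
    rw [hE]
    ring
  have h5 := (Complex.continuous_re.tendsto _).comp h4
  simpa [Function.comp_def] using h5

/-- A Tauberian theorem (lower bound half of Wiener-Ikehara, for bounded functions). -/
theorem tauberian (hm : Measurable B) (hB0 : ∀ u, 0 ≤ B u) (hBC : ∀ u, B u ≤ C)
    (hmono : ∀ u v, u ≤ v → B u * Real.exp u ≤ B v * Real.exp v)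
    (hG : ContinuousOn G {z | 0 ≤ z.re})
    (hL : ∀ z : ℂ, 0 < z.re → ∫ u in Ioi (0:ℝ), ((B u - 1 : ℝ) : ℂ) * Complex.exp (-z * u) = G z)
    {a : ℝ} (ha : a < 1) : ∀ᶠ y in atTop, a ≤ B y := by
  have hC : 0 ≤ C := (hB0 0).trans (hBC 0)
  have hB : ∀ u, |B u - 1| ≤ C + 1 := by
    intro u; rw [abs_le]; constructor <;> linarith [hB0 u, hBC u]
  set m := ∫ u, fej u with hmdef
  have hmpos : 0 < m := fej_pos
  -- choose δ and η
  obtain ⟨δ, hδ, η, hη, hfin⟩ : ∃ δ > 0, ∃ η > 0, a ≤ Real.exp (-2 * δ) * (m - η * (C + 2)) / m := by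
    have hc : Tendsto (fun d : ℝ => Real.exp (-2 * d) * (m - d * (C + 2)) / m) (𝓝[>] 0) (𝓝 1) := by
      have : Continuous (fun d : ℝ => Real.exp (-2 * d) * (m - d * (C + 2)) / m) := by fun_prop
      have h := (this.tendsto 0).mono_left (nhdsWithin_le_nhds (s := Ioi 0))
      simpa [hmpos.ne'] using h
    have h1 := hc.eventually (lt_mem_nhds ha)
    obtain ⟨d, h2, h3⟩ := (h1.and self_mem_nhdsWithin).exists
    exact ⟨d, h3, d, h3, h2.le⟩
  -- tail
  have htail : Tendsto (fun l : ℝ => ∫ v in {v : ℝ | l * δ < |v|}, fej v) atTop (𝓝 0) := by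
    have := tendsto_setIntegral_of_antitone (μ := volume) (f := fej)
      (s := fun l : ℝ => {v : ℝ | l * δ < |v|})
      (fun l => measurableSet_lt measurable_const measurable_abs)
      (fun l l' hll v hv => lt_of_le_of_lt (mul_le_mul_of_nonneg_right hll hδ.le) hv)
      ⟨0, fej_integrable.integrableOn⟩
    have he : (⋂ l : ℝ, {v : ℝ | l * δ < |v|}) = ∅ := by
      ext v
      simp only [mem_iInter, mem_ofPred_eq, mem_empty_iff_false, iff_false, not_forall, not_lt]
      exact ⟨|v| / δ, by rw [div_mul_cancel₀ _ hδ.ne']⟩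
    rw [he] at this
    simpa using this
  obtain ⟨l, hltail, hl⟩ := ((htail.eventually (gt_mem_nhds hη)).and (eventually_gt_atTop 0)).exists
  set K : ℝ → ℝ := fun v => l * fej (l * v) with hK
  have hKnn : ∀ v, 0 ≤ K v := fun v => mul_nonneg hl.le (fej_nonneg _)
  have hKi : ∀ y, Integrable fun u => K (u - y) := fun y => kern_integrable hl y
  have hKtail : ∀ y : ℝ, ∫ u in {u | δ < |u - y|}, K (u - y) ≤ η := by
    intro y
    have : ∫ u in {u | δ < |u - y|}, K (u - y) = ∫ v in {v : ℝ | l * δ < |v|}, fej v := by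
      rw [← integral_indicator (measurableSet_lt measurable_const (by fun_prop)),
        ← integral_indicator (measurableSet_lt measurable_const (by fun_prop))]
      have h := Measure.integral_comp_mul_left (fun v => ({v : ℝ | l * δ < |v|}.indicator fej) v) l
      rw [abs_of_pos (by positivity), smul_eq_mul] at h
      have h' := integral_sub_right_eq_self (μ := volume) (fun u => ({v : ℝ | l * δ < |v|}.indicator fej) (l * u)) y
      rw [← h'] at h
      have : ∫ v, ({v : ℝ | l * δ < |v|}.indicator fej) v = l * ∫ u, ({v : ℝ | l * δ < |v|}.indicator fej) (l * (u - y)) := by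
        rw [h]; field_simp
      rw [this, ← integral_const_mul]
      congr 1
      ext u
      have : l * δ < |l * (u - y)| ↔ δ < |u - y| := by
        rw [abs_mul, abs_of_pos hl, mul_lt_mul_iff_right₀ hl]
      simp only [indicator, mem_ofPred_eq, this, hK]
      split_ifs <;> simp
    rw [this]; exact hltail.le
  have hRL := taub_RL hm hB hG hL hl
  have hev : ∀ᶠ y in atTop, -η < ∫ u in Ioi (0:ℝ), (B u - 1) * K (u - y) :=
    hRL.eventually (lt_mem_nhds (by linarith))
  have hev2 := (tendsto_id.atTop_add (tendsto_const_nhds (x := -δ)) : Tendsto (fun y : ℝ => y + -δ) atTop atTop)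
  filter_upwards [hev2.eventually hev, eventually_gt_atTop (2 * δ)] with y0 hy0 hy0'
  set y := y0 + -δ with hy
  have hBKi : Integrable fun u => B u * K (u - y) := by
    refine ((hKi y).const_mul C).mono' ?_ ?_
    · have := (hKi y).aestronglyMeasurable
      exact hm.aestronglyMeasurable.mul this
    · filter_upwards with u
      rw [norm_mul, Real.norm_of_nonneg (hB0 u), Real.norm_of_nonneg (hKnn _)]
      exact mul_le_mul_of_nonneg_right (hBC u) (hKnn _)
  have e1 : ∫ u in Ioi (0:ℝ), (B u - 1) * K (u - y) =
      (∫ u in Ioi (0:ℝ), B u * K (u - y)) - ∫ u in Ioi (0:ℝ), K (u - y) := by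
    rw [← integral_sub hBKi.integrableOn (hKi y).integrableOn]
    congr 1; ext u; ring
  have e2 : m - η ≤ ∫ u in Ioi (0:ℝ), K (u - y) := by
    have h1 := integral_add_compl (measurableSet_Ioi (a := (0:ℝ))) (hKi y)
    rw [kern_total hl y] at h1
    have h2 : ∫ u in (Ioi (0:ℝ))ᶜ, K (u - y) ≤ ∫ u in {u | δ < |u - y|}, K (u - y) := by
      apply setIntegral_mono_set (hKi y).integrableOn
      · filter_upwards with u using hKnn _
      · apply Eventually.of_forall
        intro u hu
        have hu' : u ≤ 0 := not_lt.mp hu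
        show δ < |u - y|
        rw [abs_sub_comm]
        refine lt_of_lt_of_le ?_ (le_abs_self _)
        linarith
    linarith [hKtail y]
  have e3 : ∫ u in Ioi (0:ℝ), B u * K (u - y) ≤ Real.exp (2 * δ) * B y0 * m + C * η := by
    calc ∫ u in Ioi (0:ℝ), B u * K (u - y) ≤ ∫ u, B u * K (u - y) :=
          setIntegral_le_integral hBKi (by filter_upwards with u using mul_nonneg (hB0 u) (hKnn _))
      _ ≤ ∫ u, (Real.exp (2 * δ) * B y0 * K (u - y) +
            C * ({u | δ < |u - y|}.indicator (fun u => K (u - y)) u)) := by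
          apply integral_mono hBKi
          · exact ((hKi y).const_mul _).add (((hKi y).indicator
              (measurableSet_lt measurable_const (by fun_prop))).const_mul _)
          · intro u
            by_cases hu : δ < |u - y|
            · simp only [indicator, mem_ofPred_eq, hu, if_true]
              have := mul_le_mul_of_nonneg_right (hBC u) (hKnn (u - y))
              have h2 : 0 ≤ Real.exp (2 * δ) * B y0 * K (u - y) :=
                mul_nonneg (mul_nonneg (Real.exp_pos _).le (hB0 _)) (hKnn _)
              linarith
            · simp only [indicator, mem_ofPred_eq, hu, if_false, mul_zero, add_zero]
              refine mul_le_mul_of_nonneg_right ?_ (hKnn _)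
              push Not at hu
              rw [abs_le] at hu
              have h1 := hmono u y0 (by linarith [hu.2])
              have h2 : B u ≤ B y0 * Real.exp (y0 - u) := by
                rw [Real.exp_sub, ← mul_div_assoc, le_div_iff₀ (Real.exp_pos _)]
                exact h1
              have h3 : Real.exp (y0 - u) ≤ Real.exp (2 * δ) := by
                apply Real.exp_le_exp.mpr; linarith [hu.1]
              calc B u ≤ B y0 * Real.exp (y0 - u) := h2
                _ ≤ B y0 * Real.exp (2 * δ) := mul_le_mul_of_nonneg_left h3 (hB0 _)
                _ = _ := mul_comm _ _
      _ = Real.exp (2 * δ) * B y0 * m + C * ∫ u in {u | δ < |u - y|}, K (u - y) := by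
          rw [integral_add ((hKi y).const_mul _) (((hKi y).indicator
              (measurableSet_lt measurable_const (by fun_prop))).const_mul _),
            integral_const_mul (Real.exp (2 * δ) * B y0), integral_const_mul C, kern_total hl y,
            integral_indicator (measurableSet_lt measurable_const (by fun_prop))]
      _ ≤ _ := by
          have := mul_le_mul_of_nonneg_left (hKtail y) hC
          linarith
  have e4 : m - η * (C + 2) ≤ Real.exp (2 * δ) * B y0 * m := by
    have : -η < (∫ u in Ioi (0:ℝ), B u * K (u - y)) - ∫ u in Ioi (0:ℝ), K (u - y) := by
      rw [← e1]; exact hy0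
    linarith
  refine hfin.trans ?_
  rw [div_le_iff₀ hmpos]
  calc Real.exp (-2 * δ) * (m - η * (C + 2)) ≤ Real.exp (-2 * δ) * (Real.exp (2 * δ) * B y0 * m) :=
        mul_le_mul_of_nonneg_left e4 (Real.exp_pos _).le
    _ = (Real.exp (-2 * δ) * Real.exp (2 * δ)) * (B y0 * m) := by ring
    _ = B y0 * m := by rw [← Real.exp_add]; simp

end PIT


namespace PIT
open MeasureTheory Set Topology

section riemann
variable {ι : Type*} [Fintype ι]

lemma cube_iff (x : ι → ℝ) (m : ι → ℤ) :
    x ∈ Set.pi univ (fun i => Ico (m i : ℝ) (m i + 1)) ↔ (fun i => ⌊x i⌋) = m := by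
  simp only [Set.mem_pi, mem_univ, true_imp_iff, mem_Ico, funext_iff, Int.floor_eq_iff]

lemma integral_floor (g : (ι → ℤ) → ℝ) (hg : g.support.Finite) :
    Integrable (fun x : ι → ℝ => g (fun i => ⌊x i⌋)) ∧
    ∫ x : ι → ℝ, g (fun i => ⌊x i⌋) = ∑' m, g m := by
  classical
  have h1 : (fun x : ι → ℝ => g (fun i => ⌊x i⌋)) = fun x => ∑ m ∈ hg.toFinset,
      (Set.pi univ (fun i => Ico (m i : ℝ) (m i + 1))).indicator (fun _ => g m) x := by
    ext x
    simp only [indicator, cube_iff]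
    rw [Finset.sum_ite_eq]
    split_ifs with h
    · rfl
    · simpa using h
  have hv : ∀ m : ι → ℤ, volume (Set.pi univ (fun i => Ico (m i : ℝ) (m i + 1))) = 1 := by
    intro m
    rw [Real.volume_pi_Ico]
    simp
  have hi : ∀ m ∈ hg.toFinset, Integrable
      ((Set.pi univ (fun i => Ico (m i : ℝ) (m i + 1))).indicator (fun _ => g m)) := by
    intro m _
    rw [integrable_indicator_iff (MeasurableSet.univ_pi fun i => measurableSet_Ico)]
    exact integrableOn_const (by rw [hv]; simp)
  refine ⟨by rw [h1]; exact integrable_finsetSum _ hi, ?_⟩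
  rw [h1, integral_finsetSum _ hi, tsum_eq_sum (s := hg.toFinset) (by simp)]
  apply Finset.sum_congr rfl
  intro m _
  rw [integral_indicator (MeasurableSet.univ_pi fun i => measurableSet_Ico), setIntegral_const,
    measureReal_def, hv]
  simp

lemma riemann_pi [Nonempty ι] (h : (ι → ℝ) → ℝ) (L R : ℝ) (hL0 : 0 ≤ L)
    (hL : ∀ x y, |h x - h y| ≤ L * ‖x - y‖)
    (hR0 : 0 ≤ R) (hR : ∀ x, R < ‖x‖ → h x = 0) :
    ∃ c C : ℝ, ∀ t : ℝ, 1 ≤ t →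
      (Function.support fun m : ι → ℤ => h (fun i => t⁻¹ * m i)).Finite ∧
      |∑' m : ι → ℤ, h (fun i => t⁻¹ * m i) - c * t ^ (Fintype.card ι)| ≤
        C * t ^ (Fintype.card ι - 1) := by
  refine ⟨∫ x, h x, L * (2 * (R + 1)) ^ (Fintype.card ι), fun t ht => ?_⟩
  have ht0 : 0 < t := by linarith
  have hcont : Continuous h := by
    have : LipschitzWith ⟨L, hL0⟩ h := LipschitzWith.of_dist_le_mul fun x y => by
      rw [Real.dist_eq, dist_eq_norm]; exact hL x y
    exact this.continuous
  have hfin : (Function.support fun m : ι → ℤ => h (fun i => t⁻¹ * m i)).Finite := by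
    refine Set.Finite.subset (s := Set.pi univ fun _ => Icc (-⌈R * t⌉) ⌈R * t⌉) ?_ ?_
    · exact Set.Finite.pi fun (_ : ι) => Set.finite_Icc (-⌈R * t⌉) ⌈R * t⌉
    · intro m hm i _
      have h1 : ‖fun i => t⁻¹ * (m i : ℝ)‖ ≤ R := by
        by_contra hc
        exact hm (hR _ (not_le.mp hc))
      have h2 := (norm_le_pi_norm _ i).trans h1
      simp only [norm_mul, norm_inv, Real.norm_eq_abs, abs_of_pos ht0] at h2
      have h3 : |(m i : ℝ)| ≤ R * t := by
        rw [inv_mul_le_iff₀ ht0] at h2; linarith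
      rw [abs_le] at h3
      have h4 := Int.le_ceil (R * t)
      constructor
      · have : (-⌈R * t⌉ : ℝ) ≤ m i := by linarith [h3.1]
        exact_mod_cast this
      · have : (m i : ℝ) ≤ ⌈R * t⌉ := by linarith [h3.2]
        exact_mod_cast this
  refine ⟨hfin, ?_⟩
  obtain ⟨i1, i2⟩ := integral_floor _ hfin
  have hcs : HasCompactSupport h := by
    refine HasCompactSupport.intro (isCompact_closedBall (0 : ι → ℝ) R) fun x hx => hR x ?_
    simpa using hx
  have hintg : Integrable h := hcont.integrable_of_hasCompactSupport hcs
  have i3 : Integrable fun x : ι → ℝ => h (t⁻¹ • x) := hintg.comp_smul (by positivity)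
  have i4 : ∫ x : ι → ℝ, h (t⁻¹ • x) = (∫ x, h x) * t ^ (Fintype.card ι) := by
    rw [Measure.integral_comp_inv_smul, Module.finrank_fintype_fun_eq_card, smul_eq_mul,
      abs_of_pos (by positivity), mul_comm]
  rw [← i2, ← i4, ← integral_sub i1 i3]
  have hball : volume (Metric.closedBall (0 : ι → ℝ) ((R + 1) * t)) =
      ENNReal.ofReal ((2 * ((R + 1) * t)) ^ Fintype.card ι) := by
    rw [Real.volume_pi_closedBall _ (by positivity)]
  calc |∫ x : ι → ℝ, (h (fun i => t⁻¹ * (⌊x i⌋ : ℝ)) - h (t⁻¹ • x))|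
      = |∫ x in Metric.closedBall (0 : ι → ℝ) ((R + 1) * t),
          (h (fun i => t⁻¹ * (⌊x i⌋ : ℝ)) - h (t⁻¹ • x))| := by
        rw [setIntegral_eq_integral_of_forall_compl_eq_zero]
        intro x hx
        have hx' : (R + 1) * t < ‖x‖ := by simpa using hx
        have hfl : ‖x - fun i => (⌊x i⌋ : ℝ)‖ ≤ 1 := by
          rw [pi_norm_le_iff_of_nonneg zero_le_one]
          intro i
          rw [Pi.sub_apply, Real.norm_eq_abs, abs_le]
          constructor <;> linarith [Int.floor_le (x i), Int.lt_floor_add_one (x i)]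
        have e1 : h (t⁻¹ • x) = 0 := by
          apply hR
          rw [norm_smul, norm_inv, Real.norm_of_nonneg ht0.le, lt_inv_mul_iff₀ ht0]
          nlinarith
        have e2 : h (fun i => t⁻¹ * (⌊x i⌋ : ℝ)) = 0 := by
          apply hR
          have : (fun i => t⁻¹ * (⌊x i⌋ : ℝ)) = t⁻¹ • (fun i => (⌊x i⌋ : ℝ)) := rfl
          rw [this, norm_smul, norm_inv, Real.norm_of_nonneg ht0.le, lt_inv_mul_iff₀ ht0]
          have := norm_sub_norm_le x (fun i => (⌊x i⌋ : ℝ))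
          nlinarith
        rw [e1, e2, sub_zero]
    _ ≤ (L * t⁻¹) * volume.real (Metric.closedBall (0 : ι → ℝ) ((R + 1) * t)) := by
        rw [← Real.norm_eq_abs]
        apply norm_setIntegral_le_of_norm_le_const (by rw [hball]; simp)
        intro x _
        rw [Real.norm_eq_abs]
        refine (hL _ _).trans ?_
        refine mul_le_mul_of_nonneg_left ?_ hL0
        rw [pi_norm_le_iff_of_nonneg (by positivity)]
        intro i
        rw [Pi.sub_apply, Pi.smul_apply, smul_eq_mul, ← mul_sub, norm_mul, norm_inv,
          Real.norm_of_nonneg ht0.le]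
        refine mul_le_of_le_one_right (by positivity) ?_
        rw [Real.norm_eq_abs, abs_le]
        constructor <;> linarith [Int.floor_le (x i), Int.lt_floor_add_one (x i)]
    _ = L * (2 * (R + 1)) ^ (Fintype.card ι) * t ^ (Fintype.card ι - 1) := by
        rw [measureReal_def, hball, ENNReal.toReal_ofReal (by positivity), ← mul_assoc, mul_pow]
        have : t ^ Fintype.card ι = t ^ (Fintype.card ι - 1) * t := by
          rw [← pow_succ, Nat.sub_add_cancel Fintype.card_pos]
        rw [this]
        field_simp

lemma riemann_basis [Nonempty ι] {E : Type*} [NormedAddCommGroup E] [NormedSpace ℝ E]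
    [FiniteDimensional ℝ E] (b : Module.Basis ι ℝ E) (h : E → ℝ) (L R : ℝ) (hL0 : 0 ≤ L)
    (hL : ∀ x y, |h x - h y| ≤ L * ‖x - y‖)
    (hR0 : 0 ≤ R) (hR : ∀ x, R < ‖x‖ → h x = 0) :
    ∃ c C : ℝ, ∀ t : ℝ, 1 ≤ t →
      (Function.support fun m : ι → ℤ => h (t⁻¹ • ∑ i, (m i : ℝ) • b i)).Finite ∧
      |∑' m : ι → ℤ, h (t⁻¹ • ∑ i, (m i : ℝ) • b i) - c * t ^ (Fintype.card ι)| ≤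
        C * t ^ (Fintype.card ι - 1) := by
  let e : E ≃L[ℝ] (ι → ℝ) := b.equivFun.toContinuousLinearEquiv
  let e' : (ι → ℝ) →L[ℝ] E := e.symm
  let e'' : E →L[ℝ] (ι → ℝ) := e
  have := riemann_pi (fun x => h (e' x)) (L * ‖e'‖) (‖e''‖ * R) (by positivity)
    (fun x y => by
      refine (hL _ _).trans ?_
      rw [← map_sub, mul_assoc]
      exact mul_le_mul_of_nonneg_left (e'.le_opNorm _) hL0)
    (by positivity)
    (fun x hx => by
      apply hR
      by_contra hc
      push Not at hc
      have h1 : x = e'' (e' x) := (e.apply_symm_apply x).symm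
      have h2 := e''.le_opNorm (e' x)
      rw [← h1] at h2
      have h3 := mul_le_mul_of_nonneg_left hc (norm_nonneg e'')
      linarith)
  obtain ⟨c, C, hc⟩ := this
  refine ⟨c, C, fun t ht => ?_⟩
  have key : ∀ m : ι → ℤ, e' (fun i => t⁻¹ * (m i : ℝ)) = t⁻¹ • ∑ i, (m i : ℝ) • b i := by
    intro m
    show b.equivFun.symm _ = _
    rw [Module.Basis.equivFun_symm_apply, Finset.smul_sum]
    simp only [mul_smul]
  have := hc t ht
  simp only [key] at this
  exact this
end riemann

end PIT


namespace PIT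
open MeasureTheory Set Topology

/-- The radial cut-off. -/
noncomputable def kk (y : ℝ) : ℝ := y * max 0 (1 - y)

lemma kk_nonneg {y : ℝ} (hy : 0 ≤ y) : 0 ≤ kk y := mul_nonneg hy (le_max_left _ _)
lemma kk_le_self {y : ℝ} (hy : 0 ≤ y) : kk y ≤ y := by
  unfold kk
  exact mul_le_of_le_one_right hy (max_le zero_le_one (by linarith))
lemma kk_le_one {y : ℝ} (hy : 0 ≤ y) : kk y ≤ 1 := by
  unfold kk
  rcases le_total (1 - y) 0 with h | h
  · rw [max_eq_left h]; simp
  · rw [max_eq_right h]; nlinarith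
lemma kk_zero : kk 0 = 0 := by simp [kk]
lemma kk_eq_zero {y : ℝ} (hy : 1 ≤ y) : kk y = 0 := by
  unfold kk; rw [max_eq_left (by linarith)]; simp
lemma kk_lip {x y : ℝ} (hx : 0 ≤ x) (hy : 0 ≤ y) : |kk x - kk y| ≤ |x - y| := by
  wlog h : x ≤ y generalizing x y
  · rw [abs_sub_comm, abs_sub_comm x]; exact this hy hx (by linarith)
  rw [abs_sub_comm x, abs_of_nonneg (by linarith : 0 ≤ y - x)]
  unfold kk
  rw [abs_le]
  rcases le_total (1 - x) 0 with h1 | h1 <;> rcases le_total (1 - y) 0 with h2 | h2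
  · rw [max_eq_left h1, max_eq_left h2]; constructor <;> linarith
  · rw [max_eq_left h1, max_eq_right h2]; constructor <;> nlinarith
  · rw [max_eq_right h1, max_eq_left h2]; constructor <;> nlinarith
  · rw [max_eq_right h1, max_eq_right h2]; constructor <;> nlinarith

lemma tri_lip (x y : ℝ) : |tri 1 x - tri 1 y| ≤ |x - y| := by
  unfold tri
  rw [div_one, div_one]
  refine (abs_max_sub_max_le_max _ _ _ _).trans ?_
  rw [sub_self, abs_zero, max_eq_right (abs_nonneg _)]
  have : 1 - |x| - (1 - |y|) = -(|x| - |y|) := by ring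
  rw [this, abs_neg]
  exact abs_abs_sub_abs_le _ _

lemma prod_lip {ι : Type*} (s : Finset ι) (f g : ι → ℝ) (hf : ∀ i, 0 ≤ f i) (hf1 : ∀ i, f i ≤ 1)
    (hg : ∀ i, 0 ≤ g i) (hg1 : ∀ i, g i ≤ 1) :
    |∏ i ∈ s, f i - ∏ i ∈ s, g i| ≤ ∑ i ∈ s, |f i - g i| := by
  classical
  induction s using Finset.induction_on with
  | empty => simp
  | insert a s ha ih =>
    rw [Finset.prod_insert ha, Finset.prod_insert ha, Finset.sum_insert ha]
    have h1 : 0 ≤ ∏ i ∈ s, f i := Finset.prod_nonneg fun i _ => hf i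
    have h2 : ∏ i ∈ s, f i ≤ 1 := Finset.prod_le_one (fun i _ => hf i) fun i _ => hf1 i
    calc _ = |(f a - g a) * ∏ i ∈ s, f i + g a * (∏ i ∈ s, f i - ∏ i ∈ s, g i)| := by ring_nf
      _ ≤ |f a - g a| * |∏ i ∈ s, f i| + |g a| * |∏ i ∈ s, f i - ∏ i ∈ s, g i| := by
        refine (abs_add_le _ _).trans ?_
        rw [abs_mul, abs_mul]
      _ ≤ _ := by
        rw [abs_of_nonneg h1, abs_of_nonneg (hg a)]
        have := abs_nonneg (f a - g a)
        have := abs_nonneg (∏ i ∈ s, f i - ∏ i ∈ s, g i)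
        have := hg1 a
        have := hg a
        nlinarith

lemma lip_abstract {E W : Type*} [NormedAddCommGroup E] [Fintype W] (a : E → W → ℝ)
    (ha0 : ∀ x w, 0 ≤ a x w) (haL : ∀ x y w, |a x w - a y w| ≤ ‖x - y‖)
    (hale : ∀ x w, a x w ≤ ‖x‖) (haex : ∀ x, ∃ w, ‖x‖ ≤ a x w)
    (m : W → ℕ) (hm : ∀ w, 1 ≤ m w) (τ : (W → ℝ) → ℝ)
    (h0 : ∀ l, 0 ≤ τ l) (h1 : ∀ l, τ l ≤ 1) (M A : ℝ) (hM : 0 ≤ M) (hA : 0 ≤ A)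
    (hτL : ∀ l l' D, (∀ w, |l w - l' w| ≤ D) → |τ l - τ l'| ≤ M * D)
    (hτA : ∀ l, τ l ≠ 0 → ∀ w w', |l w - l w'| ≤ A) :
    ∃ L R : ℝ, 0 ≤ L ∧ 0 ≤ R ∧
      (∀ x y, |τ (fun w => log (a x w)) * kk (∏ w, a x w ^ m w) -
        τ (fun w => log (a y w)) * kk (∏ w, a y w ^ m w)| ≤ L * ‖x - y‖) ∧
      (∀ x, R < ‖x‖ → τ (fun w => log (a x w)) * kk (∏ w, a x w ^ m w) = 0) := by
  set h : E → ℝ := fun x => τ (fun w => log (a x w)) * kk (∏ w, a x w ^ m w) with hh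
  set N : E → ℝ := fun x => ∏ w, a x w ^ m w with hN
  have N0 : ∀ x, 0 ≤ N x := fun x => Finset.prod_nonneg fun w _ => pow_nonneg (ha0 x w) _
  set n := ∑ w, m w with hn
  have hn1 : 1 ≤ n := by
    obtain ⟨w, _⟩ := haex 0
    exact (hm w).trans (Finset.single_le_sum (f := m) (fun _ _ => Nat.zero_le _) (Finset.mem_univ w))
  have Nle : ∀ x, N x ≤ ‖x‖ ^ n := by
    intro x
    rw [hn, ← Finset.prod_pow_eq_pow_sum]
    exact Finset.prod_le_prod (fun w _ => pow_nonneg (ha0 x w) _)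
      fun w _ => pow_le_pow_left₀ (ha0 x w) (hale x w) _
  have Nle' : ∀ x, N x ≤ 1 → N x ≤ ‖x‖ := by
    intro x hx
    rcases le_total ‖x‖ 1 with h | h
    · exact (Nle x).trans (pow_le_of_le_one (norm_nonneg x) h (by omega))
    · linarith
  have hnn : ∀ x, 0 ≤ h x := fun x => mul_nonneg (h0 _) (kk_nonneg (N0 x))
  have hlek : ∀ x, h x ≤ kk (N x) := fun x => mul_le_of_le_one_left (kk_nonneg (N0 x)) (h1 _)
  have hle : ∀ x, h x ≤ ‖x‖ := by
    intro x
    refine (hlek x).trans ?_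
    rcases le_total (N x) 1 with h | h
    · exact (kk_le_self (N0 x)).trans (Nle' x h)
    · rw [kk_eq_zero h]; positivity
  have hN1 : ∀ x, h x ≠ 0 → N x < 1 := by
    intro x hx
    by_contra hc
    apply hx
    show _ * kk (N x) = 0
    rw [kk_eq_zero (not_lt.mp hc), mul_zero]
  have hpos : ∀ x, h x ≠ 0 → ∀ w, 0 < a x w := by
    intro x hx w
    refine lt_of_le_of_ne (ha0 x w) fun hc => hx ?_
    show _ * kk (N x) = 0
    have : N x = 0 := Finset.prod_eq_zero (Finset.mem_univ w) (by
      rw [← hc]; exact zero_pow (by have := hm w; omega))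
    rw [this, kk_zero, mul_zero]
  set κ := exp (-A) with hκ
  have κ0 : 0 < κ := exp_pos _
  have κ1 : κ ≤ 1 := by rw [hκ]; exact Real.exp_le_one_iff.mpr (by linarith)
  have hκx : ∀ x, h x ≠ 0 → ∀ w, κ * ‖x‖ ≤ a x w := by
    intro x hx w
    obtain ⟨w', hw'⟩ := haex x
    have h3 := hτA (fun w => log (a x w)) (left_ne_zero_of_mul hx) w w'
    have h4 : -A + log (a x w') ≤ log (a x w) := by linarith [(abs_le.mp h3).1]
    have h5 := exp_le_exp.mpr h4
    rw [exp_add, exp_log (hpos x hx _), exp_log (hpos x hx _)] at h5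
    exact (mul_le_mul_of_nonneg_left hw' κ0.le).trans h5
  set Q := (M + n * exp n) * (2 / κ) + (4 / κ + 1) with hQ
  have hQ0 : 0 ≤ Q := by positivity
  refine ⟨Q, κ⁻¹, hQ0, by positivity, ?_, ?_⟩
  · have main : ∀ x y, h x ≠ 0 → |h x - h y| ≤ Q * ‖x - y‖ := by
      intro x y hx
      have hx0 : 0 < ‖x‖ := by
        obtain ⟨w, _⟩ := haex 0
        exact (hpos x hx w).trans_le (hale x w)
      rcases le_or_gt (κ / 2 * ‖x‖) ‖x - y‖ with hc | hc
      · have e1 : |h x - h y| ≤ ‖x‖ + ‖y‖ := by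
          rw [abs_le]; constructor <;> linarith [hnn x, hnn y, hle x, hle y]
        have e2 : ‖y‖ ≤ ‖x‖ + ‖x - y‖ := by
          have := norm_sub_norm_le y x
          rw [norm_sub_rev] at this; linarith
        have e3 : ‖x‖ ≤ 2 / κ * ‖x - y‖ := by
          rw [div_mul_eq_mul_div, le_div_iff₀ κ0]; linarith
        have e4 : 0 ≤ (M + n * exp n) * (2 / κ) * ‖x - y‖ := by positivity
        have : Q * ‖x - y‖ = (M + n * exp n) * (2 / κ) * ‖x - y‖ + 2 * (2 / κ * ‖x - y‖) + ‖x - y‖ := by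
          rw [hQ]; ring
        linarith
      · set D := 2 / κ * ‖x - y‖ / ‖x‖ with hD
        have D0 : 0 ≤ D := by positivity
        have D1 : D ≤ 1 := by
          rw [hD, div_le_one hx0, div_mul_eq_mul_div, div_le_iff₀ κ0]; linarith
        have hy : ∀ w, κ / 2 * ‖x‖ ≤ a y w := by
          intro w
          have := (abs_le.mp (haL x y w)).2
          have := hκx x hx w
          linarith
        have hy0 : ∀ w, 0 < a y w := fun w => lt_of_lt_of_le (by positivity) (hy w)
        have logd : ∀ p q : ℝ, κ / 2 * ‖x‖ ≤ p → κ / 2 * ‖x‖ ≤ q → |p - q| ≤ ‖x - y‖ →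
            log p - log q ≤ D := by
          intro p q hp hq hpq
          have hq0 : 0 < q := lt_of_lt_of_le (by positivity) hq
          have hp0 : 0 < p := lt_of_lt_of_le (by positivity) hp
          rw [← Real.log_div hp0.ne' hq0.ne']
          have := Real.log_le_sub_one_of_pos (div_pos hp0 hq0)
          refine this.trans ?_
          have e : p / q - 1 = (p - q) / q := by field_simp
          rw [e, div_le_iff₀ hq0]
          have : D * (κ / 2 * ‖x‖) = ‖x - y‖ := by rw [hD]; field_simp
          have := mul_le_mul_of_nonneg_left hq D0
          linarith [(abs_le.mp hpq).2]
        have hxw : ∀ w, κ / 2 * ‖x‖ ≤ a x w := fun w =>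
          le_trans (by nlinarith) (hκx x hx w)
        have lD : ∀ w, |log (a x w) - log (a y w)| ≤ D := by
          intro w
          rw [abs_le]
          have e1 := logd _ _ (hxw w) (hy w) (haL x y w)
          have e2 := logd _ _ (hy w) (hxw w) (by rw [abs_sub_comm]; exact haL x y w)
          constructor <;> linarith
        have t1 := hτL _ _ D lD
        have Nx1 := hN1 x hx
        have Nxle := Nle' x Nx1.le
        have Nx0 : 0 < N x := Finset.prod_pos fun w _ => pow_pos (hpos x hx w) _
        have Ny0 : 0 < N y := Finset.prod_pos fun w _ => pow_pos (hy0 w) _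
        have hNd : |N x - N y| ≤ ‖x‖ * (n * exp n * D) := by
          set s := log (N y) - log (N x) with hs
          have hsD : |s| ≤ n * D := by
            have : s = ∑ w, (m w : ℝ) * (log (a y w) - log (a x w)) := by
              rw [hs, hN]
              simp only
              rw [Real.log_prod (fun w _ => (pow_pos (hy0 w) _).ne'),
                Real.log_prod (fun w _ => (pow_pos (hpos x hx w) _).ne'), ← Finset.sum_sub_distrib]
              apply Finset.sum_congr rfl
              intro w _
              rw [Real.log_pow, Real.log_pow]; ring
            rw [this, hn]
            push_cast
            rw [Finset.sum_mul]
            refine (Finset.abs_sum_le_sum_abs _ _).trans (Finset.sum_le_sum fun w _ => ?_)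
            rw [abs_mul, Nat.abs_cast, abs_sub_comm]
            exact mul_le_mul_of_nonneg_left (lD w) (Nat.cast_nonneg _)
          have e1 : N y = N x * exp s := by
            rw [hs, exp_sub, exp_log Nx0, exp_log Ny0]; field_simp
          have hsn : |s| ≤ n := hsD.trans (mul_le_of_le_one_right (Nat.cast_nonneg _) D1)
          have e2 : |exp s - 1| ≤ exp n * (n * D) := by
            have b1 : exp s - 1 ≤ exp n * (n * D) := by
              have := Real.add_one_le_exp (-s)
              have h3 : exp s * (1 - s) ≤ 1 := by
                have : exp s * exp (-s) = 1 := by rw [← exp_add]; simp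
                nlinarith [exp_pos s]
              have h4 : exp s - 1 ≤ exp s * s := by linarith
              have h5 : exp s * s ≤ exp s * (n * D) :=
                mul_le_mul_of_nonneg_left ((le_abs_self s).trans hsD) (exp_pos s).le
              have h6 : exp s * (n * D) ≤ exp n * (n * D) :=
                mul_le_mul_of_nonneg_right (exp_le_exp.mpr ((le_abs_self s).trans hsn)) (by positivity)
              linarith
            have b2 : -(exp n * (n * D)) ≤ exp s - 1 := by
              have := Real.add_one_le_exp s
              have h3 : 1 * (n * D) ≤ exp n * (n * D) :=
                mul_le_mul_of_nonneg_right (Real.one_le_exp (by positivity)) (by positivity)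
              have := neg_abs_le s
              linarith
            exact abs_le.mpr ⟨b2, b1⟩
          rw [e1]
          have : N x - N x * exp s = - (N x * (exp s - 1)) := by ring
          rw [this, abs_neg, abs_mul, abs_of_pos Nx0]
          refine mul_le_mul Nxle (e2.trans (le_of_eq (by ring))) (abs_nonneg _) hx0.le
        have t2 := (kk_lip (N0 x) (N0 y)).trans hNd
        set τx := τ (fun w => log (a x w))
        set τy := τ (fun w => log (a y w))
        have e : h x - h y = (τx - τy) * kk (N x) + τy * (kk (N x) - kk (N y)) := by
          show τx * kk (N x) - τy * kk (N y) = _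
          ring
        have f1 : |(τx - τy) * kk (N x)| ≤ M * D * ‖x‖ := by
          rw [abs_mul, abs_of_nonneg (kk_nonneg (N0 x))]
          exact mul_le_mul t1 ((kk_le_self (N0 x)).trans Nxle) (kk_nonneg (N0 x)) (by positivity)
        have f2 : |τy * (kk (N x) - kk (N y))| ≤ ‖x‖ * (n * exp n * D) := by
          rw [abs_mul, abs_of_nonneg (h0 _)]
          exact (mul_le_of_le_one_left (abs_nonneg _) (h1 _)).trans t2
        rw [e]
        refine (abs_add_le _ _).trans ((add_le_add f1 f2).trans ?_)
        have g1 : D * ‖x‖ = 2 / κ * ‖x - y‖ := by rw [hD]; field_simp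
        have g2 : M * D * ‖x‖ + ‖x‖ * (n * exp n * D) = (M + n * exp n) * (D * ‖x‖) := by ring
        rw [g2, g1, hQ]
        have : 0 ≤ (4 / κ + 1) * ‖x - y‖ := by positivity
        linarith
    intro x y
    by_cases hx : h x = 0
    · by_cases hy : h y = 0
      · show |h x - h y| ≤ _
        rw [hx, hy]; simp; positivity
      · show |h x - h y| ≤ _
        rw [abs_sub_comm, norm_sub_rev]
        exact main y x hy
    · exact main x y hx
  · intro x hx
    by_contra hc
    have h2 := hN1 x hc
    have h3 : (1:ℝ) ≤ N x := by
      rw [hN, ← Finset.prod_const_one (s := Finset.univ (α := W))]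
      refine Finset.prod_le_prod (fun _ _ => zero_le_one) fun w _ => ?_
      apply one_le_pow₀
      have := hκx x hc w
      rw [inv_lt_iff_one_lt_mul₀ κ0] at hx
      linarith
    linarith
end PIT


namespace PIT
open MeasureTheory Set Topology

section units
open NumberField NumberField.InfinitePlace NumberField.mixedEmbedding NumberField.Units NumberField.Units.dirichletUnitTheorem Module
variable (K : Type*) [Field K] [NumberField K]

open scoped Classical in
/-- Real basis of the log space given by the unit lattice. -/
noncomputable def UB : Basis (Fin (rank K)) ℝ (logSpace K) :=
  (basisUnitLattice K).ofZLatticeBasis ℝ (unitLattice K)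

/-- The cut-off function on the mixed space. -/
noncomputable def hK (x : mixedSpace K) : ℝ :=
  (∏ i, tri 1 ((UB K).repr (logMap x) i)) * kk (mixedEmbedding.norm x)

/-- The linear model of `logMap`. -/
noncomputable def logLin : (InfinitePlace K → ℝ) →ₗ[ℝ] logSpace K where
  toFun l := fun w => mult w.val * (l w.val - (∑ v, (mult v : ℝ) * l v) * (finrank ℚ K : ℝ)⁻¹)
  map_add' l l' := by
    ext w
    simp only [Pi.add_apply, mul_add, Finset.sum_add_distrib]
    ring
  map_smul' c l := by
    ext w
    simp only [Pi.smul_apply, smul_eq_mul, RingHom.id_apply]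
    have : ∑ v : InfinitePlace K, (mult v : ℝ) * (c * l v) = c * ∑ v, (mult v : ℝ) * l v := by
      rw [Finset.mul_sum]; exact Finset.sum_congr rfl fun _ _ => by ring
    rw [this]; ring

lemma logMap_eq_logLin {x : mixedSpace K} (hx : mixedEmbedding.norm x ≠ 0) :
    logMap x = logLin K (fun w => log (normAtPlace w x)) := by
  ext w
  rw [logMap_apply]
  simp only [logLin, LinearMap.coe_mk, AddHom.coe_mk]
  rw [mixedEmbedding.norm_apply, Real.log_prod]
  · simp only [Real.log_pow]
  · intro w _
    exact pow_ne_zero _ (mixedEmbedding.norm_ne_zero_iff.mp hx w)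

open scoped Classical in
lemma hK_lip : ∃ L R : ℝ, 0 ≤ L ∧ 0 ≤ R ∧ (∀ x y, |hK K x - hK K y| ≤ L * ‖x - y‖) ∧
    ∀ x, R < ‖x‖ → hK K x = 0 := by

  set τ : (InfinitePlace K → ℝ) → ℝ := fun l => ∏ i, tri 1 ((UB K).repr (logLin K l) i) with hτ
  set Λ : (InfinitePlace K → ℝ) →ₗ[ℝ] (Fin (rank K) → ℝ) :=
    (UB K).equivFun.toLinearMap ∘ₗ logLin K with hΛ
  set Λ' : (InfinitePlace K → ℝ) →L[ℝ] (Fin (rank K) → ℝ) := LinearMap.toContinuousLinearMap Λ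
  set Γ : (Fin (rank K) → ℝ) →L[ℝ] logSpace K :=
    LinearMap.toContinuousLinearMap (UB K).equivFun.symm.toLinearMap
  have hfac : ∀ l i, (UB K).repr (logLin K l) i = Λ' l i := fun l i => rfl
  have hmult : ∀ w : InfinitePlace K, 1 ≤ mult w := fun w => mult_pos
  have hfin : (0:ℝ) < finrank ℚ K := by exact_mod_cast finrank_pos
  have hex : ∀ x : mixedSpace K, ∃ w, ‖x‖ ≤ normAtPlace w x := by
    intro x
    rw [norm_eq_sup'_normAtPlace]
    obtain ⟨w, _, hw⟩ := Finset.exists_mem_eq_sup' Finset.univ_nonempty fun w => normAtPlace w x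
    exact ⟨w, hw.le⟩
  have hle : ∀ (x : mixedSpace K) w, normAtPlace w x ≤ ‖x‖ := by
    intro x w
    rw [norm_eq_sup'_normAtPlace]
    exact Finset.le_sup' (fun w => normAtPlace w x) (Finset.mem_univ w)
  have := lip_abstract (fun (x : mixedSpace K) w => normAtPlace w x)
    (fun x w => normAtPlace_nonneg w x)
    (fun x y w => by
      have e1 : ∀ x y : mixedSpace K, normAtPlace w x - normAtPlace w y ≤ ‖x - y‖ := by
        intro x y
        have := normAtPlace_add_le w (x - y) y
        rw [sub_add_cancel] at this
        linarith [hle (x - y) w]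
      rw [abs_le]
      have h1 := e1 x y
      have h2 := e1 y x
      rw [norm_sub_rev] at h2
      constructor <;> linarith)
    hle hex mult hmult τ
    (fun l => Finset.prod_nonneg fun i _ => tri_nonneg _ _)
    (fun l => Finset.prod_le_one (fun i _ => tri_nonneg _ _) fun i _ => tri_le_one one_pos)
    (rank K * ‖Λ'‖) (2 * ((Fintype.card (InfinitePlace K) * 2) * ‖Γ‖))
    (by positivity) (by positivity)
    (fun l l' D hD => by
      have hD0 : 0 ≤ D := by
        obtain ⟨w, _⟩ := hex 0
        exact (abs_nonneg _).trans (hD w)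
      refine (prod_lip _ _ _ (fun _ => tri_nonneg _ _) (fun _ => tri_le_one one_pos)
        (fun _ => tri_nonneg _ _) (fun _ => tri_le_one one_pos)).trans ?_
      have : ∀ i ∈ (Finset.univ : Finset (Fin (rank K))), |tri 1 ((UB K).repr (logLin K l) i) - tri 1 ((UB K).repr (logLin K l') i)| ≤ ‖Λ'‖ * D := by
        intro i _
        refine (tri_lip _ _).trans ?_
        rw [hfac, hfac, ← Pi.sub_apply, ← map_sub, ← Real.norm_eq_abs]
        refine (norm_le_pi_norm _ i).trans ((Λ'.le_opNorm _).trans ?_)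
        refine mul_le_mul_of_nonneg_left ?_ (norm_nonneg _)
        rw [pi_norm_le_iff_of_nonneg hD0]
        exact hD
      refine (Finset.sum_le_sum this).trans ?_
      simp [mul_assoc])
    (fun l hl => by
      have h1 : ‖Λ' l‖ ≤ 1 := by
        rw [pi_norm_le_iff_of_nonneg zero_le_one]
        intro i
        by_contra hc
        apply hl
        refine Finset.prod_eq_zero (Finset.mem_univ i) (tri_eq_zero one_pos ?_)
        rw [hfac]; exact (not_le.mp hc).le
      have h2 : Γ (Λ' l) = logLin K l := (UB K).equivFun.symm_apply_apply _
      have h3 : ‖logLin K l‖ ≤ ‖Γ‖ := by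
        rw [← h2]
        exact (Γ.le_opNorm _).trans (mul_le_of_le_one_right (norm_nonneg _) h1)
      set T := (∑ v, (mult v : ℝ) * l v) * (finrank ℚ K : ℝ)⁻¹ with hT
      have h4 : ∀ w : InfinitePlace K, w ≠ w₀ → |mult w * (l w - T)| ≤ ‖Γ‖ := by
        intro w hw
        exact (norm_le_pi_norm (logLin K l) ⟨w, hw⟩).trans h3
      have h5 : ∑ w, (mult w : ℝ) * (l w - T) = 0 := by
        simp only [mul_sub, Finset.sum_sub_distrib]
        rw [← Finset.sum_mul, ← Nat.cast_sum, sum_mult_eq, hT]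
        field_simp; ring
      have h6 : |mult (w₀ : InfinitePlace K) * (l w₀ - T)| ≤ Fintype.card (InfinitePlace K) * ‖Γ‖ := by
        rw [← Finset.add_sum_erase _ _ (Finset.mem_univ (w₀ : InfinitePlace K))] at h5
        rw [eq_neg_of_add_eq_zero_left h5, abs_neg]
        refine (Finset.abs_sum_le_sum_abs _ _).trans ?_
        refine (Finset.sum_le_sum (g := fun _ => ‖Γ‖) fun w hw => h4 w (Finset.ne_of_mem_erase hw)).trans ?_
        rw [Finset.sum_const, nsmul_eq_mul]
        refine mul_le_mul_of_nonneg_right ?_ (norm_nonneg _)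
        exact_mod_cast Finset.card_le_univ _
      have hc1 : (1:ℝ) ≤ Fintype.card (InfinitePlace K) := by
        exact_mod_cast Fintype.card_pos
      have h7 : ∀ w : InfinitePlace K, |l w - T| ≤ (Fintype.card (InfinitePlace K) * 2) * ‖Γ‖ := by
        intro w
        have h8 : |mult w * (l w - T)| ≤ (Fintype.card (InfinitePlace K) * 2) * ‖Γ‖ := by
          by_cases hw : w = w₀
          · rw [hw]; refine h6.trans ?_
            nlinarith [norm_nonneg Γ]
          · refine (h4 w hw).trans ?_
            nlinarith [norm_nonneg Γ]
        refine le_trans ?_ h8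
        rw [abs_mul, Nat.abs_cast]
        exact le_mul_of_one_le_left (abs_nonneg _) (by exact_mod_cast hmult w)
      intro w w'
      have := h7 w
      have h9 := h7 w'
      rw [abs_le] at *
      constructor <;> linarith [this.1, this.2, h9.1, h9.2])
  have key : ∀ x, hK K x = τ (fun w => log (normAtPlace w x)) * kk (∏ w, normAtPlace w x ^ mult w) := by
    intro x
    rw [← mixedEmbedding.norm_apply, hK]
    by_cases hx : mixedEmbedding.norm x = 0
    · rw [hx, kk_zero, mul_zero, mul_zero]
    · rw [logMap_eq_logLin K hx]
  simp only [key]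
  exact this

lemma sum_tri_int (c : ℝ) : ∑ m ∈ ({⌊-c⌋, ⌊-c⌋ + 1} : Finset ℤ), tri 1 (c + m) = 1 := by
  have h1 := Int.floor_le (-c)
  have h2 := Int.lt_floor_add_one (-c)
  rw [Finset.sum_pair (by simp)]
  unfold tri
  push_cast
  rw [abs_of_nonpos (by linarith), abs_of_nonneg (by linarith), max_eq_right (by linarith),
    max_eq_right (by linarith)]
  ring

lemma tri_int_zero {c : ℝ} {m : ℤ} (h : m ∉ ({⌊-c⌋, ⌊-c⌋ + 1} : Finset ℤ)) : tri 1 (c + m) = 0 := by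
  have h1 := Int.floor_le (-c)
  have h2 := Int.lt_floor_add_one (-c)
  simp only [Finset.mem_insert, Finset.mem_singleton, not_or] at h
  apply tri_eq_zero one_pos
  rcases lt_or_gt_of_ne h.1 with h3 | h3
  · have : (m : ℝ) + 1 ≤ ⌊-c⌋ := by exact_mod_cast h3
    rw [le_abs]; right; linarith
  · have h4 : ⌊-c⌋ + 1 < m := lt_of_le_of_ne h3 (Ne.symm h.2)
    have : (⌊-c⌋ : ℝ) + 1 + 1 ≤ m := by exact_mod_cast h4
    rw [le_abs]; left; linarith

lemma UB_logEmbedding (m : Fin (rank K) → ℤ) (ζ : torsion K) (i : Fin (rank K)) :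
    (UB K).repr (logEmbedding K (Additive.ofMul ((ζ : (𝓞 K)ˣ) * ∏ j, (fundSystem K j) ^ (m j)))) i = m i := by
  have : logEmbedding K (Additive.ofMul ((ζ : (𝓞 K)ˣ) * ∏ j, (fundSystem K j) ^ (m j))) =
      ∑ j, (m j : ℝ) • UB K j := by
    rw [ofMul_mul, map_add, logEmbedding_eq_zero_iff.mpr ζ.2, zero_add, ofMul_prod, map_sum]
    apply Finset.sum_congr rfl
    intro j _
    rw [ofMul_zpow, map_zsmul, logEmbedding_fundSystem, UB, Basis.ofZLatticeBasis_apply,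
      Int.cast_smul_eq_zsmul]
  rw [this, Basis.repr_sum_self]

/-- The unit group as torsion times a free group. -/
noncomputable def unitEquiv : (torsion K × (Fin (rank K) → ℤ)) ≃ (𝓞 K)ˣ :=
  Equiv.ofBijective (fun p => (p.1 : (𝓞 K)ˣ) * ∏ j, (fundSystem K j) ^ (p.2 j)) (by
    rw [Function.bijective_iff_existsUnique]
    intro u
    obtain ⟨p, hp, hq⟩ := exist_unique_eq_mul_prod K u
    exact ⟨p, hp.symm, fun q h => hq q h.symm⟩)

lemma hasSum_units (x : mixedSpace K) (hx : mixedEmbedding.norm x ≠ 0) (t : ℝ) (ht : 0 < t) :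
    HasSum (fun u : (𝓞 K)ˣ => hK K (t⁻¹ • (u • x)))
      (torsionOrder K * kk ((t ^ finrank ℚ K)⁻¹ * mixedEmbedding.norm x)) := by
  classical
  haveI : Fintype (torsion K) := Fintype.ofFinite _
  rw [← (unitEquiv K).hasSum_iff]
  set c : Fin (rank K) → ℝ := fun i => (UB K).repr (logMap x) i
  have key : ∀ p : torsion K × (Fin (rank K) → ℤ), hK K (t⁻¹ • ((unitEquiv K p) • x)) =
      (∏ i, tri 1 (c i + p.2 i)) * kk ((t ^ finrank ℚ K)⁻¹ * mixedEmbedding.norm x) := by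
    intro p
    rw [hK, logMap_real_smul (by rwa [norm_unit_smul]) (by positivity), mixedEmbedding.norm_smul,
      norm_unit_smul, abs_of_pos (by positivity), inv_pow,
      logMap_unit_smul _ hx]
    congr 1
    apply Finset.prod_congr rfl
    intro i _
    rw [map_add, Finsupp.add_apply]
    have : (unitEquiv K p) = (p.1 : (𝓞 K)ˣ) * ∏ j, (fundSystem K j) ^ (p.2 j) := rfl
    rw [this, UB_logEmbedding, add_comm]
  set S : Finset (torsion K × (Fin (rank K) → ℤ)) :=
    Finset.univ ×ˢ Fintype.piFinset fun i => ({⌊-c i⌋, ⌊-c i⌋ + 1} : Finset ℤ)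
  have hs : ∑ p ∈ S, hK K (t⁻¹ • ((unitEquiv K p) • x)) =
      torsionOrder K * kk ((t ^ finrank ℚ K)⁻¹ * mixedEmbedding.norm x) := by
    simp only [key]
    rw [← Finset.sum_mul, Finset.sum_product]
    simp only
    rw [Finset.sum_const, ← Finset.prod_univ_sum (fun i => ({⌊-c i⌋, ⌊-c i⌋ + 1} : Finset ℤ))
      (fun i m => tri 1 (c i + m))]
    simp only [sum_tri_int, Finset.prod_const_one, nsmul_eq_mul, mul_one, Finset.card_univ]
    rw [torsionOrder, Nat.card_eq_fintype_card]
  rw [← hs]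
  apply hasSum_sum_of_ne_finset_zero
  intro p hp
  show hK K (t⁻¹ • ((unitEquiv K p) • x)) = 0
  rw [key]
  have : ∃ i, p.2 i ∉ ({⌊-c i⌋, ⌊-c i⌋ + 1} : Finset ℤ) := by
    by_contra hc
    push Not at hc
    exact hp (Finset.mem_product.mpr ⟨Finset.mem_univ _, Fintype.mem_piFinset.mpr hc⟩)
  obtain ⟨i, hi⟩ := this
  rw [Finset.prod_eq_zero (Finset.mem_univ i) (tri_int_zero hi), zero_mul]

end units
end PIT


namespace PIT
open MeasureTheory Set Topology

section ideals
open NumberField NumberField.InfinitePlace NumberField.mixedEmbedding NumberField.Units Module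
open scoped nonZeroDivisors
variable (K : Type*) [Field K] [NumberField K]

/-- Nonzero principal multiples of `J`. -/
abbrev Pr (J : (Ideal (𝓞 K))⁰) :=
  {I : (Ideal (𝓞 K))⁰ // (J : Ideal (𝓞 K)) ∣ I ∧ (I : Ideal (𝓞 K)).IsPrincipal}

/-- generator -/
noncomputable def gen {J : (Ideal (𝓞 K))⁰} (I : Pr K J) : 𝓞 K := I.2.2.principal.choose

lemma span_gen {J : (Ideal (𝓞 K))⁰} (I : Pr K J) : Ideal.span {gen K I} = (I.1 : Ideal (𝓞 K)) :=
  I.2.2.principal.choose_spec.symm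

lemma gen_ne_zero {J : (Ideal (𝓞 K))⁰} (I : Pr K J) : gen K I ≠ 0 := by
  intro h
  have h1 := span_gen K I
  rw [h] at h1
  simp at h1
  exact nonZeroDivisors.coe_ne_zero I.1 h1.symm

/-- parametrisation of nonzero elements of `J` by ideals and units -/
noncomputable def Psi (J : (Ideal (𝓞 K))⁰) (p : Pr K J × (𝓞 K)ˣ) : mixedSpace K :=
  p.2 • mixedEmbedding K (gen K p.1)

lemma Psi_eq (J : (Ideal (𝓞 K))⁰) (p : Pr K J × (𝓞 K)ˣ) :
    Psi K J p = mixedEmbedding K (((p.2 : 𝓞 K) * gen K p.1 : 𝓞 K) : K) := by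
  rw [Psi, unitSMul_smul, ← map_mul]
  rfl

lemma Psi_inj (J : (Ideal (𝓞 K))⁰) : Function.Injective (Psi K J) := by
  rintro ⟨I, u⟩ ⟨I', u'⟩ h
  rw [Psi_eq, Psi_eq] at h
  have h1 : (u : 𝓞 K) * gen K I = u' * gen K I' :=
    RingOfIntegers.coe_injective (mixedEmbedding_injective K h)
  have h2 : I = I' := by
    apply Subtype.ext
    apply Subtype.ext
    rw [← span_gen K I, ← span_gen K I', Ideal.span_singleton_eq_span_singleton]
    refine ⟨u * u'⁻¹, ?_⟩
    push_cast
    rw [← mul_assoc, mul_comm (gen K I), h1]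
    rw [mul_right_comm]; simp
  subst h2
  rw [Prod.mk.injEq]
  exact ⟨rfl, Units.ext (mul_right_cancel₀ (gen_ne_zero K I) h1)⟩

lemma range_Psi (J : (Ideal (𝓞 K))⁰) :
    Set.range (Psi K J) = {y | ∃ a : 𝓞 K, a ∈ (J : Ideal (𝓞 K)) ∧ a ≠ 0 ∧ mixedEmbedding K a = y} := by
  ext y
  constructor
  · rintro ⟨⟨I, u⟩, rfl⟩
    refine ⟨(u : 𝓞 K) * gen K I, ?_, mul_ne_zero u.ne_zero (gen_ne_zero K I), (Psi_eq K J ⟨I, u⟩).symm⟩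
    apply Ideal.mul_mem_left
    have : gen K I ∈ Ideal.span {gen K I} := Ideal.mem_span_singleton_self _
    rw [span_gen] at this
    exact Ideal.le_of_dvd I.2.1 this
  · rintro ⟨a, haJ, ha0, rfl⟩
    let I : Pr K J := ⟨⟨Ideal.span {a}, mem_nonZeroDivisors_of_ne_zero (by simpa using ha0)⟩,
      by rw [Ideal.dvd_span_singleton]; exact haJ, ⟨a, rfl⟩⟩
    have h := span_gen K I
    rw [Ideal.span_singleton_eq_span_singleton] at h
    obtain ⟨u, hu⟩ := h
    refine ⟨⟨I, u⟩, ?_⟩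
    rw [Psi_eq]
    simp only
    rw [mul_comm, hu]

open scoped Classical in
lemma hasSum_Pr (J : (Ideal (𝓞 K))⁰) : ∃ c C : ℝ, ∀ t : ℝ, 1 ≤ t → ∃ S : ℝ,
    HasSum (fun I : Pr K J => (torsionOrder K : ℝ) *
      kk ((t ^ finrank ℚ K)⁻¹ * Ideal.absNorm (I.1 : Ideal (𝓞 K)))) S ∧
    |S - c * t ^ finrank ℚ K| ≤ C * t ^ (finrank ℚ K - 1) := by
  obtain ⟨L, R, hL0, hR0, hL, hR⟩ := hK_lip K
  set 𝔍 := FractionalIdeal.mk0 K J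
  set b := fractionalIdealLatticeBasis K 𝔍
  have hcard : Fintype.card (Free.ChooseBasisIndex ℤ 𝔍) = finrank ℚ K := by
    rw [← finrank_eq_card_chooseBasisIndex, fractionalIdeal_rank, RingOfIntegers.rank]
  have : Nonempty (Free.ChooseBasisIndex ℤ 𝔍) := by
    rw [← Fintype.card_pos_iff, hcard]; exact finrank_pos
  obtain ⟨c, C, hcC⟩ := riemann_basis b (hK K) L R hL0 hL hR0 hR
  refine ⟨c, C, fun t ht => ?_⟩
  obtain ⟨hfin, hb⟩ := hcC t ht
  rw [hcard] at hb
  refine ⟨_, ?_, hb⟩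
  set Φ : (Free.ChooseBasisIndex ℤ 𝔍 → ℤ) → mixedSpace K := fun m => ∑ i, (m i : ℝ) • b i with hΦ
  set G : mixedSpace K → ℝ := fun y => hK K (t⁻¹ • y) with hG
  have s1 : HasSum (G ∘ Φ) (∑' m, hK K (t⁻¹ • Φ m)) :=
    (summable_of_hasFiniteSupport hfin).hasSum
  have Φinj : Function.Injective Φ := by
    intro m m' h
    have h2 : b.repr (Φ m) = b.repr (Φ m') := by rw [h]
    ext i
    have h3 := DFunLike.congr_fun h2 i
    rw [hΦ] at h3
    simp only [Basis.repr_sum_self] at h3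
    exact_mod_cast h3
  have Φrange : Set.range Φ = {y | ∃ a : 𝓞 K, a ∈ (J : Ideal (𝓞 K)) ∧ mixedEmbedding K a = y} := by
    ext y
    have e1 : y ∈ Set.range Φ ↔ y ∈ Submodule.span ℤ (Set.range b) := by
      rw [Submodule.mem_span_range_iff_exists_fun]
      simp only [hΦ, Set.mem_range, Int.cast_smul_eq_zsmul]
    rw [e1, mem_span_fractionalIdealLatticeBasis]
    constructor
    · rintro ⟨z, hz, rfl⟩
      have : z ∈ ((J : Ideal (𝓞 K)) : FractionalIdeal (𝓞 K)⁰ K) := hz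
      rw [FractionalIdeal.mem_coeIdeal] at this
      obtain ⟨a, ha, rfl⟩ := this
      exact ⟨a, ha, rfl⟩
    · rintro ⟨a, ha, rfl⟩
      refine ⟨a, ?_, rfl⟩
      show (a : K) ∈ ((J : Ideal (𝓞 K)) : FractionalIdeal (𝓞 K)⁰ K)
      rw [FractionalIdeal.mem_coeIdeal]
      exact ⟨a, ha, rfl⟩
  have hG0 : G 0 = 0 := by
    simp [hG, hK, kk_zero]
  have s2 : HasSum (G ∘ Psi K J) (∑' m, hK K (t⁻¹ • Φ m)) := by
    rw [← (Psi_inj K J).hasSum_range_iff]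
    rw [← Φinj.hasSum_range_iff] at s1
    have i1 := (hasSum_subtype_iff_indicator (f := G) (s := Set.range Φ)).mp s1
    refine (hasSum_subtype_iff_indicator (f := G) (s := Set.range (Psi K J))).mpr ?_
    convert i1 using 1
    ext y
    by_cases hy : y = 0
    · subst hy; simp only [Set.indicator, hG0, ite_self]
    · have : y ∈ Set.range (Psi K J) ↔ y ∈ Set.range Φ := by
        rw [range_Psi, Φrange]
        constructor
        · rintro ⟨a, h1, _, h2⟩; exact ⟨a, h1, h2⟩
        · rintro ⟨a, h1, h2⟩
          refine ⟨a, h1, ?_, h2⟩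
          rintro rfl
          exact hy (by rw [← h2]; simp)
      simp only [Set.indicator, this]
  refine s2.prod_fiberwise fun I => ?_
  have hnz : mixedEmbedding.norm (mixedEmbedding K (gen K I : K)) = Ideal.absNorm (I.1 : Ideal (𝓞 K)) := by
    rw [norm_eq_norm, ← span_gen K I, Ideal.absNorm_span_singleton]
    rw [← Algebra.coe_norm_int]
    push_cast
    rw [Nat.cast_natAbs]
    push_cast
    rfl
  have := hasSum_units K (mixedEmbedding K (gen K I : K)) (by
    rw [hnz]
    have := Ideal.absNorm_ne_zero_of_nonZeroDivisors I.1
    exact_mod_cast this) t (by linarith)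
  rw [hnz] at this
  exact this

/-- coefficients of the Dedekind zeta function -/
noncomputable def aK (n : ℕ) : ℝ := Nat.card {I : Ideal (𝓞 K) // Ideal.absNorm I = n}

lemma hasSum_class (C : ClassGroup (𝓞 K)) : ∃ c D : ℝ, ∀ x : ℝ, 1 ≤ x → ∃ S : ℝ,
    HasSum (fun I : {I : (Ideal (𝓞 K))⁰ // ClassGroup.mk0 I = C} =>
      kk (Ideal.absNorm (I.1 : Ideal (𝓞 K)) / x)) S ∧
    |S - c * x| ≤ D * x ^ (1 - (finrank ℚ K : ℝ)⁻¹) := by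
  obtain ⟨J, hJ⟩ := ClassGroup.mk0_surjective C⁻¹
  obtain ⟨c, D, h⟩ := hasSum_Pr K J
  set n := finrank ℚ K with hn
  have hn0 : 0 < n := finrank_pos
  have hn0' : (0:ℝ) < n := by exact_mod_cast hn0
  have hNJ : (1:ℝ) ≤ Ideal.absNorm (J : Ideal (𝓞 K)) := by
    exact_mod_cast Ideal.absNorm_pos_of_nonZeroDivisors J
  set NJ : ℝ := ((Ideal.absNorm (J : Ideal (𝓞 K)) : ℕ) : ℝ) with hNJd
  have hT : (0:ℝ) < torsionOrder K := by exact_mod_cast (torsionOrder_pos K)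
  refine ⟨c * NJ / torsionOrder K, D * NJ ^ (1 - (n : ℝ)⁻¹) / torsionOrder K, fun x hx => ?_⟩
  have hx0 : 0 < x := by linarith
  set t := (x * NJ) ^ ((n:ℝ)⁻¹) with ht
  have hxN : 1 ≤ x * NJ := by nlinarith
  have ht1 : 1 ≤ t := Real.one_le_rpow hxN (by positivity)
  have htn : t ^ n = x * NJ := by
    rw [ht]; exact Real.rpow_inv_natCast_pow (by positivity) hn0.ne'
  have htn1 : t ^ (n - 1) = NJ ^ (1 - (n : ℝ)⁻¹) * x ^ (1 - (n : ℝ)⁻¹) := by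
    rw [ht, ← Real.rpow_natCast, ← Real.rpow_mul (by positivity), Nat.cast_sub hn0, Nat.cast_one,
      mul_sub, inv_mul_cancel₀ hn0'.ne', mul_one, mul_comm x, Real.mul_rpow (by positivity) hx0.le]
  obtain ⟨S, hS, hSb⟩ := h t ht1
  rw [htn, htn1] at hSb
  rw [htn] at hS
  refine ⟨S / torsionOrder K, ?_, ?_⟩
  · let e : {I : (Ideal (𝓞 K))⁰ // ClassGroup.mk0 I = C} ≃ Pr K J := by
      refine ((Equiv.dvd J).subtypeEquiv (q := fun I => (I.1 : Ideal (𝓞 K)).IsPrincipal) fun I ↦ ?_).trans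
        ((Equiv.subtypeSubtypeEquivSubtypeInter (fun I : (Ideal (𝓞 K))⁰ ↦ J ∣ I)
          (fun I => (I : Ideal (𝓞 K)).IsPrincipal)).trans
          (Equiv.subtypeEquivRight fun I => by rw [nonZeroDivisors_dvd_iff_dvd_coe]))
      rw [← ClassGroup.mk0_eq_one_iff (SetLike.coe_mem _)]
      simp_rw [Equiv.dvd_apply, Submonoid.coe_mul, ← Submonoid.mul_def, _root_.map_mul, hJ,
        inv_mul_eq_one, eq_comm]
    have he : ∀ I, ((e I).1 : (Ideal (𝓞 K))⁰) = J * I.1 := fun I => rfl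
    rw [← e.hasSum_iff] at hS
    have hS2 := hS.div_const (torsionOrder K : ℝ)
    rw [show (fun I : {I : (Ideal (𝓞 K))⁰ // ClassGroup.mk0 I = C} => kk (Ideal.absNorm (I.1 : Ideal (𝓞 K)) / x)) = _ from funext fun I => ?_]
    · exact hS2
    show _ = (torsionOrder K * kk ((x * NJ)⁻¹ * Ideal.absNorm ((e I).1 : Ideal (𝓞 K)))) / torsionOrder K
    rw [mul_div_cancel_left₀ _ hT.ne', he]
    congr 1
    rw [Submonoid.coe_mul, map_mul, Nat.cast_mul, ← hNJd]
    field_simp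
  · have e : S / torsionOrder K - c * NJ / torsionOrder K * x =
        (S - c * (x * NJ)) / torsionOrder K := by ring
    rw [e, abs_div, abs_of_pos hT, div_mul_eq_mul_div]
    refine div_le_div_of_nonneg_right (hSb.trans (le_of_eq ?_)) hT.le
    ring

theorem W_asymp : ∃ c D : ℝ, ∀ x : ℝ, 1 ≤ x → ∃ S : ℝ,
    HasSum (fun m : ℕ => aK K m * kk (m / x)) S ∧
    |S - c * x| ≤ D * x ^ (1 - (finrank ℚ K : ℝ)⁻¹) := by
  classical
  choose c D h using hasSum_class K
  refine ⟨∑ C, c C, ∑ C, D C, fun x hx => ?_⟩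
  choose S hS hSb using fun C => h C x hx
  refine ⟨∑ C, S C, ?_, ?_⟩
  · have h1 : HasSum (fun I : (Ideal (𝓞 K))⁰ => kk (Ideal.absNorm (I : Ideal (𝓞 K)) / x)) (∑ C, S C) := by
      have := hasSum_sum (s := Finset.univ) fun C _ => (hasSum_subtype_iff_indicator
        (f := fun I : (Ideal (𝓞 K))⁰ => kk (Ideal.absNorm (I : Ideal (𝓞 K)) / x))
        (s := {I | ClassGroup.mk0 I = C})).mp (hS C)
      convert this using 1
      ext I
      simp only [Set.indicator, Set.mem_ofPred_eq]
      rw [Finset.sum_ite_eq]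
      simp
    have h2 : HasSum (fun I : Ideal (𝓞 K) => kk (Ideal.absNorm I / x)) (∑ C, S C) := by
      have h3 := (hasSum_subtype_iff_indicator (f := fun I : Ideal (𝓞 K) => kk (Ideal.absNorm I / x))
        (s := {I | I ∈ (Ideal (𝓞 K))⁰})).mp h1
      convert h3 using 1
      ext I
      by_cases hI : I = ⊥
      · subst hI; simp [kk_zero]
      · rw [Set.indicator_of_mem]
        exact mem_nonZeroDivisors_of_ne_zero hI
    rw [← (Equiv.sigmaFiberEquiv (fun I : Ideal (𝓞 K) => Ideal.absNorm I)).hasSum_iff] at h2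
    refine h2.sigma fun m => ?_
    by_cases hm : m = 0
    · subst hm
      have : ∀ I : {I : Ideal (𝓞 K) // Ideal.absNorm I = 0}, kk (Ideal.absNorm I.1 / x) = 0 := by
        intro I; rw [I.2]; simp [kk_zero]
      simp only [Function.comp, Equiv.sigmaFiberEquiv_apply, this]
      simp [kk_zero, hasSum_zero]
    have : Finite {I : Ideal (𝓞 K) // Ideal.absNorm I = m} :=
      Ideal.finite_setOfPred_absNorm_eq m
    have := Fintype.ofFinite {I : Ideal (𝓞 K) // Ideal.absNorm I = m}
    have h4 := hasSum_fintype (fun I : {I : Ideal (𝓞 K) // Ideal.absNorm I = m} => kk ((m:ℝ) / x))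
    rw [Finset.sum_const, Finset.card_univ, nsmul_eq_mul, ← Nat.card_eq_fintype_card] at h4
    have h5 : (fun I : {I : Ideal (𝓞 K) // Ideal.absNorm I = m} => kk ((Ideal.absNorm I.1 : ℝ) / x)) =
        fun _ => kk ((m:ℝ) / x) := by
      ext I; rw [I.2]
    rw [← h5] at h4
    exact h4
  · rw [Finset.sum_mul, ← Finset.sum_sub_distrib, Finset.sum_mul]
    exact (Finset.abs_sum_le_sum_abs _ _).trans (Finset.sum_le_sum fun C _ => hSb C)

end ideals
end PIT


namespace PIT
open MeasureTheory Set Topology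

lemma hasMellin_congr {f g : ℝ → ℂ} {s m : ℂ} (h : HasMellin f s m) (hfg : ∀ y, 0 < y → f y = g y) :
    HasMellin g s m := by
  have : EqOn (fun t : ℝ => (t : ℂ) ^ (s - 1) • f t) (fun t : ℝ => (t : ℂ) ^ (s - 1) • g t) (Ioi 0) := by
    intro t ht
    simp only [hfg t ht]
  refine ⟨?_, ?_⟩
  · exact (integrableOn_congr_fun this measurableSet_Ioi).mp h.1
  · rw [← h.2]
    exact (setIntegral_congr_fun measurableSet_Ioi this).symm

lemma hasMellin_kk {s : ℂ} (hs : 0 < s.re) :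
    HasMellin (fun y : ℝ => (kk y : ℂ)) s (1 / (s + 1) - 1 / (s + 2)) := by
  have h1 := hasMellin_cpow_Ioc (1 : ℂ) (s := s) (by simp; linarith)
  have h2 := hasMellin_cpow_Ioc (2 : ℂ) (s := s) (by simp; linarith)
  have h3 := hasMellin_sub h1.1 h2.1
  rw [h1.2, h2.2] at h3
  refine hasMellin_congr h3 fun y hy => ?_
  by_cases h : y ≤ 1
  · rw [indicator_of_mem (show y ∈ Ioc 0 1 from ⟨hy, h⟩),
      indicator_of_mem (show y ∈ Ioc 0 1 from ⟨hy, h⟩)]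
    unfold kk
    rw [max_eq_right (by linarith), Complex.cpow_one, Complex.cpow_ofNat]
    push_cast; ring
  · rw [indicator_of_notMem (fun h' => h h'.2), indicator_of_notMem (fun h' => h h'.2),
      kk_eq_zero (by linarith)]
    simp

lemma hasMellin_pole {s : ℂ} (hs : 1 < s.re) :
    HasMellin (fun y : ℝ => ((max 0 (y⁻¹ - 1) : ℝ) : ℂ)) s (1 / (s - 1) - 1 / s) := by
  have h1 := hasMellin_cpow_Ioc (-1 : ℂ) (s := s) (by simp; linarith)
  have h2 := hasMellin_cpow_Ioc (0 : ℂ) (s := s) (by simp; linarith)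
  have h3 := hasMellin_sub h1.1 h2.1
  rw [h1.2, h2.2, ← sub_eq_add_neg, add_zero] at h3
  refine hasMellin_congr h3 fun y hy => ?_
  by_cases h : y ≤ 1
  · rw [indicator_of_mem (show y ∈ Ioc 0 1 from ⟨hy, h⟩),
      indicator_of_mem (show y ∈ Ioc 0 1 from ⟨hy, h⟩)]
    have : 1 ≤ y⁻¹ := (one_le_inv₀ hy).mpr h
    rw [max_eq_right (by linarith), Complex.cpow_neg_one, Complex.cpow_zero]
    push_cast; ring
  · rw [indicator_of_notMem (fun h' => h h'.2), indicator_of_notMem (fun h' => h h'.2)]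
    have : y⁻¹ ≤ 1 := inv_le_one_of_one_le₀ (by linarith)
    rw [max_eq_left (by linarith)]
    simp

lemma kk_cont : Continuous kk := by unfold kk; fun_prop

/-- Smoothed counting function. -/
noncomputable def VV (a : ℕ → ℝ) (y : ℝ) : ℝ := ∑' m : ℕ, a m * kk (m * y)

lemma VV_cont (a : ℕ → ℝ) : ContinuousOn (VV a) (Ioi 0) := by
  intro y0 hy0
  have hy0 : 0 < y0 := hy0
  apply ContinuousAt.continuousWithinAt
  obtain ⟨N, hN⟩ := exists_nat_gt (2 / y0)
  have : VV a =ᶠ[𝓝 y0] fun y => ∑ m ∈ Finset.range N, a m * kk (m * y) := by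
    filter_upwards [lt_mem_nhds (show y0 / 2 < y0 by linarith)] with y hy
    refine tsum_eq_sum fun m hm => ?_
    rw [Finset.mem_range, not_lt] at hm
    have h1 : (N : ℝ) ≤ m := by exact_mod_cast hm
    rw [kk_eq_zero, mul_zero]
    rw [div_lt_iff₀ hy0] at hN
    nlinarith
  refine ContinuousAt.congr ?_ this.symm
  refine Continuous.continuousAt ?_
  refine continuous_finsetSum _ fun m _ => ?_
  exact continuous_const.mul (kk_cont.comp (by fun_prop))

lemma VV_zero (a : ℕ → ℝ) {y : ℝ} (hy : 1 ≤ y) : VV a y = 0 := by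
  unfold VV
  rw [show (fun m : ℕ => a m * kk (m * y)) = fun _ => 0 from ?_, tsum_zero]
  funext m
  rcases Nat.eq_zero_or_pos m with rfl | hm
  · simp [kk_zero]
  · have : (1 : ℝ) ≤ m := by exact_mod_cast hm
    rw [kk_eq_zero (by nlinarith), mul_zero]

/-- The remainder term. -/
noncomputable def UU (a : ℕ → ℝ) (c : ℝ) (y : ℝ) : ℂ := ((VV a y - c * max 0 (y⁻¹ - 1) : ℝ) : ℂ)

lemma UU_bound (a : ℕ → ℝ) {c D θ : ℝ} (hθ : 0 ≤ θ)
    (hW : ∀ x : ℝ, 1 ≤ x → ∃ S : ℝ, HasSum (fun m : ℕ => a m * kk (m / x)) S ∧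
      |S - c * x| ≤ D * x ^ θ) {y : ℝ} (hy : 0 < y) (hy1 : y ≤ 1) :
    ‖UU a c y‖ ≤ (D + |c|) * ‖y ^ (-θ)‖ := by
  obtain ⟨S, hS, hS2⟩ := hW y⁻¹ ((one_le_inv₀ hy).mpr hy1)
  have h1 : VV a y = S := by
    rw [← hS.tsum_eq]; unfold VV
    simp only [div_inv_eq_mul]
  have h2 : y⁻¹ ^ θ = y ^ (-θ) := by rw [inv_rpow hy.le, rpow_neg hy.le]
  have h3 : 1 ≤ y⁻¹ := (one_le_inv₀ hy).mpr hy1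
  have h4 : 1 ≤ y ^ (-θ) := by rw [← h2]; exact one_le_rpow h3 hθ
  unfold UU
  rw [Complex.norm_real, max_eq_right (by linarith), h1, norm_eq_abs, norm_eq_abs,
    abs_of_pos (by linarith : 0 < y ^ (-θ))]
  rw [h2] at hS2
  calc |S - c * (y⁻¹ - 1)| = |(S - c * y⁻¹) + c| := by ring_nf
    _ ≤ |S - c * y⁻¹| + |c| := abs_add_le _ _
    _ ≤ D * y ^ (-θ) + |c| * y ^ (-θ) := by
      gcongr
      exact le_mul_of_one_le_right (abs_nonneg _) h4
    _ = _ := by ring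

lemma UU_zero (a : ℕ → ℝ) (c : ℝ) {y : ℝ} (hy : 1 ≤ y) : UU a c y = 0 := by
  unfold UU
  rw [VV_zero a hy, max_eq_left (by linarith [inv_le_one_of_one_le₀ hy])]
  simp

lemma UU_mellin (a : ℕ → ℝ) {c D θ : ℝ} (hθ : 0 ≤ θ)
    (hW : ∀ x : ℝ, 1 ≤ x → ∃ S : ℝ, HasSum (fun m : ℕ => a m * kk (m / x)) S ∧
      |S - c * x| ≤ D * x ^ θ) {s : ℂ} (hs : θ < s.re) :
    MellinConvergent (UU a c) s ∧ DifferentiableAt ℂ (mellin (UU a c)) s := by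
  have h1 : LocallyIntegrableOn (UU a c) (Ioi 0) := by
    apply ContinuousOn.locallyIntegrableOn _ measurableSet_Ioi
    unfold UU
    apply Complex.continuous_ofReal.comp_continuousOn
    apply (VV_cont a).sub
    apply continuousOn_const.mul
    apply (continuous_const.max continuous_id : Continuous fun t : ℝ => max 0 (id t)).comp_continuousOn
    apply ContinuousOn.sub _ continuousOn_const
    exact continuousOn_inv₀.mono fun x hx => ne_of_gt hx
  have h2 : UU a c =O[atTop] (fun t : ℝ => t ^ (-(s.re + 1))) := by
    have : UU a c =ᶠ[atTop] fun _ => 0 := by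
      filter_upwards [eventually_ge_atTop 1] with y hy using UU_zero a c hy
    exact this.trans_isBigO (Asymptotics.isBigO_zero _ _)
  have h3 : UU a c =O[𝓝[>] 0] (fun t : ℝ => t ^ (-θ)) := by
    refine Asymptotics.IsBigO.of_bound (D + |c|) ?_
    filter_upwards [Ioc_mem_nhdsGT (zero_lt_one (α := ℝ))] with y hy
    exact UU_bound a hθ hW hy.1 hy.2
  exact ⟨mellinConvergent_of_isBigO_rpow h1 h2 (by linarith) h3 hs,
    mellin_differentiableAt_of_isBigO_rpow h1 h2 (by linarith) h3 hs⟩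

lemma mellin_term {s : ℂ} (hs : 0 < s.re) (a : ℕ → ℝ) (m : ℕ) :
    HasMellin (fun y : ℝ => ((a m * kk (m * y) : ℝ) : ℂ)) s
      (LSeries.term (fun n => (a n : ℂ)) s m * (1 / (s + 1) - 1 / (s + 2))) := by
  rcases Nat.eq_zero_or_pos m with rfl | hm
  · simp only [Nat.cast_zero, zero_mul, kk_zero, mul_zero, LSeries.term_zero, Complex.ofReal_zero]
    constructor
    · simp [MellinConvergent]
    · simp [mellin]
  · have hm' : (0 : ℝ) < m := by exact_mod_cast hm
    have h1 := hasMellin_kk hs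
    have h2 : HasMellin (fun y : ℝ => (kk (m * y) : ℂ)) s
        (((m : ℝ) : ℂ) ^ (-s) • (1 / (s + 1) - 1 / (s + 2))) := by
      refine ⟨(MellinConvergent.comp_mul_left hm' (f := fun y : ℝ => (kk y : ℂ))).mpr h1.1, ?_⟩
      rw [mellin_comp_mul_left (fun y : ℝ => (kk y : ℂ)) s hm', h1.2]
    have h3 := hasMellin_const_smul h2.1 (a m : ℂ)
    rw [h2.2] at h3
    convert h3 using 1
    · ext y; push_cast; rfl
    · rw [LSeries.term_of_ne_zero hm.ne', Complex.cpow_neg]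
      simp only [smul_eq_mul, Complex.ofReal_natCast]
      ring

lemma mellin_VV (a : ℕ → ℝ) (ha : ∀ n, 0 ≤ a n) {s : ℂ} (hs0 : 0 < s.re)
    (hs : LSeriesSummable (fun n => (a n : ℂ)) s) :
    mellin (fun y => (VV a y : ℂ)) s =
      LSeries (fun n => (a n : ℂ)) s * (1 / (s + 1) - 1 / (s + 2)) := by
  have hintg := fun m => (mellin_term hs0 a m).1
  have hnorm : ∀ m : ℕ, ∫ y in Ioi (0:ℝ), ‖(y : ℂ) ^ (s - 1) • ((a m * kk (m * y) : ℝ) : ℂ)‖ =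
      ‖LSeries.term (fun n => (a n : ℂ)) s m‖ * (1 / (s.re + 1) - 1 / (s.re + 2)) := by
    intro m
    have h := (mellin_term (s := (s.re : ℂ)) (by simpa using hs0) a m).2
    rw [mellin] at h
    have e1 : ∫ y in Ioi (0:ℝ), (y : ℂ) ^ ((s.re : ℂ) - 1) • ((a m * kk (m * y) : ℝ) : ℂ) =
        ((∫ y in Ioi (0:ℝ), ‖(y : ℂ) ^ (s - 1) • ((a m * kk (m * y) : ℝ) : ℂ)‖ : ℝ) : ℂ) := by
      rw [← integral_complex_ofReal]
      refine setIntegral_congr_fun measurableSet_Ioi fun y hy => ?_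
      have hy : 0 < y := hy
      have : (y : ℂ) ^ ((s.re : ℂ) - 1) = ((y ^ (s.re - 1) : ℝ) : ℂ) := by
        rw [Complex.ofReal_cpow hy.le]; push_cast; rfl
      simp only [norm_smul, Complex.norm_cpow_eq_rpow_re_of_pos hy, Complex.norm_real, norm_eq_abs]
      rw [abs_of_nonneg (mul_nonneg (ha m) (kk_nonneg (by positivity))), this]
      simp
    rw [e1] at h
    have e2 : LSeries.term (fun n => (a n : ℂ)) (s.re : ℂ) m =
        ((‖LSeries.term (fun n => (a n : ℂ)) s m‖ : ℝ) : ℂ) := by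
      rcases Nat.eq_zero_or_pos m with rfl | hm
      · simp
      · have hm' : (0 : ℝ) < m := by exact_mod_cast hm
        rw [LSeries.term_of_ne_zero hm.ne', LSeries.norm_term_eq, if_neg hm.ne',
          Complex.norm_real, norm_eq_abs, abs_of_nonneg (ha m)]
        push_cast
        rw [Complex.ofReal_cpow hm'.le]
        simp
    rw [e2] at h
    exact_mod_cast h
  have h1 := hasSum_integral_of_summable_integral_norm
    (F := fun (m : ℕ) (y : ℝ) => (y : ℂ) ^ (s - 1) • ((a m * kk (m * y) : ℝ) : ℂ)) hintg
    (by simp_rw [hnorm]; exact hs.norm.mul_right _)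
  have h2 : (fun m : ℕ => ∫ y in Ioi (0:ℝ), (y : ℂ) ^ (s - 1) • ((a m * kk (m * y) : ℝ) : ℂ)) =
      fun m => LSeries.term (fun n => (a n : ℂ)) s m * (1 / (s + 1) - 1 / (s + 2)) :=
    funext fun m => (mellin_term hs0 a m).2
  rw [h2] at h1
  have h3 := (hs.hasSum.mul_right (1 / (s + 1) - 1 / (s + 2)))
  have h4 := h1.unique h3
  rw [LSeries, ← h4, mellin]
  refine setIntegral_congr_fun measurableSet_Ioi fun y hy => ?_
  simp only [smul_eq_mul]
  rw [tsum_mul_left, VV, Complex.ofReal_tsum]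

lemma continuation (a : ℕ → ℝ) (ha : ∀ n, 0 ≤ a n) {c D θ : ℝ} (hθ : 0 ≤ θ) (hθ1 : θ < 1)
    (hW : ∀ x : ℝ, 1 ≤ x → ∃ S : ℝ, HasSum (fun m : ℕ => a m * kk (m / x)) S ∧
      |S - c * x| ≤ D * x ^ θ)
    (hsum : ∀ s : ℂ, 1 < s.re → LSeriesSummable (fun n => (a n : ℂ)) s) :
    ∃ Z : ℂ → ℂ, DifferentiableOn ℂ Z {s | θ < s.re} ∧
      ∀ s : ℂ, 1 < s.re → Z s = (s - 1) * LSeries (fun n => (a n : ℂ)) s := by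
  refine ⟨fun s => (s + 1) * (s + 2) * ((s - 1) * mellin (UU a c) s + c / s), ?_, ?_⟩
  · intro s hs
    have hs : θ < s.re := hs
    have h1 := (UU_mellin a hθ hW hs).2
    have hs0 : s ≠ 0 := by rintro rfl; simp at hs; linarith
    apply DifferentiableAt.differentiableWithinAt
    fun_prop (disch := assumption)
  · intro s hs
    have h1 := (UU_mellin a hθ hW (hθ1.trans hs)).1
    have h2 := hasMellin_pole hs
    have h3 := hasMellin_const_smul h2.1 (c : ℂ)
    have h4 := hasMellin_add h1 h3.1
    have h5 : mellin (fun y => (VV a y : ℂ)) s = mellin (UU a c) s + c * (1 / (s - 1) - 1 / s) := by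
      rw [h3.2, h2.2, smul_eq_mul] at h4
      rw [← h4.2]
      congr 1
      ext y
      simp [UU]
    rw [mellin_VV a ha (by linarith) (hsum s hs)] at h5
    have e0 : s ≠ 0 := by rintro rfl; simp at hs; linarith
    have e1 : s - 1 ≠ 0 := by
      intro h; rw [sub_eq_zero] at h; rw [h] at hs; simp at hs
    have e2 : s + 1 ≠ 0 := by
      intro h; have := congrArg Complex.re h; simp at this; linarith
    have e3 : s + 2 ≠ 0 := by
      intro h; have := congrArg Complex.re h; simp at this; linarith
    have h6 : LSeries (fun n => (a n : ℂ)) s =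
        (s + 1) * (s + 2) * (mellin (UU a c) s + c * (1 / (s - 1) - 1 / s)) := by
      rw [← h5]; field_simp; ring
    rw [h6]
    field_simp
    ring

end PIT


namespace PIT
open MeasureTheory Set Topology

section vonMangoldt
open NumberField IsDedekindDomain
open scoped ENNReal

variable (K : Type*) [Field K] [NumberField K]

/-- `log N 𝔭` as an extended nonnegative real. -/
noncomputable def ell (v : HeightOneSpectrum (𝓞 K)) : ℝ≥0∞ :=
  ENNReal.ofReal (Real.log (Ideal.absNorm v.asIdeal))

open scoped Classical in
lemma sum_ell_mul (v v0 : HeightOneSpectrum (𝓞 K)) (J : Ideal (𝓞 K)) :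
    ∑' k : ℕ, (if v0.asIdeal ^ (k + 1) ∣ v.asIdeal * J then ell K v0 else 0) =
      (if v0 = v then ell K v else 0) +
        ∑' k : ℕ, (if v0.asIdeal ^ (k + 1) ∣ J then ell K v0 else 0) := by
  by_cases h : v0 = v
  · subst h
    rw [if_pos rfl]
    have : ∀ k : ℕ, (v0.asIdeal ^ (k + 1) ∣ v0.asIdeal * J ↔ v0.asIdeal ^ k ∣ J) := by
      intro k
      rw [pow_succ']
      exact mul_dvd_mul_iff_left v0.ne_bot
    simp only [this]
    rw [tsum_eq_zero_add']
    · simp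
    · exact ENNReal.summable
  · rw [if_neg h, zero_add]
    congr 1
    ext k
    have hnd : ¬ v0.asIdeal ∣ v.asIdeal := by
      intro hd
      rw [Ideal.dvd_iff_le] at hd
      exact h (HeightOneSpectrum.ext (v.isMaximal.eq_of_le v0.isPrime.ne_top hd).symm)
    have hp : Prime v0.asIdeal := v0.prime
    have : v0.asIdeal ^ (k + 1) ∣ v.asIdeal * J ↔ v0.asIdeal ^ (k + 1) ∣ J :=
      ⟨fun hd => hp.pow_dvd_of_dvd_mul_left _ hnd hd, fun hd => hd.mul_left _⟩
    simp only [this]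

open scoped Classical in
lemma sum_ell (I : Ideal (𝓞 K)) (hI : I ≠ ⊥) :
    ∑' v : HeightOneSpectrum (𝓞 K), ∑' k : ℕ, (if v.asIdeal ^ (k + 1) ∣ I then ell K v else 0) =
      ENNReal.ofReal (Real.log (Ideal.absNorm I)) := by
  induction I using UniqueFactorizationMonoid.induction_on_prime with
  | h₁ => exact absurd rfl hI
  | h₂ I hu =>
    have : I = ⊤ := by simpa using hu
    subst this
    have h : ∀ (v : HeightOneSpectrum (𝓞 K)) (k : ℕ), ¬ v.asIdeal ^ (k + 1) ∣ ⊤ := by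
      intro v k hd
      exact v.prime.not_isUnit (isUnit_of_dvd_unit ((dvd_pow_self _ (by omega)).trans hd) hu)
    simp [h]
  | h₃ J p hJ hp ih =>
    have hJ' : J ≠ ⊥ := hJ
    obtain ⟨v, rfl⟩ : ∃ v : HeightOneSpectrum (𝓞 K), v.asIdeal = p :=
      ⟨⟨p, Ideal.isPrime_of_prime hp, hp.ne_zero⟩, rfl⟩
    simp only [sum_ell_mul]
    rw [ENNReal.tsum_add, ih hJ', tsum_ite_eq, map_mul, Nat.cast_mul, Real.log_mul,
      ENNReal.ofReal_add]
    · rfl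
    · exact Real.log_natCast_nonneg _
    · exact Real.log_natCast_nonneg _
    · exact_mod_cast fun h => v.ne_bot (Ideal.absNorm_eq_zero_iff.mp h)
    · exact_mod_cast fun h => hJ' (Ideal.absNorm_eq_zero_iff.mp h)

open scoped Classical in
/-- von Mangoldt function of a number field, extended-real version. -/
noncomputable def LE (m : ℕ) : ℝ≥0∞ :=
  ∑' v : HeightOneSpectrum (𝓞 K), ∑' k : ℕ,
    (if Ideal.absNorm v.asIdeal ^ (k + 1) = m then ell K v else 0)

open scoped Classical in
/-- ideal counting function, extended-real version. -/
noncomputable def aE (m : ℕ) : ℝ≥0∞ :=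
  ∑' I : Ideal (𝓞 K), (if Ideal.absNorm I = m then 1 else 0)

lemma aE_eq {m : ℕ} (hm : m ≠ 0) : aE K m = ENNReal.ofReal (aK K m) := by
  classical
  have : Finite ({I : Ideal (𝓞 K) | Ideal.absNorm I = m} : Set _) := Ideal.finite_setOfPred_absNorm_eq m
  have : Fintype ({I : Ideal (𝓞 K) | Ideal.absNorm I = m} : Set _) := Fintype.ofFinite _
  unfold aE aK
  rw [ENNReal.ofReal_natCast]
  have h := tsum_subtype {I : Ideal (𝓞 K) | Ideal.absNorm I = m} (fun _ => (1 : ℝ≥0∞))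
  simp only [indicator_apply, Set.mem_ofPred_eq] at h
  rw [← h, tsum_fintype]
  simp only [Finset.sum_const, nsmul_eq_mul, mul_one, Finset.card_univ]
  rw [← Nat.card_eq_fintype_card]
  rfl

lemma conv_aux (n : ℕ) (hn : n ≠ 0) (x y : ℕ) (c : ℝ≥0∞) :
    ∑ p ∈ n.divisorsAntidiagonal, ((if x = p.1 then c else 0) * (if y = p.2 then 1 else 0)) =
      if x * y = n then c else 0 := by
  classical
  by_cases h : x * y = n
  · rw [if_pos h, Finset.sum_eq_single (x, y)]
    · simp
    · rintro ⟨a, b⟩ _ hne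
      by_cases h1 : x = a
      · by_cases h2 : y = b
        · subst h1; subst h2; exact absurd rfl hne
        · simp [h2]
      · simp [h1]
    · intro h'; exact absurd (Nat.mem_divisorsAntidiagonal.mpr ⟨h, hn⟩) h'
  · rw [if_neg h]
    refine Finset.sum_eq_zero ?_
    rintro ⟨a, b⟩ hab
    have hab := (Nat.mem_divisorsAntidiagonal.mp hab).1
    by_cases h1 : x = a
    · by_cases h2 : y = b
      · subst h1; subst h2; exact absurd hab h
      · simp [h2]
    · simp [h1]

open scoped Classical in
lemma conv_aux2 (n : ℕ) (Q : Ideal (𝓞 K)) (hQ : Q ≠ ⊥) (c : ℝ≥0∞) :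
    ∑' J : Ideal (𝓞 K), (if Ideal.absNorm Q * Ideal.absNorm J = n then c else 0) =
      ∑' I : Ideal (𝓞 K), (if Ideal.absNorm I = n then (if Q ∣ I then c else 0) else 0) := by
  have hinj : Function.Injective (fun J : Ideal (𝓞 K) => Q * J) := mul_right_injective₀ hQ
  rw [← hinj.tsum_eq (f := fun I : Ideal (𝓞 K) =>
    (if Ideal.absNorm I = n then (if Q ∣ I then c else 0) else 0))]
  · simp
  · intro I hI
    rw [Function.mem_support] at hI
    by_cases h : Q ∣ I
    · obtain ⟨J, rfl⟩ := h; exact ⟨J, rfl⟩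
    · simp [h] at hI

lemma conv_E (n : ℕ) (hn : n ≠ 0) :
    ∑ p ∈ n.divisorsAntidiagonal, LE K p.1 * aE K p.2 = aE K n * ENNReal.ofReal (Real.log n) := by
  classical
  have h1 : ∀ p : ℕ × ℕ, LE K p.1 * aE K p.2 = ∑' v : HeightOneSpectrum (𝓞 K), ∑' k : ℕ,
      ∑' J : Ideal (𝓞 K), ((if Ideal.absNorm v.asIdeal ^ (k + 1) = p.1 then ell K v else 0) *
        (if Ideal.absNorm J = p.2 then 1 else 0)) := by
    intro p
    simp only [LE, aE, ENNReal.tsum_mul_right, ENNReal.tsum_mul_left]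
  simp only [h1]
  rw [← Summable.tsum_finsetSum (fun _ _ => ENNReal.summable)]
  have h2 : ∀ v : HeightOneSpectrum (𝓞 K), ∑ p ∈ n.divisorsAntidiagonal, ∑' k : ℕ,
      ∑' J : Ideal (𝓞 K), ((if Ideal.absNorm v.asIdeal ^ (k + 1) = p.1 then ell K v else 0) *
        (if Ideal.absNorm J = p.2 then 1 else 0)) = ∑' k : ℕ, ∑' I : Ideal (𝓞 K),
          (if Ideal.absNorm I = n then (if v.asIdeal ^ (k + 1) ∣ I then ell K v else 0) else 0) := by
    intro v
    rw [← Summable.tsum_finsetSum (fun _ _ => ENNReal.summable)]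
    congr 1
    ext k
    rw [← Summable.tsum_finsetSum (fun _ _ => ENNReal.summable),
      ← conv_aux2 K n _ (pow_ne_zero _ v.ne_bot)]
    congr 1
    ext J
    rw [conv_aux n hn, map_pow]
  simp only [h2]
  have h3 : ∀ v : HeightOneSpectrum (𝓞 K), ∑' k : ℕ, ∑' I : Ideal (𝓞 K),
          (if Ideal.absNorm I = n then (if v.asIdeal ^ (k + 1) ∣ I then ell K v else 0) else 0) =
      ∑' I : Ideal (𝓞 K), ∑' k : ℕ,
          (if Ideal.absNorm I = n then (if v.asIdeal ^ (k + 1) ∣ I then ell K v else 0) else 0) :=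
    fun v => ENNReal.tsum_comm
  simp only [h3]
  rw [ENNReal.tsum_comm, aE, ← ENNReal.tsum_mul_right]
  congr 1
  ext I
  by_cases h : Ideal.absNorm I = n
  · simp only [h, if_true, one_mul]
    rw [sum_ell, h]
    rintro rfl
    simp at h
    exact hn h.symm
  · simp [h]

/-- Real von Mangoldt function of a number field. -/
noncomputable def LK (m : ℕ) : ℝ := (LE K m).toReal

lemma aK_one : aK K 1 = 1 := by
  unfold aK
  simp [Ideal.absNorm_eq_one_iff]

lemma norm_ge_two (v : HeightOneSpectrum (𝓞 K)) : 2 ≤ Ideal.absNorm v.asIdeal := by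
  have h0 : Ideal.absNorm v.asIdeal ≠ 0 := fun h => v.ne_bot (Ideal.absNorm_eq_zero_iff.mp h)
  have h1 : Ideal.absNorm v.asIdeal ≠ 1 := fun h => v.isPrime.ne_top (Ideal.absNorm_eq_one_iff.mp h)
  omega

lemma LE_zero : LE K 0 = 0 := by
  have : ∀ v : HeightOneSpectrum (𝓞 K), Ideal.absNorm v.asIdeal ≠ 0 := fun v => by
    have := norm_ge_two K v; omega
  simp [LE, this]

lemma LE_ne_top (m : ℕ) : LE K m ≠ ⊤ := by
  rcases eq_or_ne m 0 with rfl | hm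
  · rw [LE_zero]; simp
  have h := conv_E K m hm
  have h2 : LE K m * aE K 1 ≤ aE K m * ENNReal.ofReal (Real.log m) := by
    rw [← h]
    exact Finset.single_le_sum (f := fun p : ℕ × ℕ => LE K p.1 * aE K p.2) (fun _ _ => zero_le)
      (Nat.mem_divisorsAntidiagonal.mpr ⟨mul_one m, hm⟩ : (m, 1) ∈ _)
  rw [aE_eq K one_ne_zero, aK_one, ENNReal.ofReal_one, mul_one, aE_eq K hm] at h2
  exact ne_top_of_le_ne_top (ENNReal.mul_ne_top ENNReal.ofReal_ne_top ENNReal.ofReal_ne_top) h2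

lemma LK_nonneg (m : ℕ) : 0 ≤ LK K m := ENNReal.toReal_nonneg
lemma aK_nonneg (m : ℕ) : 0 ≤ aK K m := by unfold aK; positivity

lemma conv_real (n : ℕ) (hn : n ≠ 0) :
    ∑ p ∈ n.divisorsAntidiagonal, LK K p.1 * aK K p.2 = aK K n * Real.log n := by
  have h := congrArg ENNReal.toReal (conv_E K n hn)
  rw [ENNReal.toReal_sum, ENNReal.toReal_mul, aE_eq K hn, ENNReal.toReal_ofReal (aK_nonneg K _),
    ENNReal.toReal_ofReal (Real.log_natCast_nonneg _)] at h
  · rw [← h]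
    refine Finset.sum_congr rfl fun p hp => ?_
    have := Nat.mem_divisorsAntidiagonal.mp hp
    have hp2 : p.2 ≠ 0 := by rintro h; rw [h] at this; simp at this; exact this.2 this.1.symm
    rw [ENNReal.toReal_mul, aE_eq K hp2, ENNReal.toReal_ofReal (aK_nonneg K _)]
    rfl
  · intro p hp
    have := Nat.mem_divisorsAntidiagonal.mp hp
    have hp2 : p.2 ≠ 0 := by rintro h; rw [h] at this; simp at this; exact this.2 this.1.symm
    rw [aE_eq K hp2]
    exact ENNReal.mul_ne_top (LE_ne_top K _) ENNReal.ofReal_ne_top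

end vonMangoldt
end PIT


namespace PIT
open MeasureTheory Set Topology

section vonMangoldt2
open NumberField IsDedekindDomain
open scoped ENNReal
variable (K : Type*) [Field K] [NumberField K]

lemma norm_primePow (v : HeightOneSpectrum (𝓞 K)) : IsPrimePow (Ideal.absNorm v.asIdeal) := by
  have := v.isMaximal
  let _ := Ideal.Quotient.field v.asIdeal
  have : Finite (𝓞 K ⧸ v.asIdeal) := Ideal.finiteQuotientOfFreeOfNeBot _ v.ne_bot
  let _ := Fintype.ofFinite (𝓞 K ⧸ v.asIdeal)
  have h := FiniteField.isPrimePow_card (𝓞 K ⧸ v.asIdeal)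
  rwa [Ideal.absNorm_apply, Submodule.cardQuot_apply, Nat.card_eq_fintype_card]

lemma dvd_of_norm (v : HeightOneSpectrum (𝓞 K)) {k p j : ℕ}
    (h : Ideal.absNorm v.asIdeal ^ (k + 1) = p ^ j) : v.asIdeal ∣ Ideal.span {(p : 𝓞 K)} := by
  rw [Ideal.dvd_span_singleton]
  have h1 : ((Ideal.absNorm v.asIdeal : ℕ) : 𝓞 K) ∈ v.asIdeal := Ideal.absNorm_mem _
  have h2 : ((p ^ j : ℕ) : 𝓞 K) ∈ v.asIdeal := by
    rw [← h]; push_cast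
    exact Ideal.pow_mem_of_mem _ h1 _ (by omega)
  push_cast at h2
  exact v.isPrime.mem_of_pow_mem _ h2

lemma LE_le (m : ℕ) : LE K m ≤ ENNReal.ofReal (Module.finrank ℚ K * ArithmeticFunction.vonMangoldt m) := by
  classical
  by_cases hm : IsPrimePow m
  · obtain ⟨p, j, hp, hj, rfl⟩ := hm
    have hp := hp.nat_prime
    have hp0 : (Ideal.span {(p : 𝓞 K)}) ≠ ⊥ := by
      rw [Ne, Ideal.span_singleton_eq_bot]
      exact_mod_cast hp.ne_zero
    have h1 := sum_ell K (Ideal.span {(p : 𝓞 K)}) hp0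
    rw [Ideal.absNorm_span_natCast, RingOfIntegers.rank] at h1
    rw [ArithmeticFunction.vonMangoldt_apply_pow hj.ne',
      ArithmeticFunction.vonMangoldt_apply_prime hp]
    have h2 : (Module.finrank ℚ K : ℝ) * Real.log p = Real.log ((p ^ (Module.finrank ℚ K) : ℕ)) := by
      push_cast; rw [Real.log_pow]
    rw [h2, ← h1]
    refine ENNReal.tsum_le_tsum fun v => ?_
    by_cases hex : ∃ k : ℕ, Ideal.absNorm v.asIdeal ^ (k + 1) = p ^ j
    · obtain ⟨k, hk⟩ := hex
      have hd := dvd_of_norm K v hk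
      calc _ = ∑' i : ℕ, (if i = k then ell K v else 0) := by
            congr 1; ext i
            have : Ideal.absNorm v.asIdeal ^ (i + 1) = p ^ j ↔ i = k := by
              rw [← hk]
              constructor
              · intro h
                have := Nat.pow_right_injective (norm_ge_two K v) h
                omega
              · rintro rfl; rfl
            simp only [this]
        _ = ell K v := tsum_ite_eq k _
        _ = (if v.asIdeal ^ (0 + 1) ∣ Ideal.span {(p : 𝓞 K)} then ell K v else 0) := by
            simp [hd]
        _ ≤ _ := ENNReal.le_tsum (f := fun i : ℕ =>
            (if v.asIdeal ^ (i + 1) ∣ Ideal.span {(p : 𝓞 K)} then ell K v else 0)) 0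
    · push Not at hex
      simp [hex]
  · have h : ∀ (v : HeightOneSpectrum (𝓞 K)) (k : ℕ), Ideal.absNorm v.asIdeal ^ (k + 1) ≠ m := by
      rintro v k rfl
      exact hm ((norm_primePow K v).pow (by omega))
    simp [LE, h]

lemma LK_le (m : ℕ) : LK K m ≤ Module.finrank ℚ K * ArithmeticFunction.vonMangoldt m := by
  have h : 0 ≤ Module.finrank ℚ K * ArithmeticFunction.vonMangoldt m :=
    mul_nonneg (by positivity) ArithmeticFunction.vonMangoldt_nonneg
  exact ENNReal.toReal_le_of_le_ofReal h (LE_le K m)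

lemma LE_eq (m : ℕ) : LE K m = ENNReal.ofReal (LK K m) :=
  (ENNReal.ofReal_toReal (LE_ne_top K m)).symm

/-- The Chebyshev function of a number field. -/
noncomputable def PsiF (x : ℝ) : ℝ := ∑ n ∈ Finset.Ioc 0 ⌊x⌋₊, LK K n

lemma PsiF_le (x : ℝ) : PsiF K x ≤ Module.finrank ℚ K * Chebyshev.psi x := by
  unfold PsiF Chebyshev.psi
  rw [Finset.mul_sum]
  exact Finset.sum_le_sum fun n _ => LK_le K n

lemma finite_primes (x : ℝ) : {𝔭 : Ideal (𝓞 K) | 𝔭.IsPrime ∧ 𝔭 ≠ ⊥ ∧ (Ideal.absNorm 𝔭 : ℝ) ≤ x}.Finite := by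
  refine (Ideal.finite_setOfPred_absNorm_le ⌊x⌋₊).subset ?_
  rintro I ⟨_, _, h⟩
  exact Nat.le_floor h

open scoped Classical in
lemma LE_prime {m : ℕ} (hm : m.Prime) :
    LE K m = ∑' v : HeightOneSpectrum (𝓞 K), (if Ideal.absNorm v.asIdeal = m then ell K v else 0) := by
  unfold LE
  congr 1; ext v
  rw [tsum_eq_single 0]
  · simp
  · intro k hk
    rw [if_neg]
    rintro rfl
    exact Nat.Prime.not_prime_pow (by omega) hm

lemma PsiF_le_pi {x : ℝ} (hx : 1 ≤ x) : PsiF K x ≤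
    ({𝔭 : Ideal (𝓞 K) | 𝔭.IsPrime ∧ 𝔭 ≠ ⊥ ∧ (Ideal.absNorm 𝔭 : ℝ) ≤ x}.ncard : ℝ) * Real.log x +
      Module.finrank ℚ K * (Chebyshev.psi x - Chebyshev.theta x) := by
  classical
  have hsplit : PsiF K x = (∑ n ∈ Finset.Ioc 0 ⌊x⌋₊ with n.Prime, LK K n) +
      ∑ n ∈ Finset.Ioc 0 ⌊x⌋₊ with ¬ n.Prime, LK K n := by
    unfold PsiF
    rw [Finset.sum_filter_add_sum_filter_not]
  rw [hsplit, Chebyshev.psi_sub_theta_eq_sum_not_prime, Finset.mul_sum]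
  refine add_le_add ?_ (Finset.sum_le_sum fun n _ => LK_le K n)
  set A := {𝔭 : Ideal (𝓞 K) | 𝔭.IsPrime ∧ 𝔭 ≠ ⊥ ∧ (Ideal.absNorm 𝔭 : ℝ) ≤ x} with hA
  have hlog : 0 ≤ Real.log x := Real.log_nonneg hx
  have hfin : A.Finite := finite_primes K x
  rw [← ENNReal.ofReal_le_ofReal_iff (by positivity), ENNReal.ofReal_sum_of_nonneg
    (fun n _ => LK_nonneg K n)]
  have h1 : ∀ n ∈ (Finset.Ioc 0 ⌊x⌋₊).filter Nat.Prime, ENNReal.ofReal (LK K n) =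
      ∑' v : HeightOneSpectrum (𝓞 K), (if Ideal.absNorm v.asIdeal = n then ell K v else 0) := by
    intro n hn
    rw [← LE_eq, LE_prime K (Finset.mem_filter.mp hn).2]
  rw [Finset.sum_congr rfl h1, ← Summable.tsum_finsetSum (fun _ _ => ENNReal.summable)]
  have h2 : ∀ v : HeightOneSpectrum (𝓞 K), (∑ n ∈ (Finset.Ioc 0 ⌊x⌋₊).filter Nat.Prime,
      (if Ideal.absNorm v.asIdeal = n then ell K v else 0)) ≤
      A.indicator (fun _ => ENNReal.ofReal (Real.log x)) v.asIdeal := by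
    intro v
    rw [Finset.sum_ite_eq]
    split_ifs with h
    · have h3 := (Finset.mem_Ioc.mp (Finset.mem_filter.mp h).1)
      have h4 : (Ideal.absNorm v.asIdeal : ℝ) ≤ x := (Nat.le_floor_iff (by linarith)).mp h3.2
      rw [indicator_of_mem (show v.asIdeal ∈ A from ⟨v.isPrime, v.ne_bot, h4⟩)]
      apply ENNReal.ofReal_le_ofReal
      exact Real.log_le_log (by exact_mod_cast h3.1) h4
    · exact zero_le
  refine (ENNReal.tsum_le_tsum h2).trans ?_
  have hinj : Function.Injective (fun v : HeightOneSpectrum (𝓞 K) => v.asIdeal) :=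
    fun v w h => HeightOneSpectrum.ext h
  refine (ENNReal.tsum_comp_le_tsum_of_injective hinj
    (A.indicator (fun _ => ENNReal.ofReal (Real.log x)))).trans ?_
  rw [← tsum_subtype A]
  have := hfin.fintype
  rw [tsum_fintype, Finset.sum_const, Finset.card_univ, nsmul_eq_mul, ENNReal.ofReal_mul (by positivity),
    ENNReal.ofReal_natCast, ← Nat.card_eq_fintype_card, Nat.card_coe_set_eq]

lemma aK_summable {s : ℂ} (hs : 1 < s.re) : LSeriesSummable (fun n => (aK K n : ℂ)) s := by
  have h := ((Ideal.tendsto_norm_le_div_atTop₀ K).comp tendsto_natCast_atTop_atTop)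
  have h1 : (fun n : ℕ => ∑ k ∈ Finset.Icc 1 n, aK K k) =O[atTop] fun n => (n : ℝ) ^ (1 : ℝ) := by
    have h2 := h.isBigO_one ℝ
    have h3 := h2.mul (Asymptotics.isBigO_refl (fun n : ℕ => (n : ℝ)) atTop)
    simp only [one_mul] at h3
    simp only [rpow_one]
    refine Asymptotics.IsBigO.congr' h3 ?_ (by rfl)
    filter_upwards [eventually_ne_atTop 0] with n hn
    have hn' : (n : ℝ) ≠ 0 := by exact_mod_cast hn
    simp only [Function.comp_apply]
    rw [div_mul_cancel₀ _ hn']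
    simp only [Nat.cast_le, aK, ← Nat.cast_sum]
    congr
    rw [← add_left_inj 1, ← Ideal.card_norm_le_eq_card_norm_le_add_one,
      show Finset.Icc 1 n = Finset.Ioc 0 n from Finset.Icc_succ_left_eq_Ioc _ _,
      show 1 = Nat.card {I : Ideal (𝓞 K) // Ideal.absNorm I = 0} by simp [Ideal.absNorm_eq_zero_iff],
      Finset.sum_Ioc_add_eq_sum_Icc (n.zero_le),
      ← Finset.card_preimage_eq_sum_card_image_eq (fun k _ ↦ Ideal.finite_setOfPred_absNorm_eq k)]
    simp [Set.coe_eq_subtype]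
  exact LSeriesSummable_of_sum_norm_bigO_and_nonneg h1 (fun n => aK_nonneg K n) zero_le_one hs

lemma LK_summable {s : ℂ} (hs : 1 < s.re) : LSeriesSummable (fun n => (LK K n : ℂ)) s := by
  have h := (ArithmeticFunction.LSeriesSummable_vonMangoldt hs).norm.mul_left (Module.finrank ℚ K : ℝ)
  refine Summable.of_norm_bounded h fun n => ?_
  rw [LSeries.norm_term_eq, LSeries.norm_term_eq]
  split_ifs with hn
  · simp
  · rw [← mul_div_assoc]
    gcongr
    rw [Complex.norm_real, Complex.norm_real, norm_eq_abs, norm_eq_abs, abs_of_nonneg (LK_nonneg K n),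
      abs_of_nonneg ArithmeticFunction.vonMangoldt_nonneg]
    exact LK_le K n

lemma abscissa_le {f : ℕ → ℂ} (h : ∀ s : ℂ, 1 < s.re → LSeriesSummable f s) :
    LSeries.abscissaOfAbsConv f ≤ 1 := by
  exact_mod_cast LSeries.abscissaOfAbsConv_le_of_forall_lt_LSeriesSummable' (x := 1) (f := f)
    fun y hy => h y (by simpa using (by exact_mod_cast hy : (1:ℝ) < y))

lemma abscissa_lt {f : ℕ → ℂ} (h : ∀ s : ℂ, 1 < s.re → LSeriesSummable f s) {s : ℂ}
    (hs : 1 < s.re) : LSeries.abscissaOfAbsConv f < s.re :=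
  (abscissa_le h).trans_lt (by exact_mod_cast hs)

lemma zeta_deriv {s : ℂ} (hs : 1 < s.re) :
    HasDerivAt (LSeries (fun n => (aK K n : ℂ)))
      (-(LSeries (fun n => (LK K n : ℂ)) s * LSeries (fun n => (aK K n : ℂ)) s)) s := by
  have h := LSeries_hasDerivAt (f := fun n => (aK K n : ℂ))
    (abscissa_lt (fun s hs => aK_summable K hs) hs)
  convert h using 2
  rw [← LSeries_convolution' (LK_summable K hs) (aK_summable K hs)]
  refine LSeries_congr (fun {n} hn => ?_) s
  rw [LSeries.convolution_def]
  have h := conv_real K n hn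
  simp only [LSeries.logMul]
  rw [← Complex.natCast_log, mul_comm]
  exact_mod_cast h

end vonMangoldt2
end PIT


namespace PIT
open MeasureTheory Set Topology

lemma tendsto_pos_aux (s0 : ℂ) : Tendsto (fun e : ℝ => s0 + (e : ℂ)) (𝓝[>] 0) (𝓝 s0) := by
  have : Continuous (fun e : ℝ => s0 + (e : ℂ)) := by fun_prop
  have h := this.tendsto 0
  simp only [Complex.ofReal_zero, add_zero] at h
  exact h.mono_left nhdsWithin_le_nhds

lemma logDeriv_order {Z : ℂ → ℂ} {s0 : ℂ} (hZ : AnalyticAt ℂ Z s0) (hne : ¬ ∀ᶠ z in 𝓝 s0, Z z = 0) :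
    ∃ m : ℕ, (m = 0 → Z s0 ≠ 0) ∧
      Tendsto (fun e : ℝ => (e : ℂ) * (deriv Z (s0 + e) / Z (s0 + e))) (𝓝[>] 0) (𝓝 (m : ℂ)) ∧
      ∀ᶠ e : ℝ in 𝓝[>] 0, Z (s0 + e) ≠ 0 := by
  obtain ⟨m, g, hg, hg0, hev⟩ := hZ.exists_eventuallyEq_pow_smul_nonzero_iff.mpr hne
  have hpos : ∀ᶠ e : ℝ in 𝓝[>] 0, 0 < e := eventually_mem_nhdsWithin
  have hgc : ∀ᶠ z in 𝓝 s0, g z ≠ 0 := hg.continuousAt.eventually_ne hg0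
  have hga : ∀ᶠ z in 𝓝 s0, AnalyticAt ℂ g z := hg.eventually_analyticAt
  have hev2 : ∀ᶠ z in 𝓝 s0, deriv Z z = deriv (fun z => (z - s0) ^ m • g z) z := by
    exact (EventuallyEq.deriv hev)
  refine ⟨m, ?_, ?_, ?_⟩
  · rintro rfl
    rw [hev.self_of_nhds]; simpa using hg0
  · have h1 : Tendsto (fun e : ℝ => (m : ℂ) + (e : ℂ) * (deriv g (s0 + e) / g (s0 + e))) (𝓝[>] 0)
        (𝓝 ((m : ℂ) + 0 * (deriv g s0 / g s0))) := by
      refine tendsto_const_nhds.add (Tendsto.mul ?_ (Tendsto.div ?_ ?_ hg0))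
      · have := tendsto_pos_aux 0
        simpa using this
      · exact hg.deriv.continuousAt.tendsto.comp (tendsto_pos_aux s0)
      · exact hg.continuousAt.tendsto.comp (tendsto_pos_aux s0)
    rw [zero_mul, add_zero] at h1
    refine h1.congr' ?_
    filter_upwards [(tendsto_pos_aux s0).eventually (hev.and (hgc.and (hga.and hev2))), hpos]
      with e ⟨h2, h3, h4, h5⟩ he
    have he' : (e : ℂ) ≠ 0 := by exact_mod_cast he.ne'
    rw [h2, h5]
    have hd : HasDerivAt (fun z => (z - s0) ^ m • g z)
        ((m : ℂ) * (s0 + e - s0) ^ (m - 1) * 1 * g (s0 + e) + (s0 + e - s0) ^ m * deriv g (s0 + e))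
        (s0 + e) := by
      have := (((hasDerivAt_id (s0 + (e:ℂ))).sub_const s0).pow m).mul h4.differentiableAt.hasDerivAt
      refine (this : HasDerivAt (fun z => (z - s0) ^ m • g z) _ _).congr_deriv ?_
      simp
    rw [hd.deriv]
    simp only [add_sub_cancel_left, smul_eq_mul, mul_one]
    rcases m with _ | m
    · simp
    · simp only [Nat.add_sub_cancel]
      field_simp
      ring
  · filter_upwards [(tendsto_pos_aux s0).eventually (hev.and hgc), hpos] with e ⟨h2, h3⟩ he
    have he' : (e : ℂ) ≠ 0 := by exact_mod_cast he.ne'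
    rw [h2]
    simp only [add_sub_cancel_left, smul_eq_mul]
    exact mul_ne_zero (pow_ne_zero _ he') h3

lemma three_four_one (a : ℕ → ℝ) (ha : ∀ n, 0 ≤ a n)
    (hs : ∀ s : ℂ, 1 < s.re → LSeriesSummable (fun n => (a n : ℂ)) s) {σ : ℝ} (hσ : 1 < σ) (t : ℝ) :
    0 ≤ (3 * LSeries (fun n => (a n : ℂ)) σ + 4 * LSeries (fun n => (a n : ℂ)) (σ + t * Complex.I)
      + LSeries (fun n => (a n : ℂ)) (σ + 2 * t * Complex.I)).re := by
  have h0 := (hs σ (by simpa using hσ)).hasSum.mul_left 3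
  have h1 := (hs (σ + t * Complex.I) (by simpa using hσ)).hasSum.mul_left 4
  have h2 := (hs (σ + 2 * t * Complex.I) (by simpa using hσ)).hasSum
  have h3 := Complex.hasSum_re ((h0.add h1).add h2)
  refine h3.nonneg fun n => ?_
  rcases Nat.eq_zero_or_pos n with rfl | hn
  · simp
  simp only [LSeries.term_of_ne_zero hn.ne']
  have hn0 : (n : ℂ) ≠ 0 := by exact_mod_cast hn.ne'
  set w : ℂ := (n : ℂ) ^ (-(t * Complex.I)) with hw
  have hwn : ‖w‖ = 1 := by
    rw [hw, Complex.norm_natCast_cpow_of_pos hn]; simp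
  have e1 : (a n : ℂ) / (n : ℂ) ^ ((σ : ℂ) + t * Complex.I) = (a n : ℂ) / (n : ℂ) ^ (σ : ℂ) * w := by
    rw [Complex.cpow_add _ _ hn0, hw, Complex.cpow_neg]; field_simp
  have e2 : (a n : ℂ) / (n : ℂ) ^ ((σ : ℂ) + 2 * t * Complex.I) = (a n : ℂ) / (n : ℂ) ^ (σ : ℂ) * w ^ 2 := by
    have : (σ : ℂ) + 2 * t * Complex.I = σ + t * Complex.I + t * Complex.I := by ring
    rw [this, Complex.cpow_add _ _ hn0, Complex.cpow_add _ _ hn0, hw, Complex.cpow_neg]; field_simp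
  have e3 : (a n : ℂ) / (n : ℂ) ^ (σ : ℂ) = ((a n / (n : ℝ) ^ σ : ℝ) : ℂ) := by
    push_cast
    rw [Complex.ofReal_cpow (by positivity)]; simp
  rw [e1, e2, e3]
  have e4 : 3 * ((a n / (n : ℝ) ^ σ : ℝ) : ℂ) + 4 * (((a n / (n : ℝ) ^ σ : ℝ) : ℂ) * w) +
      ((a n / (n : ℝ) ^ σ : ℝ) : ℂ) * w ^ 2 = ((a n / (n : ℝ) ^ σ : ℝ) : ℂ) * (3 + 4 * w + w ^ 2) := by ring
  rw [e4, Complex.re_ofReal_mul]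
  refine mul_nonneg (div_nonneg (ha n) (by positivity)) ?_
  have h5 : w.re ^ 2 + w.im ^ 2 = 1 := by
    have := Complex.sq_norm w
    rw [hwn, Complex.normSq_apply] at this
    nlinarith
  simp only [Complex.add_re, Complex.mul_re, pow_two]
  simp
  nlinarith [sq_nonneg (w.re + 1)]

lemma nonvanishing (a : ℕ → ℝ) (ha : ∀ n, 0 ≤ a n)
    (hs : ∀ s : ℂ, 1 < s.re → LSeriesSummable (fun n => (a n : ℂ)) s)
    {Z : ℂ → ℂ} {θ : ℝ} (hθ : θ < 1) (hZ : DifferentiableOn ℂ Z {s | θ < s.re}) (hZ1 : Z 1 ≠ 0)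
    (hode : ∀ s : ℂ, 1 < s.re → (s - 1) * deriv Z s = Z s - (s - 1) * LSeries (fun n => (a n : ℂ)) s * Z s)
    (s0 : ℂ) (hs0 : 1 ≤ s0.re) : Z s0 ≠ 0 := by
  have hopen : IsOpen {s : ℂ | θ < s.re} := isOpen_lt continuous_const Complex.continuous_re
  have han : AnalyticOnNhd ℂ Z {s | θ < s.re} := hZ.analyticOnNhd hopen
  have hpre : IsPreconnected {s : ℂ | θ < s.re} := (convex_halfSpace_re_gt θ).isPreconnected
  have hne : ∀ s : ℂ, θ < s.re → ¬ ∀ᶠ z in 𝓝 s, Z z = 0 := by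
    intro s hs h
    exact hZ1 (han.eqOn_zero_of_preconnected_of_eventuallyEq_zero hpre hs h (by simpa using hθ))
  set L := LSeries (fun n => (a n : ℂ)) with hL
  have key : ∀ s : ℂ, 1 ≤ s.re → ∃ m : ℕ, (m = 0 → Z s ≠ 0) ∧
      Tendsto (fun e : ℝ => (e : ℂ) * L (s + e)) (𝓝[>] 0) (𝓝 ((if s = 1 then 1 else 0) - (m : ℂ))) := by
    intro s hs1
    obtain ⟨m, hm, ht, hnz⟩ := logDeriv_order (han s (lt_of_lt_of_le hθ hs1)) (hne s (lt_of_lt_of_le hθ hs1))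
    refine ⟨m, hm, ?_⟩
    have hd : Tendsto (fun e : ℝ => (e : ℂ) / (s + e - 1)) (𝓝[>] 0) (𝓝 (if s = 1 then 1 else 0)) := by
      split_ifs with h
      · subst h
        refine tendsto_const_nhds.congr' ?_
        filter_upwards [self_mem_nhdsWithin] with e he
        have he' : (e : ℂ) ≠ 0 := by exact_mod_cast (ne_of_gt he : e ≠ 0)
        rw [add_sub_cancel_left, div_self he']
      · have h1 : Tendsto (fun e : ℝ => (e : ℂ)) (𝓝[>] 0) (𝓝 0) := by
          simpa using tendsto_pos_aux 0
        have := h1.div ((tendsto_pos_aux s).sub_const 1) (sub_ne_zero.mpr h)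
        rw [zero_div] at this
        exact this
    refine (hd.sub ht).congr' ?_
    filter_upwards [hnz, self_mem_nhdsWithin] with e h1 he
    have he : 0 < e := he
    have h2 : 1 < (s + e).re := by simp; linarith
    have h3 := hode _ h2
    have h4 : s + e - 1 ≠ 0 := by
      intro h; have := congrArg Complex.re h; simp at this; simp at h2; linarith
    have h5 : deriv Z (s + e) / Z (s + e) = 1 / (s + e - 1) - L (s + e) := by
      field_simp
      linear_combination h3
    rw [h5]; ring
  obtain ⟨m, hm, ht⟩ := key s0 hs0
  by_cases h01 : s0 = 1
  · rw [h01]; exact hZ1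
  rw [if_neg h01, zero_sub] at ht
  apply hm
  rcases hs0.lt_or_eq with h1 | h1
  · have hc : ContinuousAt L s0 :=
      (LSeries_hasDerivAt (abscissa_lt hs h1)).continuousAt
    have h2 : Tendsto (fun e : ℝ => (e : ℂ) * L (s0 + e)) (𝓝[>] 0) (𝓝 (0 * L s0)) := by
      refine Tendsto.mul ?_ (hc.tendsto.comp (tendsto_pos_aux s0))
      simpa using tendsto_pos_aux 0
    have h3 := tendsto_nhds_unique ht h2
    simpa using h3
  · set t := s0.im with ht'
    have es0 : s0 = 1 + t * Complex.I := by
      apply Complex.ext <;> simp [← h1, ht']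
    have ht0 : t ≠ 0 := by
      intro h; apply h01; rw [es0, h]; simp
    obtain ⟨m0, hm0, hT0⟩ := key 1 (by simp)
    obtain ⟨m2, hm2, hT2⟩ := key (1 + 2 * t * Complex.I) (by simp)
    have hn2 : (1 : ℂ) + 2 * t * Complex.I ≠ 1 := by
      intro h
      have := congrArg Complex.im h
      simp at this
      exact ht0 this
    rw [if_neg hn2, zero_sub] at hT2
    rw [if_pos rfl] at hT0
    have hT := ((hT0.const_mul 3).add (ht.const_mul 4)).add hT2
    have hT' := (Complex.continuous_re.tendsto _).comp hT
    have hge := ge_of_tendsto hT' (b := 0) (by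
      filter_upwards [self_mem_nhdsWithin] with e he
      have he : 0 < e := he
      have h := three_four_one a ha hs (σ := 1 + e) (by linarith) t
      have h2 : (3 * ((e : ℂ) * L (1 + e)) + 4 * ((e : ℂ) * L (s0 + e)) +
        (e : ℂ) * L (1 + 2 * t * Complex.I + e)) = (e : ℂ) * (3 * L ((1 + e : ℝ) : ℂ) +
          4 * L (((1 + e : ℝ) : ℂ) + t * Complex.I) + L (((1 + e : ℝ) : ℂ) + 2 * t * Complex.I)) := by
        have a1 : s0 + e = ((1 + e : ℝ) : ℂ) + t * Complex.I := by rw [es0]; push_cast; ring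
        have a2 : 1 + 2 * t * Complex.I + e = ((1 + e : ℝ) : ℂ) + 2 * t * Complex.I := by
          push_cast; ring
        have a3 : (1 : ℂ) + e = ((1 + e : ℝ) : ℂ) := by push_cast; ring
        rw [a1, a2, a3]; ring
      simp only [Function.comp]
      rw [h2, Complex.re_ofReal_mul]
      exact mul_nonneg he.le h)
    simp at hge
    have h6 : (4 * m + m2 + 3 * m0 : ℝ) ≤ 3 := by linarith
    have h7 : 4 * m + m2 + 3 * m0 ≤ 3 := by exact_mod_cast h6
    omega

end PIT


namespace PIT
open MeasureTheory Set Topology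
open NumberField
variable (K : Type*) [Field K] [NumberField K]

lemma exists_Z : ∃ (Z : ℂ → ℂ) (θ : ℝ), θ < 1 ∧ DifferentiableOn ℂ Z {s | θ < s.re} ∧ Z 1 ≠ 0 ∧
    ∀ s : ℂ, 1 < s.re → (s - 1) * deriv Z s =
      Z s - (s - 1) * LSeries (fun n => (LK K n : ℂ)) s * Z s := by
  obtain ⟨c, D, hW⟩ := W_asymp K
  have hn : (1 : ℝ) ≤ Module.finrank ℚ K := by exact_mod_cast Module.finrank_pos
  have hθ : 0 ≤ 1 - (Module.finrank ℚ K : ℝ)⁻¹ := by linarith [inv_le_one_of_one_le₀ hn]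
  have hθ1 : 1 - (Module.finrank ℚ K : ℝ)⁻¹ < 1 := by
    have : 0 < (Module.finrank ℚ K : ℝ)⁻¹ := by positivity
    linarith
  obtain ⟨Z, hZ, hZs⟩ := continuation (aK K) (aK_nonneg K) hθ hθ1 hW (fun s hs => aK_summable K hs)
  have hopen : IsOpen {s : ℂ | 1 - (Module.finrank ℚ K : ℝ)⁻¹ < s.re} :=
    isOpen_lt continuous_const Complex.continuous_re
  refine ⟨Z, _, hθ1, hZ, ?_, ?_⟩
  · have h1 : ContinuousAt Z 1 :=
      (hZ.differentiableAt (hopen.mem_nhds (by simpa using hθ1))).continuousAt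
    have h2 := tendsto_sub_one_mul_dedekindZeta_nhdsGT K
    have h3 : Tendsto (fun s : ℝ => Z s) (𝓝[>] 1) (𝓝 (Z 1)) := by
      have h4 : Tendsto (fun s : ℝ => (s : ℂ)) (𝓝[>] 1) (𝓝 1) := by
        have := (Complex.continuous_ofReal.tendsto 1)
        simp only [Complex.ofReal_one] at this
        exact this.mono_left nhdsWithin_le_nhds
      exact h1.tendsto.comp h4
    have h5 : Tendsto (fun s : ℝ => Z s) (𝓝[>] 1) (𝓝 (dedekindZeta_residue K : ℂ)) := by
      refine h2.congr' ?_
      filter_upwards [self_mem_nhdsWithin] with s hs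
      have hs : 1 < s := hs
      rw [hZs s (by simpa using hs)]
      simp [dedekindZeta, aK]
    rw [tendsto_nhds_unique h3 h5]
    exact_mod_cast dedekindZeta_residue_ne_zero K
  · intro s hs
    have hev : Z =ᶠ[𝓝 s] fun s => (s - 1) * LSeries (fun n => (aK K n : ℂ)) s := by
      filter_upwards [(isOpen_lt continuous_const Complex.continuous_re).mem_nhds
        (show s ∈ {s : ℂ | 1 < s.re} from hs)] with w hw using hZs w hw
    have hd := ((hasDerivAt_id s).sub_const 1).mul (zeta_deriv K hs)
    have hd' : HasDerivAt (fun s => (s - 1) * LSeries (fun n => (aK K n : ℂ)) s) _ s := hd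
    rw [hev.deriv_eq, hd'.deriv, hZs s hs]
    simp only [id]
    ring

lemma PsiF_mono : Monotone (PsiF K) := by
  intro x y hxy
  unfold PsiF
  exact Finset.sum_le_sum_of_subset_of_nonneg
    (Finset.Ioc_subset_Ioc_right (Nat.floor_le_floor hxy)) fun n _ _ => LK_nonneg K n

lemma PsiF_nonneg (x : ℝ) : 0 ≤ PsiF K x := Finset.sum_nonneg fun n _ => LK_nonneg K n

lemma PsiF_le_mul {x : ℝ} (hx : 0 ≤ x) : PsiF K x ≤ (Module.finrank ℚ K * (Real.log 4 + 4)) * x := by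
  refine (PsiF_le K x).trans ?_
  rw [mul_assoc]
  exact mul_le_mul_of_nonneg_left (Chebyshev.psi_le_const_mul_self hx) (by positivity)

/-- Normalised Chebyshev function. -/
noncomputable def BB (u : ℝ) : ℝ := PsiF K (exp u) * exp (-u)

lemma BB_nonneg (u : ℝ) : 0 ≤ BB K u := mul_nonneg (PsiF_nonneg K _) (exp_pos _).le
lemma BB_le (u : ℝ) : BB K u ≤ Module.finrank ℚ K * (Real.log 4 + 4) := by
  unfold BB
  have h := mul_le_mul_of_nonneg_right (PsiF_le_mul K (exp_pos u).le) (exp_pos (-u)).le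
  rwa [mul_assoc _ (exp u), ← exp_add, add_neg_cancel, exp_zero, mul_one] at h
lemma BB_meas : Measurable (BB K) := by
  unfold BB
  exact ((PsiF_mono K).measurable.comp measurable_exp).mul (measurable_exp.comp measurable_neg)
lemma BB_mul (u : ℝ) : BB K u * exp u = PsiF K (exp u) := by
  unfold BB; rw [mul_assoc, ← exp_add, neg_add_cancel, exp_zero, mul_one]

lemma laplace_BB {z : ℂ} (hz : 0 < z.re) :
    ∫ u in Ioi (0:ℝ), ((BB K u : ℝ) : ℂ) * Complex.exp (-z * u) =
      LSeries (fun n => (LK K n : ℂ)) (z + 1) / (z + 1) := by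
  have hs : 1 < (z + 1).re := by simpa using hz
  have hO : (fun n : ℕ => ∑ k ∈ Finset.Icc 1 n, LK K k) =O[atTop] fun n => (n : ℝ) ^ (1 : ℝ) := by
    refine Asymptotics.IsBigO.of_bound (Module.finrank ℚ K * (Real.log 4 + 4)) ?_
    refine Eventually.of_forall fun n => ?_
    have h := PsiF_le_mul K (x := n) (by positivity)
    have h0 := PsiF_nonneg K n
    unfold PsiF at h h0
    rw [Nat.floor_natCast, show Finset.Ioc 0 n = Finset.Icc 1 n from rfl] at h h0
    rw [rpow_one, norm_eq_abs, norm_eq_abs, abs_of_nonneg h0, abs_of_nonneg (by positivity : (0:ℝ) ≤ n)]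
    exact h
  have h := LSeries_eq_mul_integral_of_nonneg (LK K) zero_le_one hs hO (LK_nonneg K)
  have hne : z + 1 ≠ 0 := by intro h; rw [h] at hs; simp at hs; linarith
  rw [h, mul_div_cancel_left₀ _ hne]
  have h2 := integral_comp_exp_Ioi
    (fun t : ℝ => (∑ k ∈ Finset.Icc 1 ⌊t⌋₊, (LK K k : ℂ)) * (t : ℂ) ^ (-(z + 1 + 1))) 0
  rw [exp_zero] at h2
  rw [← h2]
  refine setIntegral_congr_fun measurableSet_Ioi fun u _ => ?_
  simp only [BB, PsiF]
  rw [show Finset.Ioc 0 ⌊exp u⌋₊ = Finset.Icc 1 ⌊exp u⌋₊ from rfl]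
  have e1 : ((exp u : ℝ) : ℂ) ^ (-(z + 1 + 1)) = Complex.exp (-(z + 1 + 1) * u) := by
    rw [Complex.cpow_def_of_ne_zero (by exact_mod_cast (exp_pos u).ne'), ← Complex.ofReal_log (exp_pos u).le,
      log_exp, mul_comm]
  rw [e1]
  rw [Complex.real_smul]
  push_cast
  have e2 : Complex.exp (-(z + 1 + 1) * u) = Complex.exp (-u) * Complex.exp (-u) * Complex.exp (-z * u) := by
    rw [← Complex.exp_add, ← Complex.exp_add]; ring_nf
  have e3 : Complex.exp u * Complex.exp (-u) = 1 := by
    rw [← Complex.exp_add]; simp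
  rw [e2]
  linear_combination -(∑ k ∈ Finset.Icc 1 ⌊exp u⌋₊, (LK K k : ℂ)) * Complex.exp (-u) * Complex.exp (-z * u) * e3

theorem PsiF_lower {a : ℝ} (ha : a < 1) : ∀ᶠ x in atTop, a * x ≤ PsiF K x := by
  obtain ⟨Z, θ, hθ, hZ, hZ1, hode⟩ := exists_Z K
  have hnv := nonvanishing (LK K) (LK_nonneg K) (fun s hs => LK_summable K hs) hθ hZ hZ1 hode
  have hopen : IsOpen {s : ℂ | θ < s.re} := isOpen_lt continuous_const Complex.continuous_re
  have hdz : ContinuousOn (deriv Z) {s | θ < s.re} := (hZ.deriv hopen).continuousOn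
  set G : ℂ → ℂ := fun z => -(1 + deriv Z (z + 1) / Z (z + 1)) / (z + 1) with hG
  have hmaps : MapsTo (fun z : ℂ => z + 1) {z | 0 ≤ z.re} {s | θ < s.re} := by
    intro z hz
    have hz : 0 ≤ z.re := hz
    show θ < (z + 1).re
    simp; linarith
  have hadd : ContinuousOn (fun z : ℂ => z + 1) {z | 0 ≤ z.re} := by fun_prop
  have hre : ∀ z : ℂ, 0 ≤ z.re → z + 1 ≠ 0 := by
    intro z hz h; have := congrArg Complex.re h; simp at this; linarith
  have hGc : ContinuousOn G {z | 0 ≤ z.re} := by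
    refine ContinuousOn.div (ContinuousOn.neg (continuousOn_const.add (ContinuousOn.div
      (hdz.comp hadd hmaps) (hZ.continuousOn.comp hadd hmaps) ?_))) hadd hre
    intro z hz
    exact hnv _ (by simpa using hz)
  have hLap : ∀ z : ℂ, 0 < z.re →
      ∫ u in Ioi (0:ℝ), ((BB K u - 1 : ℝ) : ℂ) * Complex.exp (-z * u) = G z := by
    intro z hz
    have hs : 1 < (z + 1).re := by simpa using hz
    have hz0 : z ≠ 0 := by rintro rfl; simp at hz
    have i1 : IntegrableOn (fun u : ℝ => Complex.exp (-z * u)) (Ioi 0) :=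
      integrableOn_exp_mul_complex_Ioi (by simpa using hz) 0
    have v1 : ∫ u in Ioi (0:ℝ), Complex.exp (-z * u) = 1 / z := by
      rw [integral_exp_mul_complex_Ioi (by simpa using hz) 0]
      simp
    have i2 : IntegrableOn (fun u : ℝ => ((BB K u : ℝ) : ℂ) * Complex.exp (-z * u)) (Ioi 0) := by
      refine Integrable.bdd_mul i1 (c := Module.finrank ℚ K * (Real.log 4 + 4))
        (Complex.measurable_ofReal.comp (BB_meas K)).aestronglyMeasurable ?_
      refine Eventually.of_forall fun u => ?_
      rw [Complex.norm_real, norm_eq_abs, abs_of_nonneg (BB_nonneg K u)]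
      exact BB_le K u
    have e : (fun u : ℝ => ((BB K u - 1 : ℝ) : ℂ) * Complex.exp (-z * u)) =
        fun u : ℝ => ((BB K u : ℝ) : ℂ) * Complex.exp (-z * u) - Complex.exp (-z * u) := by
      ext u; push_cast; ring
    rw [e, integral_sub i2 i1, v1, laplace_BB K hz, hG]
    have h1 := hode _ hs
    have h2 := hnv _ hs.le
    have h3 := hre z hz.le
    rw [add_sub_cancel_right] at h1
    field_simp
    linear_combination h1
  have h := tauberian (BB_meas K) (BB_nonneg K) (BB_le K)
    (fun u v huv => by rw [BB_mul, BB_mul]; exact PsiF_mono K (exp_le_exp.mpr huv)) hGc hLap ha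
  have h2 := tendsto_log_atTop.eventually h
  filter_upwards [h2, eventually_gt_atTop 0] with x hx hx0
  have := mul_le_mul_of_nonneg_right hx (exp_pos (log x)).le
  rwa [BB_mul, exp_log hx0] at this

end PIT


namespace PIT
open MeasureTheory Set Topology
open NumberField
variable (K : Type*) [Field K] [NumberField K]

theorem pi_lower : ∀ᶠ x : ℝ in atTop, 0.85 * x ≤
    ({𝔭 : Ideal (𝓞 K) | 𝔭.IsPrime ∧ 𝔭 ≠ ⊥ ∧ (Ideal.absNorm 𝔭 : ℝ) ≤ x}.ncard : ℝ) * Real.log x := by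
  obtain ⟨C, hC⟩ := Chebyshev.psi_sub_theta_le_mul_sqrt
  set n : ℝ := ((Module.finrank ℚ K : ℕ) : ℝ) with hn
  have hn0 : 0 ≤ n := by positivity
  have hs := tendsto_sqrt_atTop.eventually_ge_atTop (20 * (n * C))
  filter_upwards [PsiF_lower K (show (0.9 : ℝ) < 1 by norm_num), eventually_ge_atTop 1, hs] with x h1 h2 h3
  have h4 := PsiF_le_pi K h2
  have h5 := mul_le_mul_of_nonneg_left (hC x) hn0
  have h6 : √x * √x = x := mul_self_sqrt (by linarith)
  have h7 := mul_le_mul_of_nonneg_right h3 (sqrt_nonneg x)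
  rw [h6] at h7
  nlinarith

end PIT

/-- Let `F` be a number field. If a set `P` of nonzero prime ideals of `O_F`
has natural density `ρ > 0` among all nonzero prime ideals (counted by absolute norm),
then for all sufficiently large real `g`, the set `{𝔭 ∈ P : q_𝔭 + 1 < g}` has
cardinality at least `(ρ/2)·g/log g`. -/
theorem stmt_5 (F : Type*) [Field F] [NumberField F]
    (P : Set (Ideal (NumberField.RingOfIntegers F)))
    (hP : ∀ 𝔭 ∈ P, 𝔭.IsPrime ∧ 𝔭 ≠ ⊥)
    (ρ : ℝ) (hρ : 0 < ρ)
    (hdens : Tendsto (fun x : ℝ =>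
        (({𝔭 | 𝔭 ∈ P ∧ (Ideal.absNorm 𝔭 : ℝ) ≤ x}.ncard : ℝ) /
          ({𝔭 : Ideal (NumberField.RingOfIntegers F) |
              𝔭.IsPrime ∧ 𝔭 ≠ ⊥ ∧ (Ideal.absNorm 𝔭 : ℝ) ≤ x}.ncard : ℝ)))
      atTop (nhds ρ)) :
    ∀ᶠ g : ℝ in atTop,
      (ρ / 2) * g / Real.log g ≤
        (({𝔭 | 𝔭 ∈ P ∧ (Ideal.absNorm 𝔭 : ℝ) + 1 < g}.ncard : ℝ)) := by
  have hd := hdens.eventually (lt_mem_nhds (show 0.7 * ρ < ρ by linarith))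
  have hg2 : Tendsto (fun g : ℝ => g - 2) atTop atTop := tendsto_atTop_add_const_right _ _ tendsto_id
  filter_upwards [hg2.eventually (hd.and (PIT.pi_lower F)), eventually_ge_atTop 20] with g ⟨h1, h2⟩ hg
  set A : ℝ := (({𝔭 | 𝔭 ∈ P ∧ (Ideal.absNorm 𝔭 : ℝ) ≤ g - 2}.ncard : ℕ) : ℝ) with hA
  set B : ℝ := (({𝔭 : Ideal (NumberField.RingOfIntegers F) |
              𝔭.IsPrime ∧ 𝔭 ≠ ⊥ ∧ (Ideal.absNorm 𝔭 : ℝ) ≤ g - 2}.ncard : ℕ) : ℝ) with hB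
  have hl2 : 0 < Real.log (g - 2) := Real.log_pos (by linarith)
  have hll : Real.log (g - 2) ≤ Real.log g := Real.log_le_log (by linarith) (by linarith)
  have hB0 : 0 < B := by
    by_contra hcon
    have : B * Real.log (g - 2) ≤ 0 := mul_nonpos_of_nonpos_of_nonneg (not_lt.mp hcon) hl2.le
    nlinarith
  have hAB : 0.7 * ρ * B ≤ A := by
    rw [lt_div_iff₀ hB0] at h1
    exact h1.le
  have hfin : {𝔭 | 𝔭 ∈ P ∧ (Ideal.absNorm 𝔭 : ℝ) + 1 < g}.Finite := by
    refine (PIT.finite_primes F g).subset ?_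
    rintro 𝔭 ⟨h, h'⟩
    exact ⟨(hP 𝔭 h).1, (hP 𝔭 h).2, by linarith⟩
  have hsub : A ≤ ({𝔭 | 𝔭 ∈ P ∧ (Ideal.absNorm 𝔭 : ℝ) + 1 < g}.ncard : ℝ) := by
    rw [hA]
    exact_mod_cast Set.ncard_le_ncard (by
      rintro 𝔭 ⟨h, h'⟩
      exact ⟨h, by linarith⟩) hfin
  refine le_trans ?_ hsub
  rw [div_le_iff₀ (by linarith)]
  have h3 : B * Real.log (g - 2) ≤ B * Real.log g := mul_le_mul_of_nonneg_left hll hB0.le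
  have h4 : 0.7 * ρ * B * Real.log g ≤ A * Real.log g :=
    mul_le_mul_of_nonneg_right hAB (by linarith)
  have h5 : 0.7 * ρ * (0.85 * (g - 2)) ≤ 0.7 * ρ * (B * Real.log g) :=
    mul_le_mul_of_nonneg_left (h2.trans h3) (by positivity)
  nlinarith [mul_le_mul_of_nonneg_left hg hρ.le]
end
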